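/- arXiv:0912.3381 — 3 statements merged into one kernel-verified Lean document; each statement's English description precedes it below -/
import Mathlib

section
/- Let E ⊆ ℤ² be a subset with positive upper Banach density d*(E) > 0. Then for every ε > 0, the set {n ∈ ℤ : d*(E ∩ (E + (n,0)) ∩ (E + (0,n))) > d*(E)⁴ − ε} is syndetic. -/
open MeasureTheory

/-- A set `E ⊆ ℤ` is syndetic if there is `N > 0` such that every interval
`[M, M+N)` meets `E`. -/
def Syndetic (E : Set ℤ) : Prop :=
  ∃ N : ℤ, 0 < N ∧ ∀ M : ℤ, ∃ n ∈ E, M ≤ n ∧ n < M + N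

/-- The upper Banach density of a subset of `ℤ²`: the limsup, as both side
lengths of a rectangle `[M₁,N₁) × [M₂,N₂)` tend to infinity, of the proportion
of points of the rectangle lying in the set.  The limsup along this net is
expressed as the infimum over `L` of the supremum over all rectangles both of
whose sides have length at least `L`. -/
noncomputable def upperBanachDensity (E : Set (ℤ × ℤ)) : ℝ :=
  ⨅ L : ℕ, ⨆ M₁ : ℤ, ⨆ N₁ : ℤ, ⨆ M₂ : ℤ, ⨆ N₂ : ℤ,
    ⨆ _ : M₁ + L ≤ N₁, ⨆ _ : M₂ + L ≤ N₂,
      ((E ∩ Set.Ico M₁ N₁ ×ˢ Set.Ico M₂ N₂).ncard : ℝ) /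
        (((N₁ - M₁) * (N₂ - M₂) : ℤ) : ℝ)

namespace BanachCorner

open Filter Topology

/-- Boundedness of a real function on a bare type. -/
def Bdd {Ω : Type} (F : Ω → ℝ) : Prop := ∃ C, ∀ ω, |F ω| ≤ C

section Bdd

variable {Ω Ω' : Type} {F G : Ω → ℝ}

theorem Bdd.nonneg_bound (h : Bdd F) : ∃ C, 0 ≤ C ∧ ∀ ω, |F ω| ≤ C := by
  obtain ⟨C, hC⟩ := h
  exact ⟨|C|, abs_nonneg _, fun ω => (hC ω).trans (le_abs_self C)⟩

theorem Bdd.const (c : ℝ) : Bdd (fun _ : Ω => c) := ⟨|c|, fun _ => le_rfl⟩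

theorem Bdd.add (hF : Bdd F) (hG : Bdd G) : Bdd (fun ω => F ω + G ω) := by
  obtain ⟨C, hC⟩ := hF
  obtain ⟨D, hD⟩ := hG
  exact ⟨C + D, fun ω => (abs_add_le _ _).trans (add_le_add (hC ω) (hD ω))⟩

theorem Bdd.neg (hF : Bdd F) : Bdd (fun ω => -F ω) := by
  obtain ⟨C, hC⟩ := hF
  exact ⟨C, fun ω => by rw [abs_neg]; exact hC ω⟩

theorem Bdd.sub (hF : Bdd F) (hG : Bdd G) : Bdd (fun ω => F ω - G ω) := by
  simpa only [sub_eq_add_neg] using hF.add hG.neg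

theorem Bdd.mul (hF : Bdd F) (hG : Bdd G) : Bdd (fun ω => F ω * G ω) := by
  obtain ⟨C, hC0, hC⟩ := hF.nonneg_bound
  obtain ⟨D, hD⟩ := hG
  exact ⟨C * D, fun ω => by
    rw [abs_mul]; exact mul_le_mul (hC ω) (hD ω) (abs_nonneg _) hC0⟩

theorem Bdd.pow (hF : Bdd F) (n : ℕ) : Bdd (fun ω => F ω ^ n) := by
  obtain ⟨C, hC⟩ := hF
  exact ⟨C ^ n, fun ω => by
    rw [abs_pow]; exact pow_le_pow_left₀ (abs_nonneg _) (hC ω) n⟩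

theorem Bdd.abs (hF : Bdd F) : Bdd (fun ω => |F ω|) := by
  obtain ⟨C, hC⟩ := hF
  exact ⟨C, fun ω => by rw [abs_abs]; exact hC ω⟩

theorem Bdd.comp (hF : Bdd F) (T : Ω' → Ω) : Bdd (fun ω => F (T ω)) := by
  obtain ⟨C, hC⟩ := hF
  exact ⟨C, fun ω => hC _⟩

theorem Bdd.of_finite {γ : Type} [Finite γ] (Φ : γ → ℝ) : Bdd Φ := by
  obtain ⟨C, hC⟩ := (Set.finite_range fun x => |Φ x|).bddAbove
  exact ⟨C, fun x => hC ⟨x, rfl⟩⟩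

theorem Bdd.sum {ι : Type*} (s : Finset ι) {F : ι → Ω → ℝ} (h : ∀ i ∈ s, Bdd (F i)) :
    Bdd (fun ω => ∑ i ∈ s, F i ω) := by
  classical
  induction s using Finset.induction_on with
  | empty => simpa using Bdd.const 0
  | insert a s ha ih =>
    simp only [Finset.sum_insert ha]
    exact (h a (by simp)).add (ih fun i hi => h i (by simp [hi]))

theorem Bdd.of_le {C : ℝ} (h : ∀ ω, |F ω| ≤ C) : Bdd F := ⟨C, h⟩

end Bdd

/-- A finitely additive probability on all subsets of `Ω`, given as a functional. Only its values
on bounded functions matter. -/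
structure Mean (Ω : Type) where
  toLin : (Ω → ℝ) →ₗ[ℝ] ℝ
  map_one : toLin (fun _ => 1) = 1
  nonneg' : ∀ F, Bdd F → (∀ ω, 0 ≤ F ω) → 0 ≤ toLin F

namespace Mean

variable {Ω Ω' : Type}

instance : CoeFun (Mean Ω) (fun _ => (Ω → ℝ) → ℝ) := ⟨fun m => ⇑m.toLin⟩

variable (m : Mean Ω) {F G : Ω → ℝ}

theorem add (F G : Ω → ℝ) : m (fun ω => F ω + G ω) = m F + m G := m.toLin.map_add F G

theorem sub (F G : Ω → ℝ) : m (fun ω => F ω - G ω) = m F - m G := m.toLin.map_sub F G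

theorem neg (F : Ω → ℝ) : m (fun ω => -F ω) = -m F := m.toLin.map_neg F

theorem smul (c : ℝ) (F : Ω → ℝ) : m (fun ω => c * F ω) = c * m F := m.toLin.map_smul c F

theorem mul_const (c : ℝ) (F : Ω → ℝ) : m (fun ω => F ω * c) = m F * c := by
  rw [mul_comm, ← smul]; simp only [mul_comm]

theorem const (c : ℝ) : m (fun _ => c) = c := by
  have := m.smul c (fun _ => 1)
  rw [show m (fun _ => 1) = 1 from m.map_one] at this
  simpa using this

theorem sum {ι : Type*} (s : Finset ι) (F : ι → Ω → ℝ) :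
    m (fun ω => ∑ i ∈ s, F i ω) = ∑ i ∈ s, m (F i) := by
  have := map_sum m.toLin F s
  rw [← this]
  congr 1
  ext ω
  simp

theorem nonneg (hF : Bdd F) (h : ∀ ω, 0 ≤ F ω) : 0 ≤ m F := m.nonneg' F hF h

theorem mono (hF : Bdd F) (hG : Bdd G) (h : ∀ ω, F ω ≤ G ω) : m F ≤ m G := by
  have := m.nonneg (hG.sub hF) (fun ω => sub_nonneg.2 (h ω))
  rw [sub] at this
  linarith

theorem le_of_le (hF : Bdd F) {c : ℝ} (h : ∀ ω, F ω ≤ c) : m F ≤ c :=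
  (m.mono hF (Bdd.const c) h).trans_eq (m.const c)

theorem abs_le_abs (hF : Bdd F) : |m F| ≤ m (fun ω => |F ω|) := by
  rw [abs_le]
  constructor
  · rw [← neg]
    exact m.mono hF.abs.neg hF fun ω => neg_abs_le _
  · exact m.mono hF hF.abs fun ω => le_abs_self _

theorem abs_le_of_le {c : ℝ} (h : ∀ ω, |F ω| ≤ c) : |m F| ≤ c := by
  have hF : Bdd F := ⟨c, h⟩
  exact (m.abs_le_abs hF).trans (m.le_of_le hF.abs h)

theorem cauchy_schwarz (hF : Bdd F) (hG : Bdd G) :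
    m (fun ω => F ω * G ω) ^ 2 ≤ m (fun ω => F ω ^ 2) * m (fun ω => G ω ^ 2) := by
  have key : ∀ t : ℝ, 0 ≤ m (fun ω => F ω ^ 2) * (t * t) +
      (2 * m (fun ω => F ω * G ω)) * t + m (fun ω => G ω ^ 2) := by
    intro t
    have h1 : 0 ≤ m (fun ω => (t * F ω + G ω) ^ 2) :=
      m.nonneg ((((Bdd.const t).mul hF).add hG).pow 2) fun ω => sq_nonneg _
    have h2 : (fun ω => (t * F ω + G ω) ^ 2) =
        fun ω => ((t * t) * F ω ^ 2 + (2 * t) * (F ω * G ω)) + G ω ^ 2 := by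
      ext ω; ring
    rw [h2, add, add, smul, smul] at h1
    linarith
  have := discrim_le_zero key
  rw [discrim] at this
  linarith

theorem sq_le (hF : Bdd F) : m F ^ 2 ≤ m (fun ω => F ω ^ 2) := by
  have := m.cauchy_schwarz hF (Bdd.const 1)
  simpa [m.const] using this

theorem abs_le_sqrt (hF : Bdd F) : |m F| ≤ √(m (fun ω => F ω ^ 2)) :=
  Real.abs_le_sqrt (m.sq_le hF)

/-- Push-forward of a mean. -/
def map (T : Ω → Ω') : Mean Ω' where
  toLin := m.toLin ∘ₗ LinearMap.funLeft ℝ ℝ T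
  map_one := m.map_one
  nonneg' _ hF h := m.nonneg (hF.comp T) fun _ => h _

theorem map_apply (T : Ω → Ω') (F : Ω' → ℝ) : m.map T F = m (fun ω => F (T ω)) := rfl

/-- Integration of a family of means. -/
def bind (k : Ω → Mean Ω') : Mean Ω' where
  toLin :=
    { toFun := fun F => m (fun ω => k ω F)
      map_add' := fun F G => by
        rw [← m.add]; congr 1; ext ω; exact (k ω).toLin.map_add F G
      map_smul' := fun c F => by
        rw [RingHom.id_apply, smul_eq_mul, ← m.smul]
        congr 1; ext ω; exact (k ω).toLin.map_smul c F }
  map_one := by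
    change m (fun ω => k ω (fun _ => 1)) = 1
    simp only [Mean.const]
  nonneg' F hF h := by
    obtain ⟨C, hC⟩ := hF
    exact m.nonneg ⟨C, fun ω => (k ω).abs_le_of_le hC⟩ fun ω => (k ω).nonneg ⟨C, hC⟩ h

/-- Product of means: the second factor is integrated first. -/
def prod (m' : Mean Ω') : Mean (Ω × Ω') := m.bind fun ω => m'.map fun y => (ω, y)

theorem prod_apply (m' : Mean Ω') (F : Ω × Ω' → ℝ) :
    m.prod m' F = m (fun ω => m' (fun y => F (ω, y))) := rfl

theorem bdd_mean {Ω Ω' : Type} (k : Ω → Mean Ω') {F : Ω → Ω' → ℝ}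
    (hF : ∃ C, ∀ ω y, |F ω y| ≤ C) : Bdd (fun ω => k ω (F ω)) := by
  obtain ⟨C, hC⟩ := hF
  exact ⟨C, fun ω => (k ω).abs_le_of_le (hC ω)⟩

/-- Uniform average over a nonempty finite set of points. -/
noncomputable def avg {ι : Type} (s : Finset ι) (hs : s.Nonempty) (x : ι → Ω) : Mean Ω where
  toLin :=
    { toFun := fun F => (∑ i ∈ s, F (x i)) / s.card
      map_add' := fun F G => by simp [Finset.sum_add_distrib, add_div]
      map_smul' := fun c F => by simp [← Finset.mul_sum, mul_div_assoc] }
  map_one := by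
    have : (s.card : ℝ) ≠ 0 := by exact_mod_cast hs.card_pos.ne'
    simp [this]
  nonneg' _ _ h := div_nonneg (Finset.sum_nonneg fun _ _ => h _) (Nat.cast_nonneg _)

theorem avg_apply {ι : Type} (s : Finset ι) (hs : s.Nonempty) (x : ι → Ω) (F : Ω → ℝ) :
    avg s hs x F = (∑ i ∈ s, F (x i)) / s.card := rfl

/-- A functional on bounded functions that is linear, positive and normalised comes from a mean. -/
theorem exists_of_bdd (L : (Ω → ℝ) → ℝ)
    (hadd : ∀ F G, Bdd F → Bdd G → L (fun ω => F ω + G ω) = L F + L G)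
    (hsmul : ∀ c F, Bdd F → L (fun ω => c * F ω) = c * L F)
    (hone : L (fun _ => 1) = 1)
    (hnonneg : ∀ F, Bdd F → (∀ ω, 0 ≤ F ω) → 0 ≤ L F) :
    ∃ m : Mean Ω, ∀ F, Bdd F → m F = L F := by
  let B : Submodule ℝ (Ω → ℝ) :=
    { carrier := {F | Bdd F}
      add_mem' := fun {F G} hF hG => hF.add hG
      zero_mem' := Bdd.const 0
      smul_mem' := fun c F hF => (Bdd.const c).mul hF }
  let l : B →ₗ[ℝ] ℝ :=
    { toFun := fun F => L F
      map_add' := fun F G => hadd F G F.2 G.2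
      map_smul' := fun c F => hsmul c F F.2 }
  obtain ⟨g, hg⟩ := LinearMap.exists_extend l
  have key : ∀ F, Bdd F → g F = L F := fun F hF => LinearMap.congr_fun hg ⟨F, hF⟩
  exact ⟨⟨g, by rw [key _ (Bdd.const 1), hone], fun F hF h => by
    rw [key F hF]; exact hnonneg F hF h⟩, key⟩

theorem exists_ultralimit {ι : Type*} (U : Ultrafilter ι) (μ : ι → Mean Ω) :
    ∃ m : Mean Ω, ∀ F, Bdd F → Tendsto (fun i => μ i F) U (𝓝 (m F)) := by
  have hlim : ∀ F, Bdd F → ∃ x, Tendsto (fun i => μ i F) U (𝓝 x) := by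
    rintro F ⟨C, hC⟩
    have : (↑(Ultrafilter.map (fun i => μ i F) U) : Filter ℝ) ≤ 𝓟 (Set.Icc (-C) C) := by
      rw [le_principal_iff]
      exact Filter.mem_map.2 (Filter.univ_mem' fun i => abs_le.1 ((μ i).abs_le_of_le hC))
    obtain ⟨x, -, hx⟩ := isCompact_Icc.ultrafilter_le_nhds _ this
    exact ⟨x, hx⟩
  classical
  let L : (Ω → ℝ) → ℝ := fun F => limUnder (U : Filter ι) (fun i : ι => μ i F)
  have hL : ∀ F, Bdd F → Tendsto (fun i => μ i F) U (𝓝 (L F)) := fun F hF =>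
    tendsto_nhds_limUnder (hlim F hF)
  obtain ⟨m, hm⟩ := exists_of_bdd L
    (fun F G hF hG => tendsto_nhds_unique (hL _ (hF.add hG)) (by
      simpa only [Mean.add] using (hL F hF).add (hL G hG)))
    (fun c F hF => tendsto_nhds_unique (hL _ ((Bdd.const c).mul hF)) (by
      simpa only [Mean.smul] using (hL F hF).const_mul c))
    (tendsto_nhds_unique (hL _ (Bdd.const 1)) (by
      simp only [Mean.const]; exact tendsto_const_nhds))
    (fun F hF h => ge_of_tendsto' (hL F hF) fun i => (μ i).nonneg hF h)
  exact ⟨m, fun F hF => by rw [hm F hF]; exact hL F hF⟩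

end Mean

/-- Invariance of a mean under a bijection. -/
def Mean.Inv {Ω : Type} (m : Mean Ω) (T : Equiv.Perm Ω) : Prop :=
  ∀ F, Bdd F → m (fun ω => F (T ω)) = m F

namespace Mean.Inv

variable {Ω : Type} {m : Mean Ω} {T S : Equiv.Perm Ω}

theorem mul (hT : m.Inv T) (hS : m.Inv S) : m.Inv (T * S) := fun F hF => by
  have := hS (fun ω => F (T ω)) (hF.comp T)
  simp only [Equiv.Perm.mul_apply]
  rw [this, hT F hF]

theorem symm (hT : m.Inv T) : m.Inv T⁻¹ := fun F hF => by
  rw [← hT (fun ω => F (T⁻¹ ω)) (hF.comp _)]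
  simp

theorem one : m.Inv 1 := fun F _ => by simp

theorem zpow (hT : m.Inv T) (n : ℤ) : m.Inv (T ^ n) := by
  have hpow : ∀ k : ℕ, m.Inv (T ^ k) := by
    intro k
    induction k with
    | zero => simpa using one
    | succ k ih => rw [pow_succ]; exact ih.mul hT
  obtain ⟨k, rfl | rfl⟩ := n.eq_nat_or_neg
  · simpa using hpow k
  · simpa using (hpow k).symm

end Mean.Inv

theorem zpow_invariant {Ω : Type} {R : Equiv.Perm Ω} {γ : Type*} {F : Ω → γ}
    (h : ∀ ω, F (R ω) = F ω) (n : ℤ) (ω : Ω) : F ((R ^ n) ω) = F ω := by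
  have hinv : ∀ ω, F (R⁻¹ ω) = F ω := fun ω => by rw [← h (R⁻¹ ω)]; simp
  induction n using Int.induction_on generalizing ω with
  | zero => simp
  | succ n ih => rw [zpow_add_one, Equiv.Perm.mul_apply, ih, h]
  | pred n ih => rw [zpow_sub_one, Equiv.Perm.mul_apply, ih, hinv]

/-- The `N`-th Fejér average on `ℤ`. -/
noncomputable def fejerAvg (N : ℕ) : Mean ℤ :=
  Mean.avg (Finset.range (N + 1) ×ˢ Finset.range (N + 1))
    (by simp) (fun p => (p.2 : ℤ) - p.1)

theorem fejerAvg_apply (N : ℕ) (c : ℤ → ℝ) :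
    fejerAvg N c = (∑ a ∈ Finset.range (N + 1), ∑ b ∈ Finset.range (N + 1), c ((b : ℤ) - a)) /
      ((N + 1) * (N + 1) : ℝ) := by
  rw [fejerAvg, Mean.avg_apply, Finset.sum_product]
  simp

/-- A limit of Fejér averages. -/
noncomputable def fejer : Mean ℤ :=
  Classical.choose (Mean.exists_ultralimit (hyperfilter ℕ) fejerAvg)

theorem tendsto_fejer {c : ℤ → ℝ} (hc : Bdd c) :
    Tendsto (fun N => fejerAvg N c) (hyperfilter ℕ : Ultrafilter ℕ) (𝓝 (fejer c)) :=
  Classical.choose_spec (Mean.exists_ultralimit (hyperfilter ℕ) fejerAvg) c hc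

theorem hyperfilter_le : ((hyperfilter ℕ : Ultrafilter ℕ) : Filter ℕ) ≤ atTop :=
  Nat.hyperfilter_le_atTop

theorem fejer_shift {c : ℤ → ℝ} (hc : Bdd c) : fejer (fun a => c (a + 1)) = fejer c := by
  obtain ⟨C, hC0, hC⟩ := hc.nonneg_bound
  have h1 := (tendsto_fejer (hc.comp (fun a : ℤ => a + 1))).sub (tendsto_fejer hc)
  have h2 : Tendsto (fun N : ℕ => fejerAvg N (fun a => c (a + 1)) - fejerAvg N c)
      (hyperfilter ℕ : Ultrafilter ℕ) (𝓝 0) := by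
    have h3 : Tendsto (fun N : ℕ => 2 * C * (1 / ((N : ℝ) + 1))) atTop (𝓝 0) := by
      simpa using tendsto_one_div_add_atTop_nhds_zero_nat.const_mul (2 * C)
    refine squeeze_zero_norm (fun N => ?_) (h3.mono_left hyperfilter_le)
    have hN : (0 : ℝ) < N + 1 := by positivity
    rw [fejerAvg_apply, fejerAvg_apply, ← sub_div, ← Finset.sum_sub_distrib, Real.norm_eq_abs,
      abs_div, abs_of_pos (mul_pos hN hN), div_le_iff₀ (mul_pos hN hN)]
    calc _ ≤ ∑ a ∈ Finset.range (N + 1), (2 * C) := by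
          refine (Finset.abs_sum_le_sum_abs _ _).trans (Finset.sum_le_sum fun a _ => ?_)
          rw [← Finset.sum_sub_distrib]
          have := Finset.sum_range_sub (fun b : ℕ => c ((b : ℤ) - a)) (N + 1)
          have e : ∀ b : ℕ, c ((b : ℤ) - a + 1) = c (((b + 1 : ℕ) : ℤ) - a) := fun b => by
            congr 1; push_cast; ring
          simp only [e]
          rw [this]
          refine (abs_sub _ _).trans ?_
          linarith [hC (((N + 1 : ℕ) : ℤ) - a), hC (((0 : ℕ) : ℤ) - a)]
      _ = _ := by
          rw [Finset.sum_const, Finset.card_range, nsmul_eq_mul]; push_cast; field_simp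
  exact sub_eq_zero.1 (tendsto_nhds_unique h1 h2)

/-- Elimination of an invariant factor by the Cauchy-Schwarz inequality. -/
theorem sq_mean_mul_le {Y : Type} (M : Mean Y) (R : Equiv.Perm Y) (hR : M.Inv R)
    {F G : Y → ℝ} (hF : ∀ y, F (R y) = F y) (hF1 : ∀ y, |F y| ≤ 1) (hG : Bdd G) :
    M (fun y => G y * F y) ^ 2 ≤ fejer (fun a => M (fun y => G y * G ((R ^ a) y))) := by
  have hFb : Bdd F := ⟨1, hF1⟩
  have hc : Bdd (fun a : ℤ => M (fun y => G y * G ((R ^ a) y))) := by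
    obtain ⟨C, hC0, hC⟩ := hG.nonneg_bound
    refine ⟨C * C, fun a => M.abs_le_of_le fun y => ?_⟩
    rw [abs_mul]
    exact mul_le_mul (hC _) (hC _) (abs_nonneg _) hC0
  refine ge_of_tendsto' (tendsto_fejer hc) fun N => ?_
  set n : ℝ := N + 1 with hn
  have hn0 : 0 < n := by positivity
  let A : Y → ℝ := fun y => ∑ a ∈ Finset.range (N + 1), G ((R ^ (a : ℤ)) y)
  have hA : Bdd A := Bdd.sum _ fun a _ => hG.comp _
  have h1 : M (fun y => A y * F y) = n * M (fun y => G y * F y) := by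
    have : (fun y => A y * F y) =
        fun y => ∑ a ∈ Finset.range (N + 1), (fun z => G z * F z) ((R ^ (a : ℤ)) y) := by
      ext y
      simp only [A, Finset.sum_mul, zpow_invariant hF]
    rw [this, M.sum]
    have h2 : ∀ a ∈ Finset.range (N + 1),
        M (fun y => (fun z => G z * F z) ((R ^ (a : ℤ)) y)) = M (fun y => G y * F y) :=
      fun a _ => hR.zpow a _ (hG.mul hFb)
    rw [Finset.sum_congr rfl h2]
    simp [hn]
  have h2 : M (fun y => A y ^ 2) = n * n * fejerAvg N (fun a => M (fun y => G y * G ((R ^ a) y))) := by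
    rw [fejerAvg_apply, ← hn, mul_div_cancel₀ _ (by positivity)]
    have : (fun y => A y ^ 2) = fun y => ∑ a ∈ Finset.range (N + 1),
        ∑ b ∈ Finset.range (N + 1), G ((R ^ (a : ℤ)) y) * G ((R ^ (b : ℤ)) y) := by
      ext y
      simp only [A, sq, Finset.sum_mul_sum]
    rw [this, M.sum]
    refine Finset.sum_congr rfl fun a _ => ?_
    rw [M.sum]
    refine Finset.sum_congr rfl fun b _ => ?_
    rw [← hR.zpow a (fun y => G y * G ((R ^ ((b : ℤ) - a)) y)) (hG.mul (hG.comp _))]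
    simp only [← Equiv.Perm.mul_apply, ← zpow_add]
    simp
  have h3 := M.cauchy_schwarz hA hFb
  have h4 : M (fun y => F y ^ 2) ≤ 1 := M.le_of_le (hFb.pow 2) fun y => by
    rw [← sq_abs]; exact pow_le_one₀ (abs_nonneg _) (hF1 y)
  have h5 : 0 ≤ M (fun y => A y ^ 2) := M.nonneg (hA.pow 2) fun y => sq_nonneg _
  have h6 : (n * M (fun y => G y * F y)) ^ 2 ≤ M (fun y => A y ^ 2) := by
    rw [← h1]; nlinarith
  rw [h2] at h6
  have : n * n * M (fun y => G y * F y) ^ 2 ≤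
      n * n * fejerAvg N (fun a => M (fun y => G y * G ((R ^ a) y))) := by nlinarith
  exact le_of_mul_le_mul_left this (by positivity)

theorem fejer_autocorr_nonneg {Y : Type} (M : Mean Y) (R : Equiv.Perm Y) (hR : M.Inv R)
    {G : Y → ℝ} (hG : Bdd G) : 0 ≤ fejer (fun a => M (fun y => G y * G ((R ^ a) y))) :=
  (sq_nonneg _).trans (sq_mean_mul_le M R hR (F := fun _ => 1) (fun _ => rfl) (by simp) hG)

/-- Two commuting bijections together with an invariant mean. -/
structure Sys where
  Ω : Type
  T₁ : Equiv.Perm Ω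
  T₂ : Equiv.Perm Ω
  comm : Commute T₁ T₂
  m : Mean Ω
  inv₁ : m.Inv T₁
  inv₂ : m.Inv T₂

/-- The box correlation of a function along the two actions. -/
noncomputable def Sys.box (X : Sys) (g : X.Ω → ℝ) : ℝ :=
  fejer fun b => fejer fun a => X.m fun ω =>
    (g ω * g ((X.T₂ ^ (-b)) ω)) * (g ((X.T₁ ^ (-a)) ω) * g ((X.T₂ ^ (-b)) ((X.T₁ ^ (-a)) ω)))

/-- Shift invariance of a mean on the integers. -/
def ShiftInv (l : Mean ℤ) : Prop := l.Inv (Equiv.addRight 1)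

theorem prod_inv {Ω Ω' : Type} {m : Mean Ω} {m' : Mean Ω'} {T : Equiv.Perm Ω} {S : Equiv.Perm Ω'}
    (hT : m.Inv T) (hS : m'.Inv S) : (m.prod m').Inv (Equiv.prodCongr T S) := by
  intro F hF
  obtain ⟨C, hC⟩ := hF
  rw [Mean.prod_apply, Mean.prod_apply,
    ← hT (fun ω => m' (fun y => F (ω, y))) (Mean.bdd_mean _ ⟨C, fun _ _ => hC _⟩)]
  congr 1
  ext ω
  exact hS (fun y => F (T ω, y)) ⟨C, fun _ => hC _⟩

theorem prodCongr_zpow {Ω Ω' : Type} (T : Equiv.Perm Ω) (S : Equiv.Perm Ω') (n : ℤ)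
    (p : Ω × Ω') : ((Equiv.prodCongr T S : Equiv.Perm (Ω × Ω')) ^ n) p =
      ((T ^ n) p.1, (S ^ n) p.2) := by
  induction n using Int.induction_on generalizing p with
  | zero => simp
  | succ n ih =>
    simp only [zpow_add_one, Equiv.Perm.mul_apply, ih]
    rfl
  | pred n ih =>
    simp only [zpow_sub_one, Equiv.Perm.mul_apply, ih]
    rfl

theorem addRight_zpow (n k : ℤ) : ((Equiv.addRight (1 : ℤ) : Equiv.Perm ℤ) ^ n) k = k + n := by
  induction n using Int.induction_on generalizing k with
  | zero => simp
  | succ n ih => simp only [zpow_add_one, Equiv.Perm.mul_apply, ih]; simp; ring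
  | pred n ih =>
    simp only [zpow_sub_one, Equiv.Perm.mul_apply, ih]
    change k - 1 + _ = _
    ring

theorem mul_abs_le {a b A B : ℝ} (ha : |a| ≤ A) (hb : |b| ≤ B) : |a * b| ≤ A * B := by
  rw [abs_mul]
  exact mul_le_mul ha hb (abs_nonneg _) ((abs_nonneg _).trans ha)

theorem van_der_corput (X : Sys) {l : Mean ℤ} (hl : ShiftInv l) {f₀ f₁ f₂ : X.Ω → ℝ}
    (h₀ : Bdd f₀) (h₁ : ∀ ω, |f₁ ω| ≤ 1) (h₂ : ∀ ω, |f₂ ω| ≤ 1) :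
    l (fun n => X.m fun ω => f₀ ω * f₁ ((X.T₁ ^ n) ω) * f₂ ((X.T₂ ^ n) ω)) ^ 4 ≤ X.box f₀ := by
  obtain ⟨C, hC0, hC⟩ := h₀.nonneg_bound
  let M : Mean (ℤ × X.Ω) := l.prod X.m
  let R₁ : Equiv.Perm (ℤ × X.Ω) := Equiv.prodCongr (Equiv.addRight 1) X.T₁⁻¹
  let R₂ : Equiv.Perm (ℤ × X.Ω) := Equiv.prodCongr (Equiv.addRight 1) X.T₂⁻¹
  have hM₁ : M.Inv R₁ := prod_inv hl X.inv₁.symm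
  have hM₂ : M.Inv R₂ := prod_inv hl X.inv₂.symm
  have hR₁ : ∀ (a : ℤ) p, (R₁ ^ a) p = (p.1 + a, (X.T₁ ^ (-a)) p.2) := fun a p => by
    rw [prodCongr_zpow, addRight_zpow]; simp
  have hR₂ : ∀ (a : ℤ) p, (R₂ ^ a) p = (p.1 + a, (X.T₂ ^ (-a)) p.2) := fun a p => by
    rw [prodCongr_zpow, addRight_zpow]; simp
  let F₁ : ℤ × X.Ω → ℝ := fun p => f₁ ((X.T₁ ^ p.1) p.2)
  let F₂ : ℤ × X.Ω → ℝ := fun p => f₂ ((X.T₂ ^ p.1) p.2)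
  have hF₂ : ∀ p, F₂ (R₂ p) = F₂ p := fun p => by
    change f₂ ((X.T₂ ^ (p.1 + 1)) (X.T₂⁻¹ p.2)) = _
    rw [zpow_add_one, Equiv.Perm.mul_apply]
    simp [F₂]
  have hF₁ : ∀ p, F₁ (R₁ p) = F₁ p := fun p => by
    change f₁ ((X.T₁ ^ (p.1 + 1)) (X.T₁⁻¹ p.2)) = _
    rw [zpow_add_one, Equiv.Perm.mul_apply]
    simp [F₁]
  have hRR : Commute R₁ R₂ := by
    ext p
    · simp [R₁, R₂]
    · change X.T₁⁻¹ (X.T₂⁻¹ p.2) = X.T₂⁻¹ (X.T₁⁻¹ p.2)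
      rw [← Equiv.Perm.mul_apply, ← Equiv.Perm.mul_apply, X.comm.inv_inv.eq]
  let G : ℤ × X.Ω → ℝ := fun p => f₀ p.2 * F₁ p
  have hGb : ∀ p, |G p| ≤ C := fun p =>
    (mul_abs_le (hC p.2) (h₁ ((X.T₁ ^ p.1) p.2))).trans_eq (mul_one C)
  have s1 := sq_mean_mul_le M R₂ hM₂ hF₂ (fun p => h₂ _) (G := G) ⟨C, hGb⟩
  let x : ℤ → ℝ := fun b => M (fun p => G p * G ((R₂ ^ b) p))
  let H : ℤ → ℤ × X.Ω → ℝ := fun b p => f₀ p.2 * f₀ ((X.T₂ ^ (-b)) p.2)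
  have hHb : ∀ b p, |H b p| ≤ C * C := fun b p => mul_abs_le (hC _) (hC _)
  let K : ℤ → ℤ × X.Ω → ℝ := fun b p => F₁ p * F₁ ((R₂ ^ b) p)
  have hK1 : ∀ b p, |K b p| ≤ 1 := fun b p =>
    (mul_abs_le (h₁ _) (h₁ _)).trans_eq (mul_one 1)
  have hK : ∀ b p, K b (R₁ p) = K b p := fun b p => by
    simp only [K]
    rw [hF₁, ← Equiv.Perm.mul_apply, ((hRR.symm.zpow_left b)).eq, Equiv.Perm.mul_apply, hF₁]
  have hx : ∀ b, x b = M (fun p => H b p * K b p) := fun b => by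
    simp only [x, G, H, K]
    congr 1
    ext p
    rw [hR₂]
    ring
  have s2 : ∀ b, x b ^ 2 ≤ fejer fun a => X.m fun ω =>
      (f₀ ω * f₀ ((X.T₂ ^ (-b)) ω)) *
        (f₀ ((X.T₁ ^ (-a)) ω) * f₀ ((X.T₂ ^ (-b)) ((X.T₁ ^ (-a)) ω))) := fun b => by
    rw [hx]
    refine (sq_mean_mul_le M R₁ hM₁ (hK b) (hK1 b) ⟨_, hHb b⟩).trans_eq ?_
    congr 1
    ext a
    simp only [M, Mean.prod_apply, H, hR₁, Mean.const]
  have hxb : Bdd x := Mean.bdd_mean (fun _ => M) ⟨C * C, fun b p => mul_abs_le (hGb _) (hGb _)⟩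
  have s3 : fejer x ^ 2 ≤ X.box f₀ := by
    refine (fejer.sq_le hxb).trans (fejer.mono (hxb.pow 2) ?_ s2)
    refine Mean.bdd_mean (fun _ => fejer) ⟨(C * C) * (C * C), fun b a => ?_⟩
    exact X.m.abs_le_of_le fun ω => mul_abs_le (mul_abs_le (hC _) (hC _)) (mul_abs_le (hC _) (hC _))
  calc _ = (M (fun p => G p * F₂ p) ^ 2) ^ 2 := by rw [← pow_mul]; rfl
    _ ≤ fejer x ^ 2 := pow_le_pow_left₀ (sq_nonneg _) s1 2
    _ ≤ _ := s3

/-- Correlation sequences of bounded functions along a single measure preserving bijection. -/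
def IsCorr (w : ℤ → ℝ) : Prop :=
  ∃ (Ω : Type) (S : Equiv.Perm Ω) (m : Mean Ω) (φ ψ : Ω → ℝ), m.Inv S ∧ (∀ y, |φ y| ≤ 1) ∧
    (∀ y, |ψ y| ≤ 1) ∧ w = fun n => m fun y => φ y * ψ ((S ^ n) y)

theorem IsCorr.mul {w w' : ℤ → ℝ} (h : IsCorr w) (h' : IsCorr w') : IsCorr (w * w') := by
  obtain ⟨Ω, S, m, φ, ψ, hS, hφ, hψ, rfl⟩ := h
  obtain ⟨Ω', S', m', φ', ψ', hS', hφ', hψ', rfl⟩ := h'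
  refine ⟨Ω × Ω', Equiv.prodCongr S S', m.prod m', fun p => φ p.1 * φ' p.2,
    fun p => ψ p.1 * ψ' p.2, prod_inv hS hS', fun p => ?_, fun p => ?_, ?_⟩
  · simpa using mul_abs_le (hφ p.1) (hφ' p.2)
  · simpa using mul_abs_le (hψ p.1) (hψ' p.2)
  · ext n
    simp only [Pi.mul_apply, Mean.prod_apply, prodCongr_zpow]
    rw [← Mean.mul_const]
    congr 1
    ext y
    rw [← Mean.smul]
    congr 1
    ext z
    ring

theorem IsCorr.one : IsCorr 1 :=
  ⟨Unit, 1, Mean.avg {()} (by simp) id, fun _ => 1, fun _ => 1, Mean.Inv.one, by simp, by simp, by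
    ext n; simp [Mean.const]⟩

theorem weighted_van_der_corput (X : Sys) {l : Mean ℤ} (hl : ShiftInv l) {g f₁ f₂ : X.Ω → ℝ}
    (hg : Bdd g) (h₁ : ∀ ω, |f₁ ω| ≤ 1) (h₂ : ∀ ω, |f₂ ω| ≤ 1) {w : ℤ → ℝ} (hw : IsCorr w) :
    l (fun n => w n * X.m fun ω => g ω * f₁ ((X.T₁ ^ n) ω) * f₂ ((X.T₂ ^ n) ω)) ^ 4 ≤
      X.box g := by
  obtain ⟨Ω, S, m, φ, ψ, hS, hφ, hψ, rfl⟩ := hw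
  obtain ⟨C, hC0, hC⟩ := hg.nonneg_bound
  let Z : Sys :=
    { Ω := X.Ω × Ω
      T₁ := Equiv.prodCongr X.T₁ 1
      T₂ := Equiv.prodCongr X.T₂ S
      comm := by
        ext p
        · exact congrArg (fun T : Equiv.Perm X.Ω => T p.1) X.comm.eq
        · rfl
      m := X.m.prod m
      inv₁ := prod_inv X.inv₁ Mean.Inv.one
      inv₂ := prod_inv X.inv₂ hS }
  have key := van_der_corput Z hl (f₀ := fun p => g p.1 * φ p.2) (f₁ := fun p => f₁ p.1)
    (f₂ := fun p => f₂ p.1 * ψ p.2) ⟨C * 1, fun p => mul_abs_le (hC _) (hφ _)⟩ (fun p => h₁ _)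
    (fun p => by simpa using mul_abs_le (h₂ p.1) (hψ p.2))
  have e1 : (fun n : ℤ => (m fun y => φ y * ψ ((S ^ n) y)) *
      X.m fun ω => g ω * f₁ ((X.T₁ ^ n) ω) * f₂ ((X.T₂ ^ n) ω)) =
      fun n : ℤ => Z.m fun p => (g p.1 * φ p.2) * f₁ ((Z.T₁ ^ n) p).1 *
        (f₂ ((Z.T₂ ^ n) p).1 * ψ ((Z.T₂ ^ n) p).2) := by
    ext n
    simp only [Z, Mean.prod_apply, prodCongr_zpow]
    rw [← Mean.smul]
    congr 1
    ext ω
    rw [← Mean.mul_const]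
    congr 1
    ext y
    ring
  rw [show l _ = l _ from congrArg l e1]
  refine key.trans ?_
  have e2 : Z.box (fun p => g p.1 * φ p.2) = fejer fun b =>
      (m fun y => (φ y * φ ((S ^ (-b)) y)) ^ 2) * fejer fun a => X.m fun ω =>
      (g ω * g ((X.T₂ ^ (-b)) ω)) *
        (g ((X.T₁ ^ (-a)) ω) * g ((X.T₂ ^ (-b)) ((X.T₁ ^ (-a)) ω))) := by
    rw [Sys.box]
    congr 1
    ext b
    rw [← Mean.smul]
    congr 1
    ext a
    simp only [Z, Mean.prod_apply, prodCongr_zpow]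
    rw [← Mean.smul]
    congr 1
    ext ω
    rw [← Mean.mul_const]
    congr 1
    ext y
    simp only [one_zpow, Equiv.Perm.one_apply]
    ring
  have hin : ∀ b a : ℤ, |X.m fun ω => (g ω * g ((X.T₂ ^ (-b)) ω)) *
      (g ((X.T₁ ^ (-a)) ω) * g ((X.T₂ ^ (-b)) ((X.T₁ ^ (-a)) ω)))| ≤ (C * C) * (C * C) :=
    fun b a => X.m.abs_le_of_le fun ω =>
      mul_abs_le (mul_abs_le (hC _) (hC _)) (mul_abs_le (hC _) (hC _))
  have hφ2 : ∀ (b : ℤ) y, |(φ y * φ ((S ^ (-b)) y)) ^ 2| ≤ 1 := fun b y => by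
    rw [abs_pow]
    exact pow_le_one₀ (abs_nonneg _) ((mul_abs_le (hφ y) (hφ ((S ^ (-b)) y))).trans_eq (mul_one 1))
  rw [e2, Sys.box]
  refine fejer.mono ((Mean.bdd_mean (fun _ => m) ⟨1, hφ2⟩).mul
    (Mean.bdd_mean (fun _ => fejer) ⟨_, hin⟩)) (Mean.bdd_mean (fun _ => fejer) ⟨_, hin⟩) fun b => ?_
  refine mul_le_of_le_one_left ?_ ((le_abs_self _).trans (m.abs_le_of_le (hφ2 b)))
  have := fejer_autocorr_nonneg X.m X.T₁⁻¹ X.inv₁.symm (G := fun ω => g ω * g ((X.T₂ ^ (-b)) ω))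
    ⟨C * C, fun ω => mul_abs_le (hC _) (hC _)⟩
  simpa only [inv_zpow, ← zpow_neg] using this

/-- The algebra of sequences generated by correlation sequences. -/
def corrAlg : Subalgebra ℝ (ℤ → ℝ) := Algebra.adjoin ℝ {w | IsCorr w}

theorem mem_corrAlg_span {w : ℤ → ℝ} (hw : w ∈ corrAlg) :
    w ∈ Submodule.span ℝ {w | IsCorr w} := by
  let Q : Submonoid (ℤ → ℝ) :=
    { carrier := {w | IsCorr w}, mul_mem' := fun h h' => h.mul h', one_mem' := IsCorr.one }
  have h1 : w ∈ Subalgebra.toSubmodule corrAlg := hw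
  rw [corrAlg, Algebra.adjoin_eq_span] at h1
  have : Submonoid.closure {w | IsCorr w} = Q := Submonoid.closure_eq Q
  rw [this] at h1
  exact h1

theorem corrAlg_bound {l : Mean ℤ} (hl : ShiftInv l) {w : ℤ → ℝ} (hw : w ∈ corrAlg) :
    ∃ C, 0 ≤ C ∧ ∀ (X : Sys) (g f₁ f₂ : X.Ω → ℝ), Bdd g → (∀ ω, |f₁ ω| ≤ 1) → (∀ ω, |f₂ ω| ≤ 1) →
      |l (fun n => w n * X.m fun ω => g ω * f₁ ((X.T₁ ^ n) ω) * f₂ ((X.T₂ ^ n) ω))| ≤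
        C * √√(X.box g) := by
  replace hw := mem_corrAlg_span hw
  induction hw using Submodule.span_induction with
  | mem w hw =>
    refine ⟨1, zero_le_one, fun X g f₁ f₂ hg h₁ h₂ => ?_⟩
    rw [one_mul]
    have := weighted_van_der_corput X hl hg h₁ h₂ hw
    refine Real.abs_le_sqrt (Real.le_sqrt_of_sq_le ?_)
    rwa [← pow_mul]
  | zero => exact ⟨0, le_rfl, fun X g f₁ f₂ hg h₁ h₂ => by simp [Mean.const]⟩
  | add w w' _ _ ih ih' =>
    obtain ⟨C, hC, h⟩ := ih
    obtain ⟨C', hC', h'⟩ := ih'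
    refine ⟨C + C', add_nonneg hC hC', fun X g f₁ f₂ hg h₁ h₂ => ?_⟩
    simp only [Pi.add_apply, add_mul, Mean.add]
    exact (abs_add_le _ _).trans (add_le_add (h X g f₁ f₂ hg h₁ h₂) (h' X g f₁ f₂ hg h₁ h₂))
  | smul c w _ ih =>
    obtain ⟨C, hC, h⟩ := ih
    refine ⟨|c| * C, by positivity, fun X g f₁ f₂ hg h₁ h₂ => ?_⟩
    simp only [Pi.smul_apply, smul_eq_mul, mul_assoc, Mean.smul, abs_mul c]
    simp only [← mul_assoc (g _)]
    exact mul_le_mul_of_nonneg_left (h X g f₁ f₂ hg h₁ h₂) (abs_nonneg _)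

/-- The same pair of bijections with another invariant mean. -/
def Sys.withMean (X : Sys) (m : Mean X.Ω) (h₁ : m.Inv X.T₁) (h₂ : m.Inv X.T₂) : Sys :=
  { X with m := m, inv₁ := h₁, inv₂ := h₂ }

/-- Ergodicity: no other invariant mean is dominated by twice the given one. -/
def Sys.Erg (X : Sys) : Prop :=
  ∀ m : Mean X.Ω, m.Inv X.T₁ → m.Inv X.T₂ →
    (∀ F, Bdd F → (∀ ω, 0 ≤ F ω) → m F ≤ 2 * X.m F) → ∀ F, Bdd F → m F = X.m F

/-- `π` exhibits `X` as a factor of `X'`. -/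
structure Factor (X' X : Sys) (π : X'.Ω → X.Ω) : Prop where
  map₁ : ∀ ω, π (X'.T₁ ω) = X.T₁ (π ω)
  map₂ : ∀ ω, π (X'.T₂ ω) = X.T₂ (π ω)
  map_mean : ∀ F, Bdd F → X'.m (fun ω => F (π ω)) = X.m F

theorem Factor.comp {X'' X' X : Sys} {π' : X''.Ω → X'.Ω} {π : X'.Ω → X.Ω}
    (h' : Factor X'' X' π') (h : Factor X' X π) : Factor X'' X (fun ω => π (π' ω)) where
  map₁ ω := by rw [h'.map₁, h.map₁]
  map₂ ω := by rw [h'.map₂, h.map₂]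
  map_mean F hF := by rw [h'.map_mean (fun ω => F (π ω)) (hF.comp π), h.map_mean F hF]

theorem Factor.refl (X : Sys) : Factor X X (fun ω => ω) :=
  ⟨fun _ => rfl, fun _ => rfl, fun _ _ => rfl⟩

theorem Sys.exists_isCompact_extreme (X' X : Sys) (π : X'.Ω → X.Ω) (h : Factor X' X π)
    {F₀ : X'.Ω → ℝ} (hF₀ : Bdd F₀) :
    ∃ (m : Mean X'.Ω) (h₁ : m.Inv X'.T₁) (h₂ : m.Inv X'.T₂),
      Factor (X'.withMean m h₁ h₂) X π ∧ X'.m F₀ ≤ m F₀ ∧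
      ∀ m₁ m₂ : Mean X'.Ω, ∀ (h₁₁ : m₁.Inv X'.T₁) (h₁₂ : m₁.Inv X'.T₂) (h₂₁ : m₂.Inv X'.T₁)
        (h₂₂ : m₂.Inv X'.T₂), Factor (X'.withMean m₁ h₁₁ h₁₂) X π →
        Factor (X'.withMean m₂ h₂₁ h₂₂) X π → (∀ F, Bdd F → m₁ F + m₂ F = 2 * m F) →
        ∀ F, Bdd F → m₁ F = m F := by
  let B := {F : X'.Ω → ℝ // Bdd F}
  let ev : Mean X'.Ω → B → ℝ := fun m F => m F
  let P : Mean X'.Ω → Prop := fun m => ∃ (h₁ : m.Inv X'.T₁) (h₂ : m.Inv X'.T₂),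
    Factor (X'.withMean m h₁ h₂) X π
  let K : Set (B → ℝ) := ev '' {m | P m}
  have hK : IsCompact K := by
    rw [isCompact_iff_ultrafilter_le_nhds]
    intro U hU
    rw [le_principal_iff] at hU
    classical
    let μ : (B → ℝ) → Mean X'.Ω := fun L => if hL : L ∈ K then Classical.choose hL else X'.m
    have hμ : ∀ L ∈ K, P (μ L) ∧ ev (μ L) = L := fun L hL => by
      simp only [μ, dif_pos hL]
      exact Classical.choose_spec hL
    obtain ⟨m, hm⟩ := Mean.exists_ultralimit U μ
    refine ⟨ev m, ⟨m, ?_, rfl⟩, ?_⟩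
    · refine ⟨?_, ?_, h.map₁, h.map₂, ?_⟩
      · intro F hF
        refine tendsto_nhds_unique_of_eventuallyEq (hm _ (hF.comp _)) (hm F hF) ?_
        filter_upwards [hU] with L hL
        exact (hμ L hL).1.choose F hF
      · intro F hF
        refine tendsto_nhds_unique_of_eventuallyEq (hm _ (hF.comp _)) (hm F hF) ?_
        filter_upwards [hU] with L hL
        exact (hμ L hL).1.choose_spec.choose F hF
      · intro F hF
        refine tendsto_nhds_unique_of_eventuallyEq (hm _ (hF.comp _))
          (tendsto_const_nhds (x := X.m F)) ?_
        filter_upwards [hU] with L hL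
        exact (hμ L hL).1.choose_spec.choose_spec.map_mean F hF
    · change Tendsto id (U : Filter (B → ℝ)) (𝓝 (ev m))
      rw [tendsto_pi_nhds]
      intro F
      refine (hm F F.2).congr' ?_
      filter_upwards [hU] with L hL
      exact congrFun (hμ L hL).2 F
  have hKne : K.Nonempty := ⟨ev X'.m, X'.m, ⟨X'.inv₁, X'.inv₂, h⟩, rfl⟩
  have hcont : Continuous (fun L : B → ℝ => L ⟨F₀, hF₀⟩) := continuous_apply _
  obtain ⟨L₀, hL₀K, hL₀⟩ := hK.exists_isMaxOn hKne hcont.continuousOn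
  let K' : Set (B → ℝ) := K ∩ {L | L ⟨F₀, hF₀⟩ = L₀ ⟨F₀, hF₀⟩}
  have hK' : IsCompact K' := hK.inter_right (isClosed_eq hcont continuous_const)
  obtain ⟨x, hx⟩ := hK'.extremePoints_nonempty ⟨L₀, hL₀K, rfl⟩
  rw [mem_extremePoints] at hx
  obtain ⟨⟨⟨m, ⟨h₁, h₂, hm⟩, rfl⟩, hmax⟩, hext⟩ := hx
  have hmax' : m F₀ = L₀ ⟨F₀, hF₀⟩ := hmax
  have hle : ∀ m', P m' → m' F₀ ≤ m F₀ := fun m' hm' => by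
    rw [hmax']
    exact hL₀ (show ev m' ∈ K from ⟨m', hm', rfl⟩)
  refine ⟨m, h₁, h₂, hm, hle _ ⟨X'.inv₁, X'.inv₂, h⟩, ?_⟩
  intro m₁ m₂ h₁₁ h₁₂ h₂₁ h₂₂ f₁ f₂ hsum F hF
  have a₁ := hle m₁ ⟨h₁₁, h₁₂, f₁⟩
  have a₂ := hle m₂ ⟨h₂₁, h₂₂, f₂⟩
  have a₃ := hsum F₀ hF₀
  have b₁ : ev m₁ ∈ K' := ⟨⟨m₁, ⟨h₁₁, h₁₂, f₁⟩, rfl⟩, by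
    change m₁ F₀ = L₀ ⟨F₀, hF₀⟩; rw [← hmax']; linarith⟩
  have b₂ : ev m₂ ∈ K' := ⟨⟨m₂, ⟨h₂₁, h₂₂, f₂⟩, rfl⟩, by
    change m₂ F₀ = L₀ ⟨F₀, hF₀⟩; rw [← hmax']; linarith⟩
  have := hext _ b₁ _ b₂ ⟨1 / 2, 1 / 2, by norm_num, by norm_num, by norm_num, by
    ext G
    have := hsum G G.2
    simp only [Pi.add_apply, Pi.smul_apply, smul_eq_mul, ev]
    linarith⟩
  exact congrFun this.1 ⟨F, hF⟩

/-- Ergodic extensions can be chosen so as not to decrease a given integral. -/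
theorem Sys.exists_erg (X' X : Sys) (π : X'.Ω → X.Ω) (h : Factor X' X π) (hX : X.Erg)
    {F₀ : X'.Ω → ℝ} (hF₀ : Bdd F₀) :
    ∃ (m : Mean X'.Ω) (h₁ : m.Inv X'.T₁) (h₂ : m.Inv X'.T₂),
      Factor (X'.withMean m h₁ h₂) X π ∧ (X'.withMean m h₁ h₂).Erg ∧ X'.m F₀ ≤ m F₀ := by
  obtain ⟨m, h₁, h₂, hm, hle, hext⟩ := Sys.exists_isCompact_extreme X' X π h hF₀
  refine ⟨m, h₁, h₂, hm, ?_, hle⟩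
  have hproj : ∀ (n : Mean X'.Ω) (n₁ : n.Inv X'.T₁) (n₂ : n.Inv X'.T₂),
      (∀ F, Bdd F → (∀ ω, 0 ≤ F ω) → n F ≤ 2 * m F) → Factor (X'.withMean n n₁ n₂) X π := by
    intro n n₁ n₂ hn
    refine ⟨h.map₁, h.map₂, hX (n.map π) (fun F hF => ?_) (fun F hF => ?_) fun F hF hF0 => ?_⟩
    · have := n₁ (fun ω => F (π ω)) (hF.comp π)
      simpa only [Mean.map_apply, h.map₁] using this
    · have := n₂ (fun ω => F (π ω)) (hF.comp π)
      simpa only [Mean.map_apply, h.map₂] using this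
    · rw [← hm.map_mean F hF]
      exact hn _ (hF.comp π) fun ω => hF0 _
  intro (n : Mean X'.Ω) (n₁ : n.Inv X'.T₁) (n₂ : n.Inv X'.T₂) hn F hF
  have hn' : ∀ F, Bdd F → (∀ ω, 0 ≤ F ω) → n F ≤ 2 * m F := hn
  let n' : Mean X'.Ω :=
    { toLin := (2 : ℝ) • m.toLin - n.toLin
      map_one := by
        have e₁ := m.map_one
        have e₂ := n.map_one
        simp only [LinearMap.sub_apply, LinearMap.smul_apply, smul_eq_mul, e₁, e₂]
        norm_num
      nonneg' := fun F hF hF0 => sub_nonneg.2 (hn' F hF hF0) }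
  have hn'F : ∀ F, n' F = 2 * m F - n F := fun F => rfl
  have n'₁ : n'.Inv X'.T₁ := fun F hF => by rw [hn'F, hn'F, h₁ F hF, n₁ F hF]
  have n'₂ : n'.Inv X'.T₂ := fun F hF => by rw [hn'F, hn'F, h₂ F hF, n₂ F hF]
  refine hext n n' n₁ n₂ n'₁ n'₂ (hproj n n₁ n₂ hn') (hproj n' n'₁ n'₂ fun F hF hF0 => ?_)
    (fun F _ => by rw [hn'F]; ring) F hF
  rw [hn'F]
  linarith [n.nonneg hF hF0]

/-- The one-point system. -/
noncomputable def Sys.point : Sys where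
  Ω := Unit
  T₁ := 1
  T₂ := 1
  comm := Commute.one_left 1
  m := Mean.avg {()} (by simp) id
  inv₁ := Mean.Inv.one
  inv₂ := Mean.Inv.one

theorem Sys.point_erg : Sys.point.Erg := by
  intro m _ _ _ F _
  have : F = fun _ => F () := by ext ⟨⟩; rfl
  rw [this, Mean.const, Mean.const]

theorem Sys.exists_erg_point (X : Sys) {F₀ : X.Ω → ℝ} (hF₀ : Bdd F₀) :
    ∃ (m : Mean X.Ω) (h₁ : m.Inv X.T₁) (h₂ : m.Inv X.T₂),
      (X.withMean m h₁ h₂).Erg ∧ X.m F₀ ≤ m F₀ := by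
  obtain ⟨m, h₁, h₂, -, h, h'⟩ := Sys.exists_erg X Sys.point (fun _ => ())
    ⟨fun _ => rfl, fun _ => rfl, fun F _ => by
      have : F = fun _ => F () := by ext ⟨⟩; rfl
      rw [this, Mean.const, Mean.const]⟩ Sys.point_erg hF₀
  exact ⟨m, h₁, h₂, h, h'⟩

theorem Sys.comm_zpow_apply (X : Sys) (a : ℤ) (ω : X.Ω) :
    (X.T₁ ^ a) (X.T₂ ω) = X.T₂ ((X.T₁ ^ a) ω) := by
  rw [← Equiv.Perm.mul_apply, (X.comm.zpow_left a).eq, Equiv.Perm.mul_apply]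

/-- In an ergodic system the two invariant algebras are independent. -/
theorem Sys.Erg.indep {X : Sys} (hX : X.Erg) {φ ψ : X.Ω → ℝ} (hφ : Bdd φ) (hψ : Bdd ψ)
    (hφT : ∀ ω, φ (X.T₂ ω) = φ ω) (hψT : ∀ ω, ψ (X.T₁ ω) = ψ ω) :
    X.m (fun ω => φ ω * ψ ω) = X.m φ * X.m ψ := by
  obtain ⟨C, hC0, hC⟩ := hφ.nonneg_bound
  set c : ℝ := 1 / (2 * C + 1) with hc
  have hc0 : 0 < c := by positivity
  let φ' : X.Ω → ℝ := fun ω => 1 + c * (φ ω - X.m φ)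
  have hφ'b : Bdd φ' := (Bdd.const 1).add ((Bdd.const c).mul (hφ.sub (Bdd.const _)))
  have hφ' : ∀ ω, |c * (φ ω - X.m φ)| ≤ 1 := fun ω => by
    rw [abs_mul, abs_of_pos hc0, hc, div_mul_eq_mul_div, div_le_one (by positivity), one_mul]
    linarith [abs_sub (φ ω) (X.m φ), hC ω, X.m.abs_le_of_le hC]
  have h0 : ∀ ω, 0 ≤ φ' ω := fun ω => by have := abs_le.1 (hφ' ω); simp only [φ']; linarith
  have h2 : ∀ ω, φ' ω ≤ 2 := fun ω => by have := abs_le.1 (hφ' ω); simp only [φ']; linarith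
  have hm : X.m φ' = 1 := by simp only [φ', Mean.add, Mean.smul, Mean.sub, Mean.const]; ring
  have hcor : ∀ G, Bdd G → Bdd (fun a : ℤ => X.m fun ω => φ' ((X.T₁ ^ a) ω) * G ω) := by
    rintro G ⟨D, hD⟩
    refine Mean.bdd_mean (fun _ => X.m) ⟨2 * D, fun a ω => mul_abs_le ?_ (hD ω)⟩
    rw [abs_of_nonneg (h0 _)]
    exact h2 _
  let n : Mean X.Ω :=
    { toLin :=
        { toFun := fun G => fejer fun a => X.m fun ω => φ' ((X.T₁ ^ a) ω) * G ω
          map_add' := fun F G => by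
            simp only [Pi.add_apply, mul_add, Mean.add]
          map_smul' := fun c F => by
            simp only [Pi.smul_apply, smul_eq_mul, RingHom.id_apply, mul_left_comm _ c, Mean.smul] }
      map_one := by
        change (fejer fun a => X.m fun ω => φ' ((X.T₁ ^ a) ω) * 1) = 1
        simp only [mul_one, X.inv₁.zpow _ _ hφ'b, hm, Mean.const]
      nonneg' := fun G hG hG0 => fejer.nonneg (hcor G hG) fun a =>
        X.m.nonneg ((hφ'b.comp _).mul hG) fun ω => mul_nonneg (h0 _) (hG0 _) }
  have hn : ∀ G, n G = fejer fun a => X.m fun ω => φ' ((X.T₁ ^ a) ω) * G ω := fun G => rfl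
  have hn₁ : n.Inv X.T₁ := fun G hG => by
    rw [hn, hn, ← fejer_shift (hcor _ (hG.comp _))]
    congr 1
    ext a
    rw [← X.inv₁ (fun ω => φ' ((X.T₁ ^ a) ω) * G ω) ((hφ'b.comp _).mul hG)]
    congr 1
    ext ω
    rw [zpow_add_one, Equiv.Perm.mul_apply]
  have hn₂ : n.Inv X.T₂ := fun G hG => by
    rw [hn, hn]
    congr 1
    ext a
    rw [← X.inv₂ (fun ω => φ' ((X.T₁ ^ a) ω) * G ω) ((hφ'b.comp _).mul hG)]
    congr 1
    ext ω
    simp only [φ', X.comm_zpow_apply, hφT]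
  have key := hX n hn₁ hn₂ (fun G hG hG0 => by
    rw [hn]
    refine fejer.le_of_le (hcor G hG) fun a => ?_
    rw [← Mean.smul]
    exact X.m.mono ((hφ'b.comp _).mul hG) ((Bdd.const 2).mul hG) fun ω =>
      mul_le_mul_of_nonneg_right (h2 _) (hG0 _)) ψ hψ
  have e : n ψ = X.m fun ω => φ' ω * ψ ω := by
    rw [hn, ← fejer.const (X.m fun ω => φ' ω * ψ ω)]
    congr 1
    ext a
    rw [← X.inv₁.zpow a (fun ω => φ' ω * ψ ω) (hφ'b.mul hψ)]
    simp only [zpow_invariant hψT]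
  have e2 : (X.m fun ω => φ' ω * ψ ω) =
      X.m ψ + c * (X.m (fun ω => φ ω * ψ ω) - X.m φ * X.m ψ) := by
    rw [← Mean.smul _ (X.m φ), ← Mean.sub, ← Mean.smul, ← Mean.add]
    congr 1
    ext ω
    simp only [φ']
    ring
  rw [e, e2] at key
  have : c * (X.m (fun ω => φ ω * ψ ω) - X.m φ * X.m ψ) = 0 := by linarith
  rcases mul_eq_zero.1 this with h | h
  · exact absurd h hc0.ne'
  · linarith

/-- A large box correlation is realised, in an ergodic extension, as a correlation with a product
of invariant functions. -/
theorem Sys.Erg.exists_box_extension {X : Sys} (hX : X.Erg) {γ : Type} [Finite γ] (w : X.Ω → γ)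
    (ψ : γ → ℝ) :
    ∃ (X' : Sys) (π : X'.Ω → X.Ω) (u₁ u₂ v : X'.Ω → γ), Factor X' X π ∧ X'.Erg ∧
      (∀ ω, u₁ (X'.T₂ ω) = u₁ ω) ∧ (∀ ω, u₂ (X'.T₂ ω) = u₂ ω) ∧ (∀ ω, v (X'.T₁ ω) = v ω) ∧
      X.box (fun ω => ψ (w ω)) ≤
        X'.m (fun ω => ψ (w (π ω)) * (ψ (u₁ ω) * ψ (u₂ ω) * ψ (v ω))) := by
  obtain ⟨C, hC⟩ := Bdd.of_finite ψ
  let m' : Mean (X.Ω × ℤ × ℤ) := fejer.bind fun b => fejer.bind fun a => X.m.map fun ω => (ω, a, b)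
  have hm' : ∀ F, m' F = fejer fun b => fejer fun a => X.m fun ω => F (ω, a, b) := fun F => rfl
  let Z : Sys :=
    { Ω := X.Ω × ℤ × ℤ
      T₁ := Equiv.prodCongr X.T₁ (Equiv.prodCongr (Equiv.addRight 1) 1)
      T₂ := Equiv.prodCongr X.T₂ (Equiv.prodCongr 1 (Equiv.addRight 1))
      comm := by
        ext p
        · exact congrArg (fun T : Equiv.Perm X.Ω => T p.1) X.comm.eq
        · rfl
        · rfl
      m := m'
      inv₁ := fun F hF => by
        obtain ⟨D, hD⟩ := hF
        rw [hm', hm']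
        congr 1
        ext b
        rw [← fejer_shift (c := fun a => X.m fun ω => F (ω, a, b))
          (Mean.bdd_mean (fun _ => X.m) ⟨D, fun _ _ => hD _⟩)]
        congr 1
        ext a
        exact X.inv₁ (fun ω => F (ω, a + 1, b)) ⟨D, fun _ => hD _⟩
      inv₂ := fun F hF => by
        obtain ⟨D, hD⟩ := hF
        rw [hm', hm']
        rw [← fejer_shift (c := fun b => fejer fun a => X.m fun ω => F (ω, a, b))
          (Mean.bdd_mean (fun _ => fejer) ⟨D, fun b a =>
          X.m.abs_le_of_le fun _ => hD _⟩)]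
        congr 1
        ext b
        congr 1
        ext a
        exact X.inv₂ (fun ω => F (ω, a, b + 1)) ⟨D, fun _ => hD _⟩ }
  let u₁ : Z.Ω → γ := fun p => w ((X.T₂ ^ (-p.2.2)) p.1)
  let u₂ : Z.Ω → γ := fun p => w ((X.T₂ ^ (-p.2.2)) ((X.T₁ ^ (-p.2.1)) p.1))
  let v : Z.Ω → γ := fun p => w ((X.T₁ ^ (-p.2.1)) p.1)
  have hT : ∀ (T : Equiv.Perm X.Ω) (a : ℤ) ω, (T ^ (-(a + 1))) (T ω) = (T ^ (-a)) ω :=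
    fun T a ω => by
      rw [neg_add, zpow_add, zpow_neg_one, Equiv.Perm.mul_apply]; simp
  have hfac : Factor Z X Prod.fst := ⟨fun _ => rfl, fun _ => rfl, fun F _ => by
    change m' _ = _
    simp only [hm', Mean.const]⟩
  obtain ⟨m, h₁, h₂, hf, herg, hle⟩ := Sys.exists_erg Z X Prod.fst hfac hX
    (F₀ := fun ω => ψ (w ω.1) * (ψ (u₁ ω) * ψ (u₂ ω) * ψ (v ω)))
    ⟨C * (C * C * C), fun ω => mul_abs_le (hC _) (mul_abs_le (mul_abs_le (hC _) (hC _)) (hC _))⟩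
  refine ⟨Z.withMean m h₁ h₂, Prod.fst, u₁, u₂, v, hf, herg, fun p => ?_, fun p => ?_,
    fun p => ?_, ?_⟩
  · exact congrArg w (hT X.T₂ p.2.2 p.1)
  · refine congrArg w ?_
    rw [← hT X.T₂ p.2.2, ← X.comm_zpow_apply]
    rfl
  · exact congrArg w (hT X.T₁ p.2.1 p.1)
  · refine le_of_eq_of_le ?_ hle
    change _ = m' _
    rw [Sys.box, hm']
    simp only [u₁, u₂, v]
    congr 1
    ext b
    congr 1
    ext a
    congr 1
    ext ω
    ring

/-- An ergodic system with a set `e` and a function `Φ (u, v)` built from finite-valued functions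
`u`, `v` invariant under `T₂` and `T₁` respectively. -/
structure Cfg where
  X : Sys
  erg : X.Erg
  e : X.Ω → Bool
  α : Type
  β : Type
  fα : Fintype α
  fβ : Fintype β
  u : X.Ω → α
  v : X.Ω → β
  hu : ∀ ω, u (X.T₂ ω) = u ω
  hv : ∀ ω, v (X.T₁ ω) = v ω
  Φ : α → β → ℝ

attribute [instance] Cfg.fα Cfg.fβ

/-- The indicator as a real number. -/
def ind (b : Bool) : ℝ := if b then 1 else 0

theorem ind_nonneg (b : Bool) : 0 ≤ ind b := by cases b <;> simp [ind]

theorem ind_le_one (b : Bool) : ind b ≤ 1 := by cases b <;> simp [ind]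

theorem ind_abs (b : Bool) : |ind b| ≤ 1 := by cases b <;> simp [ind]

namespace Cfg

variable (C : Cfg)

/-- The indicator function of the set. -/
def f (ω : C.X.Ω) : ℝ := ind (C.e ω)

/-- The approximating function. -/
def h (ω : C.X.Ω) : ℝ := C.Φ (C.u ω) (C.v ω)

/-- Squared distance of the indicator to the approximating function. -/
def energy : ℝ := C.X.m fun ω => (C.f ω - C.h ω) ^ 2

open scoped Classical in
/-- Indicator of an atom of `u`. -/
noncomputable def p (i : C.α) (ω : C.X.Ω) : ℝ := if C.u ω = i then 1 else 0

open scoped Classical in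
/-- Indicator of an atom of `v`. -/
noncomputable def q (j : C.β) (ω : C.X.Ω) : ℝ := if C.v ω = j then 1 else 0

theorem f_bdd : Bdd C.f := ⟨1, fun _ => ind_abs _⟩

theorem h_bdd : Bdd C.h :=
  (Bdd.of_finite (fun x : C.α × C.β => C.Φ x.1 x.2)).comp fun ω => (C.u ω, C.v ω)

theorem p_nonneg (i ω) : 0 ≤ C.p i ω := by rw [p]; split_ifs <;> norm_num

theorem p_le_one (i ω) : C.p i ω ≤ 1 := by rw [p]; split_ifs <;> norm_num

theorem q_nonneg (i ω) : 0 ≤ C.q i ω := by rw [q]; split_ifs <;> norm_num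

theorem q_le_one (i ω) : C.q i ω ≤ 1 := by rw [q]; split_ifs <;> norm_num

theorem p_abs (i ω) : |C.p i ω| ≤ 1 := by
  rw [abs_of_nonneg (C.p_nonneg _ _)]; exact C.p_le_one _ _

theorem q_abs (i ω) : |C.q i ω| ≤ 1 := by
  rw [abs_of_nonneg (C.q_nonneg _ _)]; exact C.q_le_one _ _

theorem p_bdd (i) : Bdd (C.p i) := ⟨1, C.p_abs i⟩

theorem q_bdd (j) : Bdd (C.q j) := ⟨1, C.q_abs j⟩

theorem sum_pq (K : C.α → C.β → ℝ) (ω : C.X.Ω) :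
    ∑ i, ∑ j, K i j * (C.p i ω * C.q j ω) = K (C.u ω) (C.v ω) := by
  classical
  rw [Finset.sum_eq_single (C.u ω) (fun i _ hi => by simp [p, hi.symm]) (by simp),
    Finset.sum_eq_single (C.v ω) (fun i _ hi => by simp [q, hi.symm]) (by simp)]
  simp [p, q]

theorem sum_p (ω : C.X.Ω) : ∑ i, C.p i ω = 1 := by
  rw [Finset.sum_eq_single (C.u ω) (fun i _ hi => by simp [p, hi.symm]) (by simp)]
  simp [p]

theorem sum_q (ω : C.X.Ω) : ∑ j, C.q j ω = 1 := by
  rw [Finset.sum_eq_single (C.v ω) (fun i _ hi => by simp [q, hi.symm]) (by simp)]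
  simp [q]

theorem mean_pq (K : C.α → C.β → C.X.Ω → ℝ) :
    C.X.m (fun ω => K (C.u ω) (C.v ω) ω) =
      ∑ i, ∑ j, C.X.m (fun ω => K i j ω * (C.p i ω * C.q j ω)) := by
  simp only [← Mean.sum]
  congr 1
  ext ω
  exact (C.sum_pq (fun i j => K i j ω) ω).symm

/-- The approximating function is the conditional expectation of the indicator. -/
structure IsCondExp : Prop where
  nonneg : ∀ i j, 0 ≤ C.Φ i j
  le_one : ∀ i j, C.Φ i j ≤ 1
  mean : ∀ i j, C.X.m (fun ω => C.f ω * (C.p i ω * C.q j ω)) =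
    C.Φ i j * C.X.m (fun ω => C.p i ω * C.q j ω)

/-- `C'` extends `C` (the approximating functions being unrelated). -/
structure Over (C' C : Cfg) (π : C'.X.Ω → C.X.Ω) : Prop where
  factor : Factor C'.X C.X π
  e_eq : ∀ ω, C'.e ω = C.e (π ω)

theorem Over.f_eq {C' C : Cfg} {π : C'.X.Ω → C.X.Ω} (h : Over C' C π) (ω) :
    C'.f ω = C.f (π ω) := by rw [f, f, h.e_eq]

theorem Over.comp {C'' C' C : Cfg} {π' : C''.X.Ω → C'.X.Ω} {π : C'.X.Ω → C.X.Ω}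
    (h' : Over C'' C' π') (h : Over C' C π) : Over C'' C (fun ω => π (π' ω)) :=
  ⟨h'.factor.comp h.factor, fun ω => by rw [h'.e_eq, h.e_eq]⟩

/-- Replace the approximating function. -/
def withΦ (Φ : C.α → C.β → ℝ) : Cfg := { C with Φ := Φ }

theorem over_withΦ (Φ : C.α → C.β → ℝ) : Over (C.withΦ Φ) C (fun ω => ω) :=
  ⟨Factor.refl _, fun _ => rfl⟩

theorem exists_condExp :
    ∃ Φ, (C.withΦ Φ).IsCondExp ∧ (C.withΦ Φ).energy ≤ C.energy := by
  have hpq : ∀ i j, Bdd (fun ω => C.p i ω * C.q j ω) := fun i j => (C.p_bdd i).mul (C.q_bdd j)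
  have hpq0 : ∀ i j ω, 0 ≤ C.p i ω * C.q j ω :=
    fun i j ω => mul_nonneg (C.p_nonneg _ _) (C.q_nonneg _ _)
  have hfpq : ∀ i j, Bdd (fun ω => C.f ω * (C.p i ω * C.q j ω)) := fun i j => C.f_bdd.mul (hpq i j)
  have h0 : ∀ i j, 0 ≤ C.X.m (fun ω => C.p i ω * C.q j ω) :=
    fun i j => C.X.m.nonneg (hpq i j) (hpq0 i j)
  have h1 : ∀ i j, 0 ≤ C.X.m (fun ω => C.f ω * (C.p i ω * C.q j ω)) :=
    fun i j => C.X.m.nonneg (hfpq i j) fun ω => mul_nonneg (ind_nonneg _) (hpq0 i j ω)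
  have h2 : ∀ i j, C.X.m (fun ω => C.f ω * (C.p i ω * C.q j ω)) ≤
      C.X.m (fun ω => C.p i ω * C.q j ω) :=
    fun i j => C.X.m.mono (hfpq i j) (hpq i j) fun ω =>
      mul_le_of_le_one_left (hpq0 i j ω) (ind_le_one _)
  let Φ : C.α → C.β → ℝ := fun i j =>
    C.X.m (fun ω => C.f ω * (C.p i ω * C.q j ω)) / C.X.m (fun ω => C.p i ω * C.q j ω)
  have hΦ : ∀ i j, C.X.m (fun ω => C.f ω * (C.p i ω * C.q j ω)) =
      Φ i j * C.X.m (fun ω => C.p i ω * C.q j ω) := fun i j => by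
    rcases eq_or_ne (C.X.m (fun ω => C.p i ω * C.q j ω)) 0 with h | h
    · have := h1 i j
      have := h2 i j
      rw [h] at this ⊢
      linarith
    · exact (div_mul_cancel₀ _ h).symm
  refine ⟨Φ, ⟨fun i j => div_nonneg (h1 i j) (h0 i j), fun i j => div_le_one_of_le₀ (h2 i j) (h0 i j),
    hΦ⟩, ?_⟩
  have key : C.energy - (C.withΦ Φ).energy = ∑ i, ∑ j,
      (Φ i j - C.Φ i j) ^ 2 * C.X.m (fun ω => C.p i ω * C.q j ω) := by
    have : C.energy - (C.withΦ Φ).energy = C.X.m fun ω =>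
        (C.f ω - C.Φ (C.u ω) (C.v ω)) ^ 2 - (C.f ω - Φ (C.u ω) (C.v ω)) ^ 2 := by
      rw [Mean.sub]; rfl
    rw [this, C.mean_pq fun i j ω => (C.f ω - C.Φ i j) ^ 2 - (C.f ω - Φ i j) ^ 2]
    refine Finset.sum_congr rfl fun i _ => Finset.sum_congr rfl fun j _ => ?_
    have e : (fun ω => ((C.f ω - C.Φ i j) ^ 2 - (C.f ω - Φ i j) ^ 2) * (C.p i ω * C.q j ω)) =
        fun ω => (2 * (Φ i j - C.Φ i j)) * (C.f ω * (C.p i ω * C.q j ω)) -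
          ((Φ i j - C.Φ i j) * (Φ i j + C.Φ i j)) * (C.p i ω * C.q j ω) := by
      ext ω; ring
    rw [e, Mean.sub, Mean.smul, Mean.smul, hΦ]
    ring
  have : 0 ≤ C.energy - (C.withΦ Φ).energy := by
    rw [key]
    exact Finset.sum_nonneg fun i _ => Finset.sum_nonneg fun j _ =>
      mul_nonneg (sq_nonneg _) (h0 i j)
  linarith

theorem energy_nonneg : 0 ≤ C.energy :=
  C.X.m.nonneg ((C.f_bdd.sub C.h_bdd).pow 2) fun _ => sq_nonneg _

theorem exists_energy_decrement (h0 : ∀ i j, 0 ≤ C.Φ i j) (h1 : ∀ i j, C.Φ i j ≤ 1) {η : ℝ}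
    (hη : 0 ≤ η) (hbox : η ≤ C.X.box fun ω => C.f ω - C.h ω) :
    ∃ (C' : Cfg) (π : C'.X.Ω → C.X.Ω), Over C' C π ∧ C'.energy ≤ C.energy - η ^ 2 := by
  let ψ : Bool × C.α × C.β → ℝ := fun x => ind x.1 - C.Φ x.2.1 x.2.2
  have hψ : ∀ x, |ψ x| ≤ 1 := fun x => by
    rw [abs_le]
    constructor <;> simp only [ψ] <;>
    linarith [ind_nonneg x.1, ind_le_one x.1, h0 x.2.1 x.2.2, h1 x.2.1 x.2.2]
  have hψb : Bdd ψ := ⟨1, hψ⟩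
  let w : C.X.Ω → Bool × C.α × C.β := fun ω => (C.e ω, C.u ω, C.v ω)
  obtain ⟨X', π, u₁, u₂, v, hπ, herg, hu₁, hu₂, hv, hle⟩ := C.erg.exists_box_extension w ψ
  replace hle : η ≤ _ := hbox.trans hle
  let C' : Cfg :=
    { X := X'
      erg := herg
      e := fun ω => C.e (π ω)
      α := C.α × (Bool × C.α × C.β) × (Bool × C.α × C.β)
      β := C.β × (Bool × C.α × C.β)
      fα := inferInstance
      fβ := inferInstance
      u := fun ω => (C.u (π ω), u₁ ω, u₂ ω)
      v := fun ω => (C.v (π ω), v ω)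
      hu := fun ω => by rw [hπ.map₂, C.hu, hu₁, hu₂]
      hv := fun ω => by rw [hπ.map₁, C.hv, hv]
      Φ := fun a b => C.Φ a.1 b.1 + η * (ψ a.2.1 * ψ a.2.2 * ψ b.2) }
  refine ⟨C', π, ⟨hπ, fun _ => rfl⟩, ?_⟩
  have hU : ∀ ω, |ψ (u₁ ω) * ψ (u₂ ω) * ψ (v ω)| ≤ 1 := fun ω =>
    (mul_abs_le (mul_abs_le (hψ _) (hψ _)) (hψ _)).trans_eq (by norm_num)
  have e : C'.energy = X'.m (fun ω => ψ (w (π ω)) ^ 2) -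
      (2 * η) * X'.m (fun ω => ψ (w (π ω)) * (ψ (u₁ ω) * ψ (u₂ ω) * ψ (v ω))) +
      η ^ 2 * X'.m (fun ω => (ψ (u₁ ω) * ψ (u₂ ω) * ψ (v ω)) ^ 2) := by
    rw [← Mean.smul, ← Mean.smul, ← Mean.sub, ← Mean.add]
    change X'.m _ = X'.m _
    congr 1
    ext ω
    simp only [f, h, C', ψ, w]
    ring
  have e1 : X'.m (fun ω => ψ (w (π ω)) ^ 2) = C.energy :=
    hπ.map_mean (fun ω => ψ (w ω) ^ 2) ((hψb.comp w).pow 2)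
  have e2 : X'.m (fun ω => (ψ (u₁ ω) * ψ (u₂ ω) * ψ (v ω)) ^ 2) ≤ 1 :=
    X'.m.le_of_le (Bdd.pow ⟨1, hU⟩ 2) fun ω => by
      rw [← sq_abs]; exact pow_le_one₀ (abs_nonneg _) (hU ω)
  rw [e, e1]
  nlinarith [sq_nonneg η]

/-- The infimum of the energies of all extensions. -/
noncomputable def inf : ℝ :=
  sInf {x | ∃ (C' : Cfg) (π : C'.X.Ω → C.X.Ω), Over C' C π ∧ C'.energy = x}

variable {C}

theorem inf_le {C' : Cfg} {π : C'.X.Ω → C.X.Ω} (h : Over C' C π) : C.inf ≤ C'.energy :=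
  csInf_le ⟨0, by rintro _ ⟨D, _, _, rfl⟩; exact D.energy_nonneg⟩ ⟨C', π, h, rfl⟩

theorem exists_lt_inf_add {η : ℝ} (hη : 0 < η) :
    ∃ (C' : Cfg) (π : C'.X.Ω → C.X.Ω), Over C' C π ∧ C'.IsCondExp ∧ C'.energy < C.inf + η := by
  have hne : {x | ∃ (C' : Cfg) (π : C'.X.Ω → C.X.Ω), Over C' C π ∧ C'.energy = x}.Nonempty :=
    ⟨_, C, _, ⟨Factor.refl _, fun _ => rfl⟩, rfl⟩
  obtain ⟨_, ⟨C', π, h, rfl⟩, hlt⟩ := exists_lt_of_csInf_lt hne (lt_add_of_pos_right C.inf hη)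
  obtain ⟨Φ, hΦ, hle⟩ := C'.exists_condExp
  exact ⟨C'.withΦ Φ, _, (C'.over_withΦ Φ).comp h, hΦ, hle.trans_lt hlt⟩

theorem exists_structured_approx (C : Cfg) {ε : ℝ} (hε : 0 < ε) :
    ∃ (C₁ : Cfg) (π₁ : C₁.X.Ω → C.X.Ω), Over C₁ C π₁ ∧ C₁.IsCondExp ∧ ∀ η : ℝ, 0 < η →
      ∃ (C₂ : Cfg) (π₂ : C₂.X.Ω → C₁.X.Ω), Over C₂ C₁ π₂ ∧ C₂.IsCondExp ∧
        (C₂.X.box fun ω => C₂.f ω - C₂.h ω) < η ∧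
        C₂.X.m (fun ω => (C₁.h (π₂ ω) - C₂.h ω) ^ 2) ≤ 6 * ε := by
  obtain ⟨C₁, π₁, o₁, hc₁, lt₁⟩ := exists_lt_inf_add (C := C) hε
  refine ⟨C₁, π₁, o₁, hc₁, fun η hη => ?_⟩
  obtain ⟨C₂, π₂, o₂, hc₂, lt₂⟩ := exists_lt_inf_add (C := C₁) (lt_min hε (pow_pos hη 2))
  refine ⟨C₂, π₂, o₂, hc₂, ?_, ?_⟩
  · by_contra! hcon
    obtain ⟨C₃, π₃, o₃, le₃⟩ := C₂.exists_energy_decrement hc₂.nonneg hc₂.le_one hη.le hcon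
    have := inf_le (o₃.comp o₂)
    have := min_le_right ε (η ^ 2)
    linarith
  · let M : Cfg :=
      { X := C₂.X
        erg := C₂.erg
        e := C₂.e
        α := C₁.α × C₂.α
        β := C₁.β × C₂.β
        fα := inferInstance
        fβ := inferInstance
        u := fun ω => (C₁.u (π₂ ω), C₂.u ω)
        v := fun ω => (C₁.v (π₂ ω), C₂.v ω)
        hu := fun ω => by rw [o₂.factor.map₂, C₁.hu, C₂.hu]
        hv := fun ω => by rw [o₂.factor.map₁, C₁.hv, C₂.hv]
        Φ := fun a b => (C₁.Φ a.1 b.1 + C₂.Φ a.2 b.2) / 2 }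
    have oM : Over M C₂ (fun ω => ω) := ⟨Factor.refl _, fun _ => rfl⟩
    have hM := inf_le ((oM.comp o₂).comp o₁)
    have e₁ : C₂.X.m (fun ω => (C₂.f ω - C₁.h (π₂ ω)) ^ 2) = C₁.energy := by
      simp only [o₂.f_eq]
      exact o₂.factor.map_mean (fun ω => (C₁.f ω - C₁.h ω) ^ 2) ((C₁.f_bdd.sub C₁.h_bdd).pow 2)
    have e : C₂.X.m (fun ω => (C₁.h (π₂ ω) - C₂.h ω) ^ 2) =
        2 * C₁.energy + 2 * C₂.energy - 4 * M.energy := by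
      rw [← e₁, energy, ← Mean.smul, ← Mean.smul, ← Mean.add]
      change _ = _ - 4 * C₂.X.m _
      rw [← Mean.smul, ← Mean.sub]
      congr 1
      ext ω
      simp only [f, h, M]
      ring
    have := inf_le o₂
    have := min_le_left ε (η ^ 2)
    have : C₁.inf ≤ C₁.energy := inf_le (C := C₁) ⟨Factor.refl _, fun _ => rfl⟩
    rw [e]
    linarith

end Cfg

/-- Average over the first `r + 1` terms of an integer sequence. -/
noncomputable def finAvg (n : ℕ → ℤ) (r : ℕ) : Mean ℤ :=
  Mean.avg (Finset.range (r + 1)) (by simp) n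

theorem finAvg_apply (n : ℕ → ℤ) (r : ℕ) (F : ℤ → ℝ) :
    finAvg n r F = (∑ s ∈ Finset.range (r + 1), F (n s)) / (r + 1) := by
  rw [finAvg, Mean.avg_apply]; simp

theorem finAvg_le (n : ℕ → ℤ) (r : ℕ) {F : ℤ → ℝ} {c : ℝ} (h : ∀ s, F (n s) ≤ c) :
    finAvg n r F ≤ c := by
  rw [finAvg_apply, div_le_iff₀ (by positivity)]
  refine (Finset.sum_le_sum fun s _ => h s).trans_eq ?_
  simp; ring

theorem finAvg_mono (n : ℕ → ℤ) (r : ℕ) {F G : ℤ → ℝ} (h : ∀ a, F a ≤ G a) :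
    finAvg n r F ≤ finAvg n r G := by
  rw [finAvg_apply, finAvg_apply]
  exact div_le_div_of_nonneg_right (Finset.sum_le_sum fun s _ => h _) (by positivity)

theorem mean_finAvg {Ω : Type} (m : Mean Ω) (n : ℕ → ℤ) (r : ℕ) (K : ℤ → Ω → ℝ) :
    m (fun ω => finAvg n r (fun a => K a ω)) = finAvg n r (fun a => m (K a)) := by
  simp only [finAvg_apply, div_eq_mul_inv]
  rw [Mean.mul_const, Mean.sum]

theorem abs_finAvg_le (n : ℕ → ℤ) (r : ℕ) {F : ℤ → ℝ} {c : ℝ} (h : ∀ s, |F (n s)| ≤ c) :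
    |finAvg n r F| ≤ c := by
  rw [abs_le]
  refine ⟨?_, finAvg_le n r fun s => (le_abs_self _).trans (h s)⟩
  have := finAvg_le n r (F := fun a => -F a) (c := c) fun s => (neg_le_abs _).trans (h s)
  rw [Mean.neg] at this
  linarith

theorem finAvg_finAvg_le (n : ℕ → ℤ) (r : ℕ) {g : ℤ → ℤ → ℝ} {η : ℝ}
    (h : ∀ s t, s ≠ t → g (n s) (n t) ≤ η) (h2 : ∀ a, g a a ≤ 2) (hη : 0 ≤ η) :
    finAvg n r (fun a => finAvg n r (fun b => g a b)) ≤ η + 2 / (r + 1) := by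
  refine finAvg_le n r fun s => ?_
  rw [finAvg_apply, div_le_iff₀ (by positivity)]
  have : ∀ t ∈ Finset.range (r + 1), g (n s) (n t) ≤ η + if s = t then 2 else 0 := by
    intro t _
    split_ifs with hst
    · subst hst; linarith [h2 (n s)]
    · linarith [h s t hst]
  refine (Finset.sum_le_sum this).trans ?_
  rw [Finset.sum_add_distrib, Finset.sum_ite_eq, add_mul, div_mul_cancel₀ _ (by positivity)]
  have : (if s ∈ Finset.range (r + 1) then (2 : ℝ) else 0) ≤ 2 := by split_ifs <;> norm_num
  simp only [Finset.sum_const, Finset.card_range, nsmul_eq_mul]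
  push_cast
  linarith

/-- Average of a function along powers of a bijection. -/
noncomputable def av {Ω : Type} (S : Equiv.Perm Ω) (n : ℕ → ℤ) (r : ℕ) (ψ : Ω → ℝ) (ω : Ω) : ℝ :=
  finAvg n r fun a => ψ ((S ^ a) ω)

section av

variable {Ω : Type} {m : Mean Ω} {S : Equiv.Perm Ω} {n n' : ℕ → ℤ} {r r' : ℕ} {ψ ψ' : Ω → ℝ}

theorem av_abs_le {c : ℝ} (h : ∀ ω, |ψ ω| ≤ c) (ω : Ω) : |av S n r ψ ω| ≤ c :=
  abs_finAvg_le n r fun _ => h _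

theorem av_bdd (h : Bdd ψ) : Bdd (av S n r ψ) := by
  obtain ⟨c, hc⟩ := h
  exact ⟨c, av_abs_le hc⟩

theorem mean_av (hS : m.Inv S) (h : Bdd ψ) : m (av S n r ψ) = m ψ := by
  change m (fun ω => finAvg n r fun a => ψ ((S ^ a) ω)) = m ψ
  rw [mean_finAvg m n r (fun a ω => ψ ((S ^ a) ω))]
  simp only [hS.zpow _ ψ h, Mean.const]

theorem av_mono (h : ∀ ω, ψ ω ≤ ψ' ω) (ω : Ω) : av S n r ψ ω ≤ av S n r ψ' ω :=
  finAvg_mono n r fun _ => h _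

theorem av_sum {ι : Type*} (s : Finset ι) (ψ : ι → Ω → ℝ) (ω : Ω) :
    av S n r (fun ω => ∑ i ∈ s, ψ i ω) ω = ∑ i ∈ s, av S n r (ψ i) ω :=
  Mean.sum _ s _

theorem mean_av_mul_av :
    m (fun ω => av S n r ψ ω * av S n' r' ψ' ω) =
      finAvg n r fun a => finAvg n' r' fun b => m fun ω => ψ ((S ^ a) ω) * ψ' ((S ^ b) ω) := by
  have : (fun ω => av S n r ψ ω * av S n' r' ψ' ω) = fun ω => finAvg n r fun a =>
      finAvg n' r' fun b => ψ ((S ^ a) ω) * ψ' ((S ^ b) ω) := by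
    ext ω
    simp only [Mean.smul, Mean.mul_const, av]
  rw [this, mean_finAvg m n r fun a ω => finAvg n' r' fun b => ψ ((S ^ a) ω) * ψ' ((S ^ b) ω)]
  congr 1
  ext a
  exact mean_finAvg m n' r' fun b ω => ψ ((S ^ a) ω) * ψ' ((S ^ b) ω)

end av

theorem Sys.invS (X : Sys) : X.m.Inv (X.T₂ * X.T₁⁻¹) := X.inv₂.mul X.inv₁.symm

theorem Sys.commS₁ (X : Sys) (a : ℤ) (ω) :
    ((X.T₂ * X.T₁⁻¹) ^ a) (X.T₁ ω) = X.T₁ (((X.T₂ * X.T₁⁻¹) ^ a) ω) := by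
  have : Commute (X.T₂ * X.T₁⁻¹) X.T₁ := X.comm.symm.mul_left (Commute.refl X.T₁).inv_left
  rw [← Equiv.Perm.mul_apply, (this.zpow_left a).eq, Equiv.Perm.mul_apply]

theorem Sys.commS₂ (X : Sys) (a : ℤ) (ω) :
    ((X.T₂ * X.T₁⁻¹) ^ a) (X.T₂ ω) = X.T₂ (((X.T₂ * X.T₁⁻¹) ^ a) ω) := by
  have : Commute (X.T₂ * X.T₁⁻¹) X.T₂ := (Commute.refl X.T₂).mul_left X.comm.inv_left
  rw [← Equiv.Perm.mul_apply, (this.zpow_left a).eq, Equiv.Perm.mul_apply]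

/-- Averages along `T₂ T₁⁻¹` approximately factor over products of invariant functions. -/
theorem Sys.Erg.av_mul_approx {X : Sys} (hX : X.Erg) {p q : X.Ω → ℝ} (hp : ∀ ω, |p ω| ≤ 1)
    (hq : ∀ ω, |q ω| ≤ 1) (hpT : ∀ ω, p (X.T₂ ω) = p ω) (hqT : ∀ ω, q (X.T₁ ω) = q ω)
    {n : ℕ → ℤ} {r : ℕ} {c η : ℝ}
    (h : (finAvg n r fun a => finAvg n r fun b => |(X.m fun ω =>
      q (((X.T₂ * X.T₁⁻¹) ^ a) ω) * q (((X.T₂ * X.T₁⁻¹) ^ b) ω)) - c|) ≤ η) :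
    X.m (fun ω => (av (X.T₂ * X.T₁⁻¹) n r (fun ω => p ω * q ω) ω -
      av (X.T₂ * X.T₁⁻¹) n r q ω * av (X.T₂ * X.T₁⁻¹) n r p ω) ^ 2) ≤ 4 * η := by
  set S := X.T₂ * X.T₁⁻¹ with hS
  let P : ℤ → X.Ω → ℝ := fun a ω => p ((S ^ a) ω)
  let Q : ℤ → X.Ω → ℝ := fun a ω => q ((S ^ a) ω)
  have hP : ∀ a, Bdd (P a) := fun a => ⟨1, fun _ => hp _⟩
  have hQ : ∀ a, Bdd (Q a) := fun a => ⟨1, fun _ => hq _⟩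
  let ν := finAvg n r
  let x : ℤ → ℤ → ℝ := fun a b => X.m fun ω => P a ω * P b ω
  let y : ℤ → ℤ → ℝ := fun a b => X.m fun ω => Q a ω * Q b ω
  have e1 : ∀ ω, av S n r (fun ω => p ω * q ω) ω - av S n r q ω * av S n r p ω =
      ν fun s => ν fun t => P s ω * (Q s ω - Q t ω) := fun ω => by
    simp only [mul_sub, Mean.sub, Mean.const, Mean.smul, Mean.mul_const]
    rw [mul_comm (av S n r q ω)]
    rfl
  have e2 : (fun ω => (av S n r (fun ω => p ω * q ω) ω - av S n r q ω * av S n r p ω) ^ 2) =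
      fun ω => ν fun s => ν fun t => ν fun a => ν fun b =>
        (P s ω * (Q s ω - Q t ω)) * (P a ω * (Q a ω - Q b ω)) := by
    ext ω
    rw [e1, sq]
    simp only [← Mean.smul, ← Mean.mul_const]
    simp only [mul_comm (P _ ω * (Q _ ω - Q _ ω)) (P _ ω * (Q _ ω - Q _ ω))]
  have e3 : ∀ s t a b, X.m (fun ω => (P s ω * (Q s ω - Q t ω)) * (P a ω * (Q a ω - Q b ω))) =
      x s a * (y s a - y s b - y t a + y t b) := fun s t a b => by
    have h1 := hX.indep (φ := fun ω => P s ω * P a ω)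
      (ψ := fun ω => Q s ω * Q a ω - Q s ω * Q b ω - Q t ω * Q a ω + Q t ω * Q b ω)
      ((hP s).mul (hP a)) (((((hQ s).mul (hQ a)).sub ((hQ s).mul (hQ b))).sub
        ((hQ t).mul (hQ a))).add ((hQ t).mul (hQ b)))
      (fun ω => by simp only [P, S, X.commS₂, hpT]) (fun ω => by simp only [Q, S, X.commS₁, hqT])
    rw [Mean.add, Mean.sub, Mean.sub] at h1
    refine Eq.trans ?_ h1
    congr 1
    ext ω
    ring
  have hx : ∀ a b, |x a b| ≤ 1 := fun a b =>
    X.m.abs_le_of_le fun ω => (mul_abs_le (hp _) (hp _)).trans_eq (mul_one 1)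
  have e4 : ∀ s t a b, X.m (fun ω => (P s ω * (Q s ω - Q t ω)) * (P a ω * (Q a ω - Q b ω))) ≤
      |y s a - c| + |y s b - c| + |y t a - c| + |y t b - c| := fun s t a b => by
    rw [e3]
    refine (le_abs_self _).trans ?_
    rw [abs_mul]
    refine (mul_le_of_le_one_left (abs_nonneg _) (hx _ _)).trans ?_
    have : y s a - y s b - y t a + y t b =
      (y s a - c) - (y s b - c) - (y t a - c) + (y t b - c) := by ring
    rw [this]
    refine (abs_add_le _ _).trans (add_le_add_left ((abs_sub _ _).trans
      (add_le_add_left (abs_sub _ _) _)) _)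
  rw [e2]
  have sw : X.m (fun ω => ν fun s => ν fun t => ν fun a => ν fun b =>
        (P s ω * (Q s ω - Q t ω)) * (P a ω * (Q a ω - Q b ω))) =
      ν fun s => ν fun t => ν fun a => ν fun b => X.m fun ω =>
        (P s ω * (Q s ω - Q t ω)) * (P a ω * (Q a ω - Q b ω)) := by
    simp only [ν, mean_finAvg X.m n r (fun s ω => finAvg n r fun t => finAvg n r fun a =>
      finAvg n r fun b => (P s ω * (Q s ω - Q t ω)) * (P a ω * (Q a ω - Q b ω)))]
    congr 1; ext s
    rw [mean_finAvg X.m n r (fun t ω => finAvg n r fun a =>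
      finAvg n r fun b => (P s ω * (Q s ω - Q t ω)) * (P a ω * (Q a ω - Q b ω)))]
    congr 1; ext t
    rw [mean_finAvg X.m n r (fun a ω =>
      finAvg n r fun b => (P s ω * (Q s ω - Q t ω)) * (P a ω * (Q a ω - Q b ω)))]
    congr 1; ext a
    exact mean_finAvg X.m n r (fun b ω => (P s ω * (Q s ω - Q t ω)) * (P a ω * (Q a ω - Q b ω)))
  rw [sw]
  calc _ ≤ ν fun s => ν fun t => ν fun a => ν fun b =>
        |y s a - c| + |y s b - c| + |y t a - c| + |y t b - c| :=
        finAvg_mono n r fun s => finAvg_mono n r fun t => finAvg_mono n r fun a =>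
          finAvg_mono n r fun b => e4 s t a b
    _ = 4 * ν fun a => ν fun b => |y a b - c| := by
        simp only [Mean.add, Mean.const]
        ring
    _ ≤ 4 * η := by
        have : (ν fun a => ν fun b => |y a b - c|) ≤ η := h
        linarith

/-- Every member of the ultrafilter contains the difference set of a sequence. -/
def DiffRich (p : Ultrafilter ℤ) : Prop :=
  ∀ G ∈ p, ∃ n : ℕ → ℤ, ∀ s t, s < t → n t - n s ∈ G

section

attribute [local instance] Ultrafilter.add Ultrafilter.addSemigroup

theorem diffRich_of_idem (p : Ultrafilter ℤ) (hp : p + p = p) : DiffRich p := fun G hG => by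
  obtain ⟨a, ha⟩ := Hindman.exists_FS_of_large p hp G hG
  refine ⟨fun s => ∑ i ∈ Finset.range s, a.get i, fun s t hst => ha ?_⟩
  rw [← Finset.sum_Ico_eq_sub _ hst.le]
  exact Hindman.FS.finsetSum a _ (Finset.nonempty_Ico.2 hst)

theorem exists_diffRich {l : Mean ℤ} (hl : ShiftInv l) :
    ∃ p : Ultrafilter ℤ, DiffRich p ∧ ∀ A : Set ℤ, l (A.indicator 1) = 0 → Aᶜ ∈ p := by
  have hind : ∀ A : Set ℤ, Bdd (A.indicator (1 : ℤ → ℝ)) := fun A => ⟨1, fun n => by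
    by_cases h : n ∈ A <;> simp [h]⟩
  have hnn : ∀ (A : Set ℤ) n, 0 ≤ A.indicator (1 : ℤ → ℝ) n := fun A n =>
    Set.indicator_nonneg (fun _ _ => zero_le_one) n
  let K : Set (Ultrafilter ℤ) := {p | ∀ A : Set ℤ, l (A.indicator 1) = 0 → Aᶜ ∈ p}
  have hclosed : IsClosed K := by
    have : K = ⋂ A ∈ {A : Set ℤ | l (A.indicator 1) = 0}, {p : Ultrafilter ℤ | Aᶜ ∈ p} := by
      ext p; simp [K]
    rw [this]
    exact isClosed_biInter fun A _ => ultrafilter_isClosed_basic _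
  have hne : K.Nonempty := by
    let 𝓕 : Filter ℤ :=
      { sets := {B | l (Bᶜ.indicator 1) = 0}
        univ_sets := by
          have : l (fun _ => 0) = 0 := l.const 0
          simpa using this
        sets_of_superset := fun {B B'} hB hBB' => by
          refine le_antisymm ?_ (l.nonneg (hind _) (hnn _))
          refine (l.mono (hind _) (hind _) fun n => ?_).trans_eq hB
          exact Set.indicator_le_indicator_of_subset (Set.compl_subset_compl.2 hBB')
            (fun _ => zero_le_one) n
        inter_sets := fun {B B'} hB hB' => by
          refine le_antisymm ?_ (l.nonneg (hind _) (hnn _))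
          refine (l.mono (hind _) ((hind _).add (hind _)) fun n => ?_).trans_eq
            ((l.add (Bᶜ.indicator 1) (B'ᶜ.indicator 1)).trans (by rw [hB, hB', add_zero]))
          by_cases h : n ∈ B <;> by_cases h' : n ∈ B' <;> simp [h, h'] }
    have : 𝓕.NeBot := ⟨fun h => by
      have h1 : ∅ ∈ 𝓕 := by rw [h]; trivial
      have h2 : l ((∅ᶜ : Set ℤ).indicator 1) = 0 := h1
      have h3 : l (fun _ => 1) = 1 := l.const 1
      rw [Set.compl_empty, Set.indicator_univ] at h2
      have : l (1 : ℤ → ℝ) = 1 := h3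
      linarith⟩
    refine ⟨Ultrafilter.of 𝓕, fun A hA => Ultrafilter.of_le 𝓕 ?_⟩
    change l (Aᶜᶜ.indicator 1) = 0
    rwa [compl_compl]
  obtain ⟨p, hp, hpp⟩ := exists_idempotent_in_compact_add_subsemigroup
    Ultrafilter.continuous_add_left K hne hclosed.isCompact fun p hp q hq A hA => by
      change ∀ᶠ n in ((p + q : Ultrafilter ℤ) : Filter ℤ), n ∈ Aᶜ
      rw [Ultrafilter.eventually_add]
      refine Eventually.of_forall fun k => ?_
      have : l ({n | k + n ∈ A}.indicator 1) = 0 := by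
        rw [← hA, ← hl.zpow k _ (hind A)]
        congr 1
        ext n
        rw [addRight_zpow, add_comm n k]
        rfl
      exact hq _ this
  exact ⟨p, diffRich_of_idem p hpp, hp⟩

end

theorem abs_finAvg_range_le {n : ℕ → ℤ} {r : ℕ} {F : ℤ → ℝ} {c : ℝ}
    (h : ∀ s < r + 1, |F (n s)| ≤ c) : |finAvg n r F| ≤ c := by
  rw [finAvg_apply, abs_div, abs_of_pos (by positivity : (0 : ℝ) < r + 1),
    div_le_iff₀ (by positivity)]
  refine (Finset.abs_sum_le_sum_abs _ _).trans
    ((Finset.sum_le_sum fun s hs => h s (Finset.mem_range.1 hs)).trans_eq ?_)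
  simp; ring

theorem abs_finAvg_le_finAvg_abs (n : ℕ → ℤ) (r : ℕ) (F : ℤ → ℝ) :
    |finAvg n r F| ≤ finAvg n r fun a => |F a| := by
  rw [finAvg_apply, finAvg_apply, abs_div, abs_of_pos (by positivity : (0 : ℝ) < r + 1)]
  exact div_le_div_of_nonneg_right (Finset.abs_sum_le_sum_abs _ _) (by positivity)

theorem exists_av_approx {Ω : Type} {m : Mean Ω} {S : Equiv.Perm Ω} (hS : m.Inv S)
    {p : Ultrafilter ℤ} (hp : DiffRich p) {I : Type*} [Fintype I] (ψ : I → Ω → ℝ)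
    (hψ : ∀ k ω, |ψ k ω| ≤ 1) (c : I → I → ℝ)
    (hc : ∀ k l, Tendsto (fun n : ℤ => m fun ω => ψ k ω * ψ l ((S ^ n) ω)) p (𝓝 (c k l)))
    {η : ℝ} (hη : 0 < η) :
    ∃ n : ℕ → ℤ, ∃ r : ℕ, (∀ k, (finAvg n r fun a => finAvg n r fun b =>
        |(m fun ω => ψ k ((S ^ a) ω) * ψ k ((S ^ b) ω)) - c k k|) ≤ η) ∧
      ∀ k l, |m (fun ω => av S n r (ψ k) ω * av S n r (ψ l) ω) - c k l| ≤ η := by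
  obtain ⟨η₀, h0, h1, h2⟩ : ∃ η₀, 0 < η₀ ∧ η₀ ≤ η / 4 ∧ 6 * η₀ ≤ (η / 4) ^ 2 :=
    ⟨min (η / 4) (η ^ 2 / 96), by positivity, min_le_left _ _, by
      have := min_le_right (η / 4) (η ^ 2 / 96)
      linarith⟩
  have hG : {n : ℤ | ∀ k l, |(m fun ω => ψ k ω * ψ l ((S ^ n) ω)) - c k l| ≤ η₀} ∈ p := by
    change ∀ᶠ n in (p : Filter ℤ), ∀ k l, _
    rw [eventually_all]
    intro k
    rw [eventually_all]
    intro l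
    exact ((hc k l).eventually (Metric.closedBall_mem_nhds _ h0)).mono fun n hn => hn
  obtain ⟨n, hn⟩ := hp _ hG
  have hcorr : ∀ k l s t, s < t →
      |(m fun ω => ψ k ((S ^ n s) ω) * ψ l ((S ^ n t) ω)) - c k l| ≤ η₀ := by
    intro k l s t hst
    have hb : Bdd fun ω => ψ k ω * ψ l ((S ^ (n t - n s)) ω) :=
      (Bdd.of_le (hψ k)).mul ((Bdd.of_le (hψ l)).comp _)
    have := hn s t hst k l
    rw [← hS.zpow (n s) _ hb] at this
    simpa only [← Equiv.Perm.mul_apply, ← zpow_add, sub_add_cancel] using this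
  have hc1 : ∀ k l, |c k l| ≤ 1 := fun k l => by
    refine le_of_tendsto (hc k l).abs (Eventually.of_forall fun n => ?_)
    exact m.abs_le_of_le fun ω => (mul_abs_le (hψ k _) (hψ l _)).trans_eq (mul_one 1)
  obtain ⟨r, hr⟩ : ∃ r : ℕ, 2 / ((r : ℝ) + 1) ≤ η₀ := by
    obtain ⟨r, hr⟩ := exists_nat_gt (2 / η₀)
    refine ⟨r, ?_⟩
    rw [div_lt_iff₀ h0] at hr
    rw [div_le_iff₀ (by positivity)]
    nlinarith
  have hblock : ∀ d k, (finAvg (fun s => n (s + d)) r fun a => finAvg (fun s => n (s + d)) r fun b =>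
        |(m fun ω => ψ k ((S ^ a) ω) * ψ k ((S ^ b) ω)) - c k k|) ≤ 2 * η₀ := by
    intro d k
    refine (finAvg_finAvg_le _ r (η := η₀) (fun s t hst => ?_) (fun a => ?_) h0.le).trans
      (by linarith)
    · rcases lt_or_gt_of_ne hst with h | h
      · exact hcorr k k _ _ (by omega)
      · have := hcorr k k (t + d) (s + d) (by omega)
        simpa only [mul_comm (ψ k ((S ^ n (s + d)) _))] using this
    · refine (abs_sub _ _).trans ?_
      have := hc1 k k
      have : |m fun ω => ψ k ((S ^ a) ω) * ψ k ((S ^ a) ω)| ≤ 1 :=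
        m.abs_le_of_le fun ω => (mul_abs_le (hψ k _) (hψ k _)).trans_eq (mul_one 1)
      linarith
  have hsub : ∀ (n₁ n₂ : ℕ → ℤ) k l, ((finAvg n₁ r fun a => finAvg n₂ r fun b =>
        m fun ω => ψ k ((S ^ a) ω) * ψ l ((S ^ b) ω)) - c k l) =
        finAvg n₁ r fun a => finAvg n₂ r fun b =>
          (m fun ω => ψ k ((S ^ a) ω) * ψ l ((S ^ b) ω)) - c k l := by
    intro n₁ n₂ k l
    simp only [Mean.sub, Mean.const]
  have hdiff : ∀ (n₁ n₂ : ℕ → ℤ) k l e, (finAvg n₁ r fun a => finAvg n₂ r fun b =>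
        |(m fun ω => ψ k ((S ^ a) ω) * ψ l ((S ^ b) ω)) - c k l|) ≤ e →
      |m (fun ω => av S n₁ r (ψ k) ω * av S n₂ r (ψ l) ω) - c k l| ≤ e := by
    intro n₁ n₂ k l e h
    rw [mean_av_mul_av]
    rw [hsub]
    refine le_trans ?_ h
    exact (abs_finAvg_le_finAvg_abs _ _ _).trans
      (finAvg_mono _ _ fun a => abs_finAvg_le_finAvg_abs _ _ _)
  have hcross : ∀ k l, |m (fun ω => av S n r (ψ k) ω *
      av S (fun s => n (s + (r + 1))) r (ψ l) ω) - c k l| ≤ η₀ := by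
    intro k l
    rw [mean_av_mul_av]
    rw [hsub]
    refine abs_finAvg_range_le fun s hs => abs_finAvg_range_le fun t ht => ?_
    exact hcorr k l _ _ (by omega)
  refine ⟨n, r, fun k => (hblock 0 k).trans (by linarith), fun k l => ?_⟩
  have hA : ∀ n k, Bdd (av S n r (ψ k)) := fun n k => ⟨1, av_abs_le (hψ k)⟩
  set A := fun k => av S n r (ψ k)
  set B := fun k => av S (fun s => n (s + (r + 1))) r (ψ k)
  have e1 : |m (fun ω => A l ω * A l ω) - c l l| ≤ 2 * η₀ := hdiff _ _ _ _ _ (hblock 0 l)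
  have e2 : |m (fun ω => B l ω * B l ω) - c l l| ≤ 2 * η₀ := hdiff _ _ _ _ _ (hblock (r + 1) l)
  have e3 := hcross l l
  have e4 := hcross k l
  change |m (fun ω => A l ω * B l ω) - c l l| ≤ η₀ at e3
  change |m (fun ω => A k ω * B l ω) - c k l| ≤ η₀ at e4
  have e5 : m (fun ω => (A l ω - B l ω) ^ 2) ≤ 6 * η₀ := by
    have : (fun ω => (A l ω - B l ω) ^ 2) =
        fun ω => A l ω * A l ω - 2 * (A l ω * B l ω) + B l ω * B l ω := by
      ext ω; ring
    rw [this, Mean.add, Mean.sub, Mean.smul]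
    rw [abs_le] at e1 e2 e3
    linarith
  have e6 : |m fun ω => A k ω * (A l ω - B l ω)| ≤ η / 4 := by
    refine (m.abs_le_sqrt ((hA _ _).mul ((hA _ _).sub (hA _ _)))).trans ?_
    rw [Real.sqrt_le_left (by positivity)]
    refine le_trans (m.mono (((hA _ _).mul ((hA _ _).sub (hA _ _))).pow 2)
      (((hA _ _).sub (hA _ _)).pow 2) fun ω => ?_) (e5.trans h2)
    rw [mul_pow]
    refine mul_le_of_le_one_left (sq_nonneg _) ?_
    rw [sq_le_one_iff_abs_le_one]
    exact av_abs_le (hψ k) ω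
  have e7 : (m fun ω => A k ω * (A l ω - B l ω)) =
      m (fun ω => A k ω * A l ω) - m fun ω => A k ω * B l ω := by
    simp only [mul_sub, Mean.sub]
  rw [e7] at e6
  rw [abs_le] at e4 e6 ⊢
  constructor <;> linarith

theorem four_mul_le_add {x y z v c : ℝ} (hx : 0 ≤ x) (hy : 0 ≤ y) (hz : 0 ≤ z) (hv : 0 ≤ v)
    (hc : 0 ≤ c) (h : c ^ 4 ≤ x * y * (z * v)) : 4 * c ≤ x + y + z + v := by
  have h1 : 4 * (x * y) ≤ (x + y) ^ 2 := by nlinarith [sq_nonneg (x - y)]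
  have h2 : 4 * (z * v) ≤ (z + v) ^ 2 := by nlinarith [sq_nonneg (z - v)]
  have h3 : (4 * c ^ 2) ^ 2 ≤ ((x + y) * (z + v)) ^ 2 := by
    have := mul_le_mul h1 h2 (by positivity) (by positivity)
    nlinarith
  have h4 : 4 * c ^ 2 ≤ (x + y) * (z + v) :=
    (pow_le_pow_iff_left₀ (by positivity) (by positivity) two_ne_zero).1 h3
  have h5 : (4 * c) ^ 2 ≤ (x + y + z + v) ^ 2 := by nlinarith [sq_nonneg ((x + y) - (z + v))]
  exact (pow_le_pow_iff_left₀ (by positivity) (by positivity) two_ne_zero).1 h5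

theorem weighted_amgm {a b α β γ c φ δ : ℝ} (hc : 0 ≤ c) (ha : c ≤ a) (hb : c ≤ b)
    (hγ : c ≤ γ) (hα : a ≤ α) (hβ : b ≤ β) (hφ : 0 < φ) (hδ : 0 < δ) :
    4 * c ≤ φ / δ ^ 3 * (b * a + |γ - β * α|) + δ / φ * c + δ * (c * (α / a)) +
      δ * (c * (β / b)) := by
  rcases hc.eq_or_lt with rfl | hc'
  · have : 0 ≤ b * a := mul_nonneg hb ha
    have := abs_nonneg (γ - β * α)
    simp only [mul_zero, zero_mul, add_zero]
    positivity
  have ha' := hc'.trans_le ha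
  have hb' := hc'.trans_le hb
  have hα' := ha'.trans_le hα
  have hβ' := hb'.trans_le hβ
  have he := abs_nonneg (γ - β * α)
  refine four_mul_le_add (by positivity) (by positivity) (by positivity) (by positivity) hc ?_
  have h1 : b * a * c ≤ (b * a + |γ - β * α|) * (α * β) := by
    have := le_abs_self (γ - β * α)
    have h2 : b * a ≤ β * α := mul_le_mul hβ hα ha'.le hβ'.le
    have h3 : |γ - β * α| * (b * a) ≤ |γ - β * α| * (β * α) := mul_le_mul_of_nonneg_left h2 he
    have h4 : b * a * c ≤ b * a * (|γ - β * α| + β * α) :=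
      mul_le_mul_of_nonneg_left (by linarith) (by positivity)
    linarith
  have h2 : φ / δ ^ 3 * (b * a + |γ - β * α|) * (δ / φ * c) * (δ * (c * (α / a)) *
      (δ * (c * (β / b)))) = (b * a + |γ - β * α|) * (α * β) * (c ^ 3 / (b * a)) := by
    field_simp
  rw [h2]
  calc c ^ 4 = b * a * c * (c ^ 3 / (b * a)) := by field_simp
    _ ≤ _ := mul_le_mul_of_nonneg_right h1 (by positivity)

theorem Bdd.exists_tendsto {Ω : Type} {w : Ω → ℝ} (hw : Bdd w) (p : Ultrafilter Ω) :
    ∃ c, Tendsto w p (𝓝 c) := by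
  obtain ⟨C, hC⟩ := hw
  obtain ⟨c, -, hc⟩ := (isCompact_Icc (a := -C) (b := C)).ultrafilter_le_nhds (p.map w) (by
    rw [le_principal_iff]
    exact (Eventually.of_forall fun x => abs_le.1 (hC x) : ∀ᶠ x in (p : Filter Ω), _))
  exact ⟨c, hc⟩

namespace Cfg

variable {C : Cfg}

variable (C) in
theorem p_T₂ (i : C.α) (ω : C.X.Ω) : C.p i (C.X.T₂ ω) = C.p i ω := by
  unfold p; rw [C.hu]

variable (C) in
theorem q_T₁ (j : C.β) (ω : C.X.Ω) : C.q j (C.X.T₁ ω) = C.q j ω := by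
  unfold q; rw [C.hv]

theorem IsCondExp.pow_four_le_av (hC : C.IsCondExp) {n : ℕ → ℤ} {r : ℕ} {c : C.β → ℝ} {η τ : ℝ}
    (h : ∀ j, (finAvg n r fun a => finAvg n r fun b => |(C.X.m fun ω =>
      C.q j (((C.X.T₂ * C.X.T₁⁻¹) ^ a) ω) * C.q j (((C.X.T₂ * C.X.T₁⁻¹) ^ b) ω)) - c j|) ≤ η)
    (hτ : 0 < τ) (hτ1 : τ ≤ 1) (hδ : 0 < C.X.m C.f) :
    C.X.m C.f ^ 4 ≤ (∑ i, ∑ j, C.Φ i j * C.X.m fun ω =>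
      av (C.X.T₂ * C.X.T₁⁻¹) n r (fun ω => C.q j ω * C.f ω) ω *
      av (C.X.T₂ * C.X.T₁⁻¹) n r (fun ω => C.p i ω * C.f ω) ω) + τ +
      (Fintype.card C.α * Fintype.card C.β : ℝ) * (2 * √(4 * η)) := by
  set S := C.X.T₂ * C.X.T₁⁻¹
  set δ := C.X.m C.f with hδ'
  let a : C.α → C.X.Ω → ℝ := fun i => av S n r fun ω => C.p i ω * C.f ω
  let b : C.β → C.X.Ω → ℝ := fun j => av S n r fun ω => C.q j ω * C.f ω
  let α : C.α → C.X.Ω → ℝ := fun i => av S n r (C.p i)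
  let β : C.β → C.X.Ω → ℝ := fun j => av S n r (C.q j)
  let γ : C.α → C.β → C.X.Ω → ℝ := fun i j => av S n r fun ω => C.p i ω * C.q j ω
  let κ : C.α → C.β → C.X.Ω → ℝ := fun i j => av S n r fun ω => C.f ω * (C.p i ω * C.q j ω)
  let D : C.α → C.β → C.X.Ω → ℝ := fun i j ω => |γ i j ω - β j ω * α i ω|
  let g : C.X.Ω → ℝ := av S n r C.f
  have hf0 : ∀ ω, 0 ≤ C.f ω := fun ω => ind_nonneg _
  have hf1 : ∀ ω, C.f ω ≤ 1 := fun ω => ind_le_one _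
  have hav0 : ∀ {ψ : C.X.Ω → ℝ}, (∀ ω, 0 ≤ ψ ω) → ∀ ω, 0 ≤ av S n r ψ ω := fun {ψ} hψ ω => by
    have := av_mono (S := S) (n := n) (r := r) hψ ω
    rwa [av, Mean.const] at this
  have hp0 := C.p_nonneg
  have hp1 := C.p_le_one
  have hq0 := C.q_nonneg
  have hq1 := C.q_le_one
  have hκ0 : ∀ i j ω, 0 ≤ κ i j ω := fun i j =>
    hav0 fun ω => mul_nonneg (hf0 _) (mul_nonneg (hp0 _ _) (hq0 _ _))
  have hκa : ∀ i j ω, κ i j ω ≤ a i ω := fun i j => av_mono fun ω => by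
    rw [mul_comm (C.f ω)]
    exact mul_le_mul_of_nonneg_right (mul_le_of_le_one_right (hp0 _ _) (hq1 _ _)) (hf0 _)
  have hκb : ∀ i j ω, κ i j ω ≤ b j ω := fun i j => av_mono fun ω => by
    rw [mul_comm (C.f ω)]
    exact mul_le_mul_of_nonneg_right (mul_le_of_le_one_left (hq0 _ _) (hp1 _ _)) (hf0 _)
  have hκγ : ∀ i j ω, κ i j ω ≤ γ i j ω := fun i j => av_mono fun ω =>
    mul_le_of_le_one_left (mul_nonneg (hp0 _ _) (hq0 _ _)) (hf1 _)
  have haα : ∀ i ω, a i ω ≤ α i ω := fun i => av_mono fun ω =>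
    mul_le_of_le_one_right (hp0 _ _) (hf1 _)
  have hbβ : ∀ i ω, b i ω ≤ β i ω := fun i => av_mono fun ω =>
    mul_le_of_le_one_right (hq0 _ _) (hf1 _)
  have ha0 : ∀ i ω, 0 ≤ a i ω := fun i => hav0 fun ω => mul_nonneg (hp0 _ _) (hf0 _)
  have hb0 : ∀ i ω, 0 ≤ b i ω := fun i => hav0 fun ω => mul_nonneg (hq0 _ _) (hf0 _)
  have hg0 : ∀ ω, 0 ≤ g ω := hav0 hf0
  have hg1 : ∀ ω, g ω ≤ 1 := fun ω => (abs_le.1 (av_abs_le (fun ω => ind_abs (C.e ω)) ω)).2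
  have sκa : ∀ i ω, ∑ j, κ i j ω = a i ω := fun i ω => by
    simp only [κ, a, ← av_sum]
    congr 1
    ext ω
    rw [← Finset.mul_sum, ← Finset.mul_sum, C.sum_q, mul_one, mul_comm]
  have sκb : ∀ j ω, ∑ i, κ i j ω = b j ω := fun j ω => by
    simp only [κ, b, ← av_sum]
    congr 1
    ext ω
    rw [← Finset.mul_sum, ← Finset.sum_mul, C.sum_p, one_mul, mul_comm]
  have sa : ∀ ω, ∑ i, a i ω = g ω := fun ω => by
    simp only [a, g, ← av_sum]
    congr 1
    ext ω
    rw [← Finset.sum_mul, C.sum_p, one_mul]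
  have sb : ∀ ω, ∑ i, b i ω = g ω := fun ω => by
    simp only [b, g, ← av_sum]
    congr 1
    ext ω
    rw [← Finset.sum_mul, C.sum_q, one_mul]
  have sα : ∀ ω, ∑ i, α i ω = 1 := fun ω => by
    simp only [α, ← av_sum, C.sum_p]
    rw [av, Mean.const]
  have sβ : ∀ ω, ∑ i, β i ω = 1 := fun ω => by
    simp only [β, ← av_sum, C.sum_q]
    rw [av, Mean.const]
  have ba : ∀ i, Bdd (a i) := fun i => av_bdd ((C.p_bdd i).mul C.f_bdd)
  have bb : ∀ i, Bdd (b i) := fun i => av_bdd ((C.q_bdd i).mul C.f_bdd)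
  have bα : ∀ i, Bdd (α i) := fun i => av_bdd (C.p_bdd i)
  have bβ : ∀ i, Bdd (β i) := fun i => av_bdd (C.q_bdd i)
  have bγ : ∀ i j, Bdd (γ i j) := fun i j => av_bdd ((C.p_bdd i).mul (C.q_bdd j))
  have bκ : ∀ i j, Bdd (κ i j) := fun i j =>
    av_bdd (C.f_bdd.mul ((C.p_bdd i).mul (C.q_bdd j)))
  have bγβα : ∀ i j, Bdd (fun ω => γ i j ω - β j ω * α i ω) := fun i j =>
    (bγ i j).sub ((bβ j).mul (bα i))
  have bD : ∀ i j, Bdd (D i j) := fun i j => (bγβα i j).abs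
  have bg : Bdd g := av_bdd C.f_bdd
  have hΦ0 : ∀ i j, 0 < C.Φ i j + τ := fun i j => by linarith [hC.nonneg i j]
  have key : ∀ ω, 4 * g ω ≤ (∑ i, ∑ j, ((C.Φ i j + τ) / δ ^ 3 * (b j ω * a i ω + D i j ω) +
      δ / (C.Φ i j + τ) * κ i j ω)) + 2 * δ := by
    intro ω
    have h1 : ∑ i, ∑ j, 4 * κ i j ω ≤ ∑ i, ∑ j, ((C.Φ i j + τ) / δ ^ 3 * (b j ω * a i ω + D i j ω) +
      δ / (C.Φ i j + τ) * κ i j ω + δ * (κ i j ω * (α i ω / a i ω)) +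
      δ * (κ i j ω * (β j ω / b j ω))) :=
      Finset.sum_le_sum fun i _ => Finset.sum_le_sum fun j _ =>
        weighted_amgm (hκ0 i j ω) (hκa i j ω) (hκb i j ω) (hκγ i j ω) (haα i ω) (hbβ j ω)
          (hΦ0 i j) hδ
    have h2 : ∑ i, ∑ j, 4 * κ i j ω = 4 * g ω := by
      simp only [← Finset.mul_sum, sκa, sa]
    have h3 : ∑ i, ∑ j, δ * (κ i j ω * (α i ω / a i ω)) ≤ δ := by
      simp only [← Finset.mul_sum, ← Finset.sum_mul, sκa]
      refine mul_le_of_le_one_right hδ.le ((Finset.sum_le_sum fun i _ => ?_).trans_eq (sα ω))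
      rcases (ha0 i ω).eq_or_lt with h | h
      · rw [← h, zero_mul, h]; exact haα i ω
      · rw [mul_div_cancel₀ _ h.ne']
    have h4 : ∑ i, ∑ j, δ * (κ i j ω * (β j ω / b j ω)) ≤ δ := by
      rw [Finset.sum_comm]
      simp only [← Finset.mul_sum, ← Finset.sum_mul, sκb]
      refine mul_le_of_le_one_right hδ.le ((Finset.sum_le_sum fun i _ => ?_).trans_eq (sβ ω))
      rcases (hb0 i ω).eq_or_lt with h | h
      · rw [← h, zero_mul, h]; exact hbβ i ω
      · rw [mul_div_cancel₀ _ h.ne']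
    rw [h2] at h1
    simp only [Finset.sum_add_distrib] at h1 ⊢
    linarith
  have hD : ∀ i j, C.X.m (D i j) ≤ √(4 * η) := by
    intro i j
    refine (le_abs_self _).trans ((C.X.m.abs_le_sqrt (bD i j)).trans (Real.sqrt_le_sqrt ?_))
    refine le_of_eq_of_le ?_ (C.erg.av_mul_approx (C.p_abs i) (C.q_abs j)
      (C.p_T₂ i) (C.q_T₁ j) (h j))
    simp only [D, sq_abs]
    rfl
  have hS : C.X.m.Inv S := C.X.invS
  have bsum : Bdd fun ω => ∑ i, ∑ j, ((C.Φ i j + τ) / δ ^ 3 * (b j ω * a i ω + D i j ω) +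
      δ / (C.Φ i j + τ) * κ i j ω) := Bdd.sum _ fun i _ => Bdd.sum _ fun j _ =>
    ((Bdd.const _).mul (((bb j).mul (ba i)).add (bD i j))).add ((Bdd.const _).mul (bκ i j))
  have h1 := C.X.m.mono ((Bdd.const 4).mul bg) (bsum.add (Bdd.const (2 * δ))) key
  rw [Mean.smul, Mean.add, Mean.const, mean_av hS C.f_bdd] at h1
  simp only [Mean.sum, Mean.add, Mean.smul] at h1
  have h2 : ∑ i, ∑ j, δ / (C.Φ i j + τ) * C.X.m (κ i j) ≤ δ := by
    have : ∀ i j, δ / (C.Φ i j + τ) * C.X.m (κ i j) ≤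
        δ * C.X.m fun ω => C.p i ω * C.q j ω := by
      intro i j
      rw [mean_av hS (C.f_bdd.mul ((C.p_bdd i).mul (C.q_bdd j))), hC.mean]
      have h5 : 0 ≤ C.X.m fun ω => C.p i ω * C.q j ω :=
        C.X.m.nonneg ((C.p_bdd i).mul (C.q_bdd j)) fun ω => mul_nonneg (hp0 _ _) (hq0 _ _)
      rw [div_mul_eq_mul_div, div_le_iff₀ (hΦ0 i j)]
      have := mul_nonneg (mul_nonneg hδ.le h5) hτ.le
      linarith
    refine (Finset.sum_le_sum fun i _ => Finset.sum_le_sum fun j _ => this i j).trans_eq ?_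
    simp only [← Finset.mul_sum]
    have := C.mean_pq fun _ _ _ => 1
    simp only [one_mul, Mean.const] at this
    rw [← this, mul_one]
  have h3 : ∀ i j, (C.Φ i j + τ) / δ ^ 3 * (C.X.m (fun ω => b j ω * a i ω) + C.X.m (D i j)) ≤
      (C.Φ i j * C.X.m (fun ω => b j ω * a i ω) + τ * C.X.m (fun ω => b j ω * a i ω) +
        2 * √(4 * η)) / δ ^ 3 := by
    intro i j
    rw [div_mul_eq_mul_div]
    refine div_le_div_of_nonneg_right ?_ (by positivity)
    have : (C.Φ i j + τ) * C.X.m (D i j) ≤ 2 * √(4 * η) :=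
      mul_le_mul (by linarith [hC.le_one i j]) (hD i j)
        (C.X.m.nonneg (bD i j) fun ω => abs_nonneg _) (by norm_num)
    linarith
  have h4 : ∑ i, ∑ j, C.X.m (fun ω => b j ω * a i ω) ≤ 1 := by
    simp only [← Mean.sum]
    refine C.X.m.le_of_le (Bdd.sum _ fun i _ => Bdd.sum _ fun j _ => (bb j).mul (ba i)) fun ω => ?_
    simp only [← Finset.sum_mul, ← Finset.mul_sum, sa, sb]
    exact mul_le_one₀ (hg1 ω) (hg0 ω) (hg1 ω)
  have h5 := Finset.sum_le_sum fun i (_ : i ∈ Finset.univ) =>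
    Finset.sum_le_sum fun j (_ : j ∈ Finset.univ) => h3 i j
  simp only [← Finset.sum_div, Finset.sum_add_distrib, ← Finset.mul_sum, Finset.sum_const,
    Finset.card_univ, nsmul_eq_mul] at h5 h1
  have h6 : δ ≤ ((∑ i, ∑ j, C.Φ i j * C.X.m (fun ω => b j ω * a i ω)) +
      τ * (∑ i, ∑ j, C.X.m (fun ω => b j ω * a i ω)) +
      2 * (Fintype.card C.β * (Fintype.card C.α * √(4 * η)))) / δ ^ 3 := by
    refine le_trans ?_ h5
    linarith
  rw [le_div_iff₀ (by positivity)] at h6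
  have h7 := mul_le_mul_of_nonneg_left h4 hτ.le
  change C.X.m C.f ^ 4 ≤ (∑ i, ∑ j, C.Φ i j * C.X.m (fun ω => b j ω * a i ω)) + _ + _
  linarith

theorem mean_h_mul (n : ℤ) :
    C.X.m (fun ω => C.h ω * C.f ((C.X.T₁ ^ n) ω) * C.f ((C.X.T₂ ^ n) ω)) =
      ∑ i, ∑ j, C.Φ i j * C.X.m fun ω => (C.q j ω * C.f ω) *
        (C.p i (((C.X.T₂ * C.X.T₁⁻¹) ^ n) ω) * C.f (((C.X.T₂ * C.X.T₁⁻¹) ^ n) ω)) := by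
  have h1 : (fun ω => C.h ω * C.f ((C.X.T₁ ^ n) ω) * C.f ((C.X.T₂ ^ n) ω)) = fun ω =>
      ∑ i, ∑ j, C.Φ i j * ((C.q j ((C.X.T₁ ^ n) ω) * C.f ((C.X.T₁ ^ n) ω)) *
        (C.p i ((C.X.T₂ ^ n) ω) * C.f ((C.X.T₂ ^ n) ω))) := by
    ext ω
    rw [h, ← C.sum_pq C.Φ ω, Finset.sum_mul, Finset.sum_mul]
    refine Finset.sum_congr rfl fun i _ => ?_
    rw [Finset.sum_mul, Finset.sum_mul]
    refine Finset.sum_congr rfl fun j _ => ?_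
    rw [zpow_invariant (C.p_T₂ i), zpow_invariant (C.q_T₁ j)]
    ring
  rw [h1]
  simp only [Mean.sum, Mean.smul]
  refine Finset.sum_congr rfl fun i _ => Finset.sum_congr rfl fun j _ => ?_
  congr 1
  have hb : Bdd fun ω => (C.q j ω * C.f ω) *
        (C.p i (((C.X.T₂ * C.X.T₁⁻¹) ^ n) ω) * C.f (((C.X.T₂ * C.X.T₁⁻¹) ^ n) ω)) :=
    ((C.q_bdd j).mul C.f_bdd).mul (((C.p_bdd i).mul C.f_bdd).comp _)
  rw [← C.X.inv₁.zpow n _ hb]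
  congr 1
  ext ω
  have h2 : ((C.X.T₂ * C.X.T₁⁻¹) ^ n) ((C.X.T₁ ^ n) ω) = (C.X.T₂ ^ n) ω := by
    have : Commute C.X.T₂ C.X.T₁⁻¹ := C.X.comm.symm.inv_right
    rw [← Equiv.Perm.mul_apply, this.mul_zpow, inv_zpow, inv_mul_cancel_right]
  rw [h2]

theorem IsCondExp.pow_four_le_lim (hC : C.IsCondExp) (hδ : 0 < C.X.m C.f) {p : Ultrafilter ℤ}
    (hp : DiffRich p) :
    ∃ L, C.X.m C.f ^ 4 ≤ L ∧ Tendsto (fun n : ℤ => C.X.m fun ω =>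
      C.h ω * C.f ((C.X.T₁ ^ n) ω) * C.f ((C.X.T₂ ^ n) ω)) p (𝓝 L) := by
  set S := C.X.T₂ * C.X.T₁⁻¹ with hS
  let ψ : C.β ⊕ (C.α ⊕ C.β) → C.X.Ω → ℝ := Sum.elim C.q
    (Sum.elim (fun i ω => C.p i ω * C.f ω) (fun j ω => C.q j ω * C.f ω))
  have hψ : ∀ k ω, |ψ k ω| ≤ 1 := by
    rintro (j | i | j) ω
    · exact C.q_abs j ω
    · exact (mul_abs_le (C.p_abs i ω) (ind_abs _)).trans_eq (mul_one 1)
    · exact (mul_abs_le (C.q_abs j ω) (ind_abs _)).trans_eq (mul_one 1)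
  have hlim : ∀ k l, ∃ c, Tendsto (fun n : ℤ => C.X.m fun ω => ψ k ω * ψ l ((S ^ n) ω)) p (𝓝 c) :=
    fun k l => Bdd.exists_tendsto ⟨1, fun n => C.X.m.abs_le_of_le fun ω =>
      (mul_abs_le (hψ _ _) (hψ _ _)).trans_eq (mul_one 1)⟩ p
  choose c hc using hlim
  refine ⟨∑ i, ∑ j, C.Φ i j * c (.inr (.inr j)) (.inr (.inl i)), ?_, ?_⟩
  · set L := ∑ i, ∑ j, C.Φ i j * c (.inr (.inr j)) (.inr (.inl i))
    set K : ℝ := Fintype.card C.α * Fintype.card C.β with hK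
    have key : ∀ t : ℝ, 0 < t → t ≤ 1 → C.X.m C.f ^ 4 ≤ L + K * t ^ 2 + t + K * (2 * (2 * t)) := by
      intro t ht ht1
      obtain ⟨n, r, h1, h2⟩ := exists_av_approx C.X.invS hp ψ hψ c hc (pow_pos ht 2)
      have h3 := hC.pow_four_le_av (c := fun j => c (.inl j) (.inl j)) (fun j => h1 (.inl j)) ht ht1 hδ
      have h4 : √(4 * t ^ 2) = 2 * t := by
        rw [show 4 * t ^ 2 = (2 * t) ^ 2 by ring, Real.sqrt_sq (by positivity)]
      rw [h4] at h3
      refine h3.trans ?_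
      have h5 : ∀ i j, C.Φ i j * (C.X.m fun ω => av S n r (fun ω => C.q j ω * C.f ω) ω *
          av S n r (fun ω => C.p i ω * C.f ω) ω) ≤
          C.Φ i j * c (.inr (.inr j)) (.inr (.inl i)) + t ^ 2 := by
        intro i j
        have := (abs_le.1 (h2 (.inr (.inr j)) (.inr (.inl i)))).2
        have h6 := mul_le_mul_of_nonneg_left this (hC.nonneg i j)
        have h7 := mul_le_mul_of_nonneg_right (hC.le_one i j) (sq_nonneg t)
        rw [mul_sub] at h6
        have h8 : C.Φ i j * (C.X.m fun ω => av S n r (fun ω => C.q j ω * C.f ω) ω *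
          av S n r (fun ω => C.p i ω * C.f ω) ω) - C.Φ i j * c (.inr (.inr j)) (.inr (.inl i)) ≤
            C.Φ i j * t ^ 2 := h6
        linarith
      have h6 := Finset.sum_le_sum fun i (_ : i ∈ Finset.univ) =>
        Finset.sum_le_sum fun j (_ : j ∈ Finset.univ) => h5 i j
      simp only [Finset.sum_add_distrib, Finset.sum_const, Finset.card_univ, nsmul_eq_mul] at h6
      rw [← mul_assoc] at h6
      linarith
    have hlim : Tendsto (fun t : ℝ => L + K * t ^ 2 + t + K * (2 * (2 * t))) (𝓝[>] 0) (𝓝 L) :=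
      ((by fun_prop : Continuous fun t : ℝ => L + K * t ^ 2 + t + K * (2 * (2 * t))).tendsto' 0 L
        (by simp)).mono_left nhdsWithin_le_nhds
    refine ge_of_tendsto hlim ?_
    filter_upwards [Ioc_mem_nhdsGT (zero_lt_one (α := ℝ))] with t ht
    exact key t ht.1 ht.2
  · simp only [C.mean_h_mul]
    exact tendsto_finsetSum _ fun i _ => tendsto_finsetSum _ fun j _ =>
      (hc (.inr (.inr j)) (.inr (.inl i))).const_mul _

end Cfg

section density

variable {E : Set (ℤ × ℤ)} {L : ℕ} {M₁ N₁ M₂ N₂ : ℤ}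

theorem density_nonneg (h₁ : M₁ ≤ N₁) (h₂ : M₂ ≤ N₂) :
    0 ≤ ((E ∩ Set.Ico M₁ N₁ ×ˢ Set.Ico M₂ N₂).ncard : ℝ) / (((N₁ - M₁) * (N₂ - M₂) : ℤ) : ℝ) := by
  have : 0 ≤ (N₁ - M₁) * (N₂ - M₂) := mul_nonneg (by omega) (by omega)
  have : (0 : ℝ) ≤ (((N₁ - M₁) * (N₂ - M₂) : ℤ) : ℝ) := by exact_mod_cast this
  positivity

theorem density_le_one (h₁ : M₁ ≤ N₁) (h₂ : M₂ ≤ N₂) :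
    ((E ∩ Set.Ico M₁ N₁ ×ˢ Set.Ico M₂ N₂).ncard : ℝ) / (((N₁ - M₁) * (N₂ - M₂) : ℤ) : ℝ) ≤ 1 := by
  have h0 : 0 ≤ (N₁ - M₁) * (N₂ - M₂) := mul_nonneg (by omega) (by omega)
  refine div_le_one_of_le₀ ?_ (by exact_mod_cast h0)
  have h1 : (Set.Ico M₁ N₁ ×ˢ Set.Ico M₂ N₂) = ↑(Finset.Ico M₁ N₁ ×ˢ Finset.Ico M₂ N₂) := by simp
  have h2 : (E ∩ Set.Ico M₁ N₁ ×ˢ Set.Ico M₂ N₂).ncard ≤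
      (Set.Ico M₁ N₁ ×ˢ Set.Ico M₂ N₂).ncard :=
    Set.ncard_le_ncard Set.inter_subset_right (by rw [h1]; exact Finset.finite_toSet _)
  rw [h1, Set.ncard_coe_finset, Finset.card_product, Int.card_Ico, Int.card_Ico] at h2
  have h3 : (((E ∩ Set.Ico M₁ N₁ ×ˢ Set.Ico M₂ N₂).ncard : ℤ)) ≤ (N₁ - M₁) * (N₂ - M₂) := by
    rw [h1]
    refine (Int.ofNat_le.2 h2).trans_eq ?_
    rw [Nat.cast_mul, Int.toNat_of_nonneg (by omega), Int.toNat_of_nonneg (by omega)]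
  exact_mod_cast h3

/-- The density in a rectangle if its sides have length at least `L`, and zero otherwise. -/
noncomputable def rectDensity (E : Set (ℤ × ℤ)) (L : ℕ) (M₁ N₁ M₂ N₂ : ℤ) : ℝ :=
  ⨆ _ : M₁ + L ≤ N₁, ⨆ _ : M₂ + L ≤ N₂,
    ((E ∩ Set.Ico M₁ N₁ ×ˢ Set.Ico M₂ N₂).ncard : ℝ) / (((N₁ - M₁) * (N₂ - M₂) : ℤ) : ℝ)

theorem rectDensity_nonneg : 0 ≤ rectDensity E L M₁ N₁ M₂ N₂ :=
  Real.iSup_nonneg fun h => Real.iSup_nonneg fun h' => density_nonneg (by omega) (by omega)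

theorem rectDensity_le_one : rectDensity E L M₁ N₁ M₂ N₂ ≤ 1 :=
  Real.iSup_le (fun h => Real.iSup_le
    (fun h' => density_le_one (by omega) (by omega)) zero_le_one) zero_le_one

/-- The supremal density in rectangles with sides of length at least `L`. -/
noncomputable def supDensity (E : Set (ℤ × ℤ)) (L : ℕ) : ℝ :=
  ⨆ M₁ : ℤ, ⨆ N₁ : ℤ, ⨆ M₂ : ℤ, ⨆ N₂ : ℤ, rectDensity E L M₁ N₁ M₂ N₂

theorem upperBanachDensity_eq : upperBanachDensity E = ⨅ L, supDensity E L := rfl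

theorem supDensity_nonneg : 0 ≤ supDensity E L :=
  Real.iSup_nonneg fun _ => Real.iSup_nonneg fun _ => Real.iSup_nonneg fun _ =>
    Real.iSup_nonneg fun _ => rectDensity_nonneg

theorem upperBanachDensity_le : upperBanachDensity E ≤ supDensity E L :=
  ciInf_le ⟨0, by rintro _ ⟨L, rfl⟩; exact supDensity_nonneg⟩ L

theorem rectDensity_le_supDensity : rectDensity E L M₁ N₁ M₂ N₂ ≤ supDensity E L := by
  have h1 : ∀ M₁ N₁ M₂, ⨆ N₂, rectDensity E L M₁ N₁ M₂ N₂ ≤ 1 := fun _ _ _ =>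
    Real.iSup_le (fun _ => rectDensity_le_one) zero_le_one
  have h2 : ∀ M₁ N₁, ⨆ M₂, ⨆ N₂, rectDensity E L M₁ N₁ M₂ N₂ ≤ 1 := fun _ _ =>
    Real.iSup_le (fun _ => h1 _ _ _) zero_le_one
  have h3 : ∀ M₁, ⨆ N₁, ⨆ M₂, ⨆ N₂, rectDensity E L M₁ N₁ M₂ N₂ ≤ 1 := fun _ =>
    Real.iSup_le (fun _ => h2 _ _) zero_le_one
  refine le_ciSup_of_le ⟨1, by rintro _ ⟨_, rfl⟩; exact h3 _⟩ M₁ ?_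
  refine le_ciSup_of_le ⟨1, by rintro _ ⟨_, rfl⟩; exact h2 _ _⟩ N₁ ?_
  refine le_ciSup_of_le ⟨1, by rintro _ ⟨_, rfl⟩; exact h1 _ _ _⟩ M₂ ?_
  exact le_ciSup_of_le ⟨1, by rintro _ ⟨_, rfl⟩; exact rectDensity_le_one⟩ N₂ le_rfl

theorem density_le_supDensity (h₁ : M₁ + L ≤ N₁) (h₂ : M₂ + L ≤ N₂) :
    ((E ∩ Set.Ico M₁ N₁ ×ˢ Set.Ico M₂ N₂).ncard : ℝ) / (((N₁ - M₁) * (N₂ - M₂) : ℤ) : ℝ) ≤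
      supDensity E L := by
  refine le_of_eq_of_le ?_ (rectDensity_le_supDensity (M₁ := M₁) (N₁ := N₁) (M₂ := M₂) (N₂ := N₂))
  rw [rectDensity, ciSup_pos h₁, ciSup_pos h₂]

theorem exists_rect {c : ℝ} (hc : 0 ≤ c) (h : c < supDensity E L) :
    ∃ M₁ N₁ M₂ N₂ : ℤ, M₁ + L ≤ N₁ ∧ M₂ + L ≤ N₂ ∧
      c < ((E ∩ Set.Ico M₁ N₁ ×ˢ Set.Ico M₂ N₂).ncard : ℝ) /
        (((N₁ - M₁) * (N₂ - M₂) : ℤ) : ℝ) := by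
  obtain ⟨M₁, h⟩ := exists_lt_of_lt_ciSup h
  obtain ⟨N₁, h⟩ := exists_lt_of_lt_ciSup h
  obtain ⟨M₂, h⟩ := exists_lt_of_lt_ciSup h
  obtain ⟨N₂, h⟩ := exists_lt_of_lt_ciSup h
  refine ⟨M₁, N₁, M₂, N₂, ?_⟩
  by_contra hn
  refine absurd h (not_lt.2 (Real.iSup_le (fun h₁ => Real.iSup_le (fun h₂ => ?_) hc) hc))
  by_contra h'
  exact hn ⟨h₁, h₂, not_le.1 h'⟩

end density

/-- Average over a rectangle with integer sides. -/
noncomputable def rectMean (M₁ M₂ : ℤ) (r₁ r₂ : ℕ) : Mean (ℤ × ℤ) :=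
  (finAvg (fun s => M₁ + s) r₁).prod (finAvg (fun s => M₂ + s) r₂)

open scoped Classical in
theorem rectMean_ind (E : Set (ℤ × ℤ)) (M₁ M₂ : ℤ) (r₁ r₂ : ℕ) :
    rectMean M₁ M₂ r₁ r₂ (fun ω => ind (decide (ω ∈ E))) =
      ((E ∩ Set.Ico M₁ (M₁ + r₁ + 1) ×ˢ Set.Ico M₂ (M₂ + r₂ + 1)).ncard : ℝ) /
        (((M₁ + r₁ + 1 - M₁) * (M₂ + r₂ + 1 - M₂) : ℤ) : ℝ) := by
  have h1 : E ∩ Set.Ico M₁ (M₁ + r₁ + 1) ×ˢ Set.Ico M₂ (M₂ + r₂ + 1) =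
      ↑(((Finset.range (r₁ + 1) ×ˢ Finset.range (r₂ + 1)).filter
        fun x => ((M₁ + x.1, M₂ + x.2) : ℤ × ℤ) ∈ E).image
          fun x : ℕ × ℕ => ((M₁ + x.1, M₂ + x.2) : ℤ × ℤ)) := by
    ext ⟨x, y⟩
    simp only [Set.mem_inter_iff, Set.mem_prod, Set.mem_Ico, Finset.coe_image, Set.mem_image,
      Finset.coe_filter, Finset.mem_product, Finset.mem_range, Set.mem_ofPred_eq, Prod.mk.injEq,
      Prod.exists]
    constructor
    · rintro ⟨h, ⟨h1, h2⟩, h3, h4⟩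
      have e1 : M₁ + ((x - M₁).toNat : ℤ) = x := by omega
      have e2 : M₂ + ((y - M₂).toNat : ℤ) = y := by omega
      exact ⟨(x - M₁).toNat, (y - M₂).toNat, ⟨⟨by omega, by omega⟩, by rwa [e1, e2]⟩, e1, e2⟩
    · rintro ⟨s, t, ⟨⟨h1, h2⟩, h⟩, rfl, rfl⟩
      exact ⟨h, by omega, by omega⟩
  rw [h1, Set.ncard_coe_finset, Finset.card_image_of_injective _ (fun x y h => by
    simp only [Prod.mk.injEq] at h
    exact Prod.ext (by omega) (by omega))]
  rw [rectMean, Mean.prod_apply]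
  simp only [finAvg_apply, ← Finset.sum_div, div_div]
  rw [Finset.card_filter, Finset.sum_product]
  push_cast
  congr 1
  · refine Finset.sum_congr rfl fun s _ => Finset.sum_congr rfl fun t _ => ?_
    simp [ind]
  · ring

theorem abs_finAvg_shift_sub_le (M : ℤ) (r : ℕ) {F : ℤ → ℝ} {C : ℝ} (hF : ∀ n, |F n| ≤ C) :
    |finAvg (fun s => M + s) r (fun n => F (n + 1)) - finAvg (fun s => M + s) r F| ≤
      2 * C / (r + 1) := by
  rw [finAvg_apply, finAvg_apply, ← sub_div, ← Finset.sum_sub_distrib, abs_div,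
    abs_of_pos (by positivity : (0 : ℝ) < r + 1)]
  refine div_le_div_of_nonneg_right ?_ (by positivity)
  have := Finset.sum_range_sub (fun s : ℕ => F (M + s)) (r + 1)
  push_cast at this
  simp only [← add_assoc] at this
  rw [this]
  refine (abs_sub _ _).trans ?_
  have := hF (M + r + 1)
  have := hF (M + (0 : ℕ))
  push_cast at this
  linarith

theorem tendsto_bound (C : ℝ) : Tendsto (fun k : ℕ => 2 * C / ((k : ℝ) + 1))
    (hyperfilter ℕ : Ultrafilter ℕ) (𝓝 0) := by
  have := (tendsto_one_div_add_atTop_nhds_zero_nat (𝕜 := ℝ)).const_mul (2 * C)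
  simp only [mul_one_div, mul_zero] at this
  exact this.mono_left hyperfilter_le

theorem eq_of_abs_sub_le {u v : ℕ → ℝ} {a b C : ℝ}
    (hu : Tendsto u (hyperfilter ℕ : Ultrafilter ℕ) (𝓝 a))
    (hv : Tendsto v (hyperfilter ℕ : Ultrafilter ℕ) (𝓝 b))
    (h : ∀ k, |u k - v k| ≤ 2 * C / ((k : ℝ) + 1)) : a = b :=
  sub_eq_zero.1 (tendsto_nhds_unique (hu.sub hv) (squeeze_zero_norm h (tendsto_bound C)))

theorem exists_shiftInv_of_not_syndetic {D : Set ℤ} (hD : ¬ Syndetic D) :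
    ∃ l : Mean ℤ, ShiftInv l ∧ ∀ F, Bdd F → (∀ n ∉ D, F n ≤ 0) → l F ≤ 0 := by
  have : ∀ k : ℕ, ∃ M : ℤ, ∀ n ∈ D, M ≤ n → M + k + 1 ≤ n := by
    intro k
    by_contra! h
    refine hD ⟨k + 1, by positivity, fun M => ?_⟩
    obtain ⟨n, hn, h1, h2⟩ := h M
    exact ⟨n, hn, h1, by omega⟩
  choose M hM using this
  obtain ⟨l, hl⟩ := Mean.exists_ultralimit (hyperfilter ℕ) fun k => finAvg (fun s => M k + s) k
  refine ⟨l, fun F hF => ?_, fun F hF h => ?_⟩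
  · obtain ⟨C, hC⟩ := id hF
    exact eq_of_abs_sub_le (hl _ (hF.comp fun n => n + 1)) (hl F hF)
      fun k => abs_finAvg_shift_sub_le (M k) k hC
  · refine le_of_tendsto (hl F hF) (Eventually.of_forall fun k => ?_)
    rw [finAvg_apply]
    refine div_nonpos_of_nonpos_of_nonneg (Finset.sum_nonpos fun s hs => h _ fun hmem => ?_)
      (by positivity)
    have := hM k _ hmem (by omega)
    rw [Finset.mem_range] at hs
    omega

theorem addRight_zpow_apply {G : Type*} [AddCommGroup G] (g x : G) (n : ℤ) :
    ((Equiv.addRight g : Equiv.Perm G) ^ n) x = x + n • g := by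
  induction n using Int.induction_on generalizing x with
  | zero => simp
  | succ k ih =>
    rw [zpow_add_one, Equiv.Perm.mul_apply, ih, Equiv.coe_addRight, add_smul, one_smul]
    rw [add_assoc, add_comm g]
  | pred k ih =>
    rw [zpow_sub_one, Equiv.Perm.mul_apply, ih, sub_smul, one_smul, Equiv.Perm.inv_def,
      Equiv.addRight_symm, Equiv.coe_addRight]
    rw [add_assoc, add_comm (-g), sub_eq_add_neg]

open scoped Classical in
theorem mean_ind_le_upperBanachDensity {m : Mean (ℤ × ℤ)} (h₁ : m.Inv (Equiv.addRight (-1, 0)))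
    (h₂ : m.Inv (Equiv.addRight (0, -1))) (A : Set (ℤ × ℤ)) :
    m (fun ω => ind (decide (ω ∈ A))) ≤ upperBanachDensity A := by
  rw [upperBanachDensity_eq]
  refine le_ciInf fun L => ?_
  set F : ℤ × ℤ → ℝ := fun ω => ind (decide (ω ∈ A))
  have hF : Bdd F := ⟨1, fun _ => ind_abs _⟩
  have hinv : ∀ x y : ℤ, m (fun ω => F (ω.1 + x, ω.2 + y)) = m F := by
    intro x y
    rw [← h₁.zpow (-x) F hF, ←
      h₂.zpow (-y) (fun ω => F (((Equiv.addRight (-1, 0) : Equiv.Perm (ℤ × ℤ)) ^ (-x)) ω))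
        (hF.comp _)]
    congr 1
    ext ω
    rw [addRight_zpow_apply, addRight_zpow_apply]
    congr 1
    ext <;> simp
  have h1 : m (fun ω => rectMean ω.1 ω.2 L L F) = m F := by
    have e1 : (fun ω : ℤ × ℤ => rectMean ω.1 ω.2 L L F) = fun ω =>
        finAvg (fun s => s) L fun x => finAvg (fun s => s) L fun y => F (ω.1 + x, ω.2 + y) := by
      ext ω
      simp only [rectMean, Mean.prod_apply, finAvg_apply]
    rw [e1, mean_finAvg m _ L fun x ω => finAvg (fun s => s) L fun y => F (ω.1 + x, ω.2 + y)]
    simp only [mean_finAvg m _ L fun y (ω : ℤ × ℤ) => F (ω.1 + _, ω.2 + y), hinv, Mean.const]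
  rw [← h1]
  refine m.le_of_le (Mean.bdd_mean _ ⟨1, fun _ _ => ind_abs _⟩) fun ω => ?_
  rw [rectMean_ind]
  exact density_le_supDensity (by omega) (by omega)

open scoped Classical in
theorem exists_invariant_mean {E : Set (ℤ × ℤ)} (hE : 0 < upperBanachDensity E) :
    ∃ m : Mean (ℤ × ℤ), m.Inv (Equiv.addRight (-1, 0)) ∧ m.Inv (Equiv.addRight (0, -1)) ∧
      upperBanachDensity E ≤ m fun ω => ind (decide (ω ∈ E)) := by
  set δ := upperBanachDensity E with hδ
  have h1 : ∀ k : ℕ, ∃ (M₁ M₂ : ℤ) (r₁ r₂ : ℕ), k ≤ r₁ ∧ k ≤ r₂ ∧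
      δ - δ * (1 / ((k : ℝ) + 1)) ≤ rectMean M₁ M₂ r₁ r₂ fun ω => ind (decide (ω ∈ E)) := by
    intro k
    have hk : (0 : ℝ) < 1 / ((k : ℝ) + 1) := by positivity
    have hk1 : 1 / ((k : ℝ) + 1) ≤ 1 := by
      rw [div_le_one (by positivity)]; linarith [(Nat.cast_nonneg k : (0 : ℝ) ≤ k)]
    obtain ⟨M₁, N₁, M₂, N₂, h1, h2, h⟩ := exists_rect (E := E) (L := k + 1)
      (c := δ - δ * (1 / ((k : ℝ) + 1))) (by nlinarith)
      (lt_of_lt_of_le (by have := mul_pos hE hk; linarith) upperBanachDensity_le)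
    push_cast at h1 h2
    refine ⟨M₁, M₂, (N₁ - M₁ - 1).toNat, (N₂ - M₂ - 1).toNat, by omega, by omega, ?_⟩
    rw [rectMean_ind]
    have e1 : M₁ + ((N₁ - M₁ - 1).toNat : ℤ) + 1 = N₁ := by omega
    have e2 : M₂ + ((N₂ - M₂ - 1).toNat : ℤ) + 1 = N₂ := by omega
    rw [e1, e2]
    exact h.le
  choose M₁ M₂ r₁ r₂ hr₁ hr₂ h using h1
  obtain ⟨m, hm⟩ := Mean.exists_ultralimit (hyperfilter ℕ)
    fun k => rectMean (M₁ k) (M₂ k) (r₁ k) (r₂ k)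
  have hbound : ∀ {C : ℝ} {k r : ℕ}, 0 ≤ C → k ≤ r → 2 * C / ((r : ℝ) + 1) ≤ 2 * C / (k + 1) :=
    fun hC hkr => div_le_div_of_nonneg_left (by positivity) (by positivity) (by gcongr)
  have hinv : ∀ T : Equiv.Perm (ℤ × ℤ), (∀ F : ℤ × ℤ → ℝ, ∀ C, 0 ≤ C → (∀ ω, |F ω| ≤ C) → ∀ k,
      |rectMean (M₁ k) (M₂ k) (r₁ k) (r₂ k) (fun ω => F (T ω)) -
        rectMean (M₁ k) (M₂ k) (r₁ k) (r₂ k) F| ≤ 2 * C / (k + 1)) → m.Inv T := by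
    intro T hT F hF
    obtain ⟨C, hC0, hC⟩ := hF.nonneg_bound
    exact eq_of_abs_sub_le (hm _ (hF.comp T)) (hm F hF) (hT F C hC0 hC)
  have i1 : m.Inv (Equiv.addRight (1, 0)) := hinv _ fun F C hC0 hC k => by
    refine le_trans ?_ (hbound hC0 (hr₁ k))
    have e : ∀ ω : ℤ × ℤ, Equiv.addRight ((1, 0) : ℤ × ℤ) ω = (ω.1 + 1, ω.2) := fun ω => by
      ext <;> simp
    simp only [e]
    exact abs_finAvg_shift_sub_le (M₁ k) (r₁ k)
      (F := fun x => finAvg (fun s => M₂ k + s) (r₂ k) fun y => F (x, y))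
      fun x => Mean.abs_le_of_le _ fun y => hC _
  have i2 : m.Inv (Equiv.addRight (0, 1)) := hinv _ fun F C hC0 hC k => by
    refine le_trans ?_ (hbound hC0 (hr₂ k))
    have e : ∀ ω : ℤ × ℤ, Equiv.addRight ((0, 1) : ℤ × ℤ) ω = (ω.1, ω.2 + 1) := fun ω => by
      ext <;> simp
    simp only [rectMean, Mean.prod_apply, e]
    rw [← Mean.sub]
    refine Mean.abs_le_of_le _ fun x => ?_
    exact abs_finAvg_shift_sub_le (M₂ k) (r₂ k) (F := fun y => F (x, y)) fun y => hC _
  refine ⟨m, ?_, ?_, ?_⟩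
  · exact i1.symm
  · exact i2.symm
  · have h1 := hm (fun ω => ind (decide (ω ∈ E))) ⟨1, fun _ => ind_abs _⟩
    have h2 : Tendsto (fun k : ℕ => δ - δ * (1 / ((k : ℝ) + 1)))
        (hyperfilter ℕ : Ultrafilter ℕ) (𝓝 (δ - δ * 0)) :=
      (((tendsto_one_div_add_atTop_nhds_zero_nat (𝕜 := ℝ)).mono_left
        hyperfilter_le).const_mul δ).const_sub δ
    rw [mul_zero, sub_zero] at h2
    exact le_of_tendsto_of_tendsto' h2 h1 h

open scoped Classical in
theorem exists_cfg {E : Set (ℤ × ℤ)} (hE : 0 < upperBanachDensity E) :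
    ∃ C : Cfg, upperBanachDensity E ≤ C.X.m C.f ∧ ∀ n : ℤ,
      C.X.m (fun ω => C.f ω * C.f ((C.X.T₁ ^ n) ω) * C.f ((C.X.T₂ ^ n) ω)) ≤
        upperBanachDensity
          (E ∩ ((· + ((n : ℤ), (0 : ℤ))) '' E) ∩ ((· + ((0 : ℤ), (n : ℤ))) '' E)) := by
  obtain ⟨m', h1, h2, hm'⟩ := exists_invariant_mean hE
  let X : Sys := ⟨ℤ × ℤ, Equiv.addRight (-1, 0), Equiv.addRight (0, -1), by
    ext ω <;> simp, m', h1, h2⟩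
  obtain ⟨m, h₁, h₂, herg, hm⟩ := X.exists_erg_point (F₀ := fun ω => ind (decide (ω ∈ E)))
    ⟨1, fun _ => ind_abs _⟩
  refine ⟨⟨X.withMean m h₁ h₂, herg, fun ω => decide (ω ∈ E), Unit, Unit, inferInstance,
    inferInstance, fun _ => (), fun _ => (), fun _ => rfl, fun _ => rfl, fun _ _ => 0⟩,
    hm'.trans hm, fun n => ?_⟩
  refine le_of_eq_of_le ?_ (mean_ind_le_upperBanachDensity h₁ h₂ _)
  congr 1
  funext ω
  obtain ⟨x, y⟩ : ℤ × ℤ := ω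
  change ind (decide ((x, y) ∈ E)) *
    ind (decide (((Equiv.addRight ((-1, 0) : ℤ × ℤ) : Equiv.Perm (ℤ × ℤ)) ^ n) (x, y) ∈ E)) *
    ind (decide (((Equiv.addRight ((0, -1) : ℤ × ℤ) : Equiv.Perm (ℤ × ℤ)) ^ n) (x, y) ∈ E)) = _
  rw [addRight_zpow_apply, addRight_zpow_apply]
  have e1 : ((x, y) ∈ (· + ((n : ℤ), (0 : ℤ))) '' E) ↔ (x, y) + n • (-1, 0) ∈ E := by
    constructor
    · rintro ⟨z, hz, h⟩
      convert hz using 1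
      rw [← h]
      ext <;> simp
    · exact fun h => ⟨_, h, by ext <;> simp⟩
  have e2 : ((x, y) ∈ (· + ((0 : ℤ), (n : ℤ))) '' E) ↔ (x, y) + n • (0, -1) ∈ E := by
    constructor
    · rintro ⟨z, hz, h⟩
      convert hz using 1
      rw [← h]
      ext <;> simp
    · exact fun h => ⟨_, h, by ext <;> simp⟩
  simp only [Set.mem_inter_iff, e1, e2]
  by_cases a1 : (x, y) ∈ E <;> by_cases a2 : (x, y) + n • (-1, 0) ∈ E <;>
    by_cases a3 : (x, y) + n • (0, -1) ∈ E <;> simp only [a1, a2, a3, ind] <;> simp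

theorem Factor.zpow₁ {X' X : Sys} {π : X'.Ω → X.Ω} (h : Factor X' X π) (n : ℤ) (ω : X'.Ω) :
    π ((X'.T₁ ^ n) ω) = (X.T₁ ^ n) (π ω) := by
  induction n using Int.induction_on generalizing ω with
  | zero => simp
  | succ k ih => rw [zpow_add_one, Equiv.Perm.mul_apply, ih, h.map₁, zpow_add_one,
      Equiv.Perm.mul_apply]
  | pred k ih =>
    rw [zpow_sub_one, Equiv.Perm.mul_apply, ih, zpow_sub_one, Equiv.Perm.mul_apply]
    congr 1
    rw [Equiv.Perm.eq_inv_iff_eq, ← h.map₁, ← Equiv.Perm.mul_apply, mul_inv_cancel, Equiv.Perm.one_apply]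

theorem Factor.zpow₂ {X' X : Sys} {π : X'.Ω → X.Ω} (h : Factor X' X π) (n : ℤ) (ω : X'.Ω) :
    π ((X'.T₂ ^ n) ω) = (X.T₂ ^ n) (π ω) := by
  induction n using Int.induction_on generalizing ω with
  | zero => simp
  | succ k ih => rw [zpow_add_one, Equiv.Perm.mul_apply, ih, h.map₂, zpow_add_one,
      Equiv.Perm.mul_apply]
  | pred k ih =>
    rw [zpow_sub_one, Equiv.Perm.mul_apply, ih, zpow_sub_one, Equiv.Perm.mul_apply]
    congr 1
    rw [Equiv.Perm.eq_inv_iff_eq, ← h.map₂, ← Equiv.Perm.mul_apply, mul_inv_cancel, Equiv.Perm.one_apply]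

namespace Cfg

variable {C C' : Cfg}

/-- Correlation of a function with the translates of the indicator along a corner. -/
def corr (C : Cfg) (g : C.X.Ω → ℝ) (n : ℤ) : ℝ :=
  C.X.m fun ω => g ω * C.f ((C.X.T₁ ^ n) ω) * C.f ((C.X.T₂ ^ n) ω)

theorem f_abs (C : Cfg) (ω) : |C.f ω| ≤ 1 := ind_abs _

theorem corr_add (g g' : C.X.Ω → ℝ) (n : ℤ) :
    C.corr (fun ω => g ω + g' ω) n = C.corr g n + C.corr g' n := by
  rw [corr, corr, corr, ← Mean.add]
  congr 1
  ext ω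
  ring

theorem abs_corr_le {g : C.X.Ω → ℝ} {c : ℝ} (hg : ∀ ω, |g ω| ≤ c) (n : ℤ) : |C.corr g n| ≤ c := by
  refine C.X.m.abs_le_of_le fun ω => ?_
  simpa using mul_abs_le (mul_abs_le (hg ω) (C.f_abs ((C.X.T₁ ^ n) ω))) (C.f_abs ((C.X.T₂ ^ n) ω))

theorem abs_corr_le_sqrt {g : C.X.Ω → ℝ} (hg : Bdd g) (n : ℤ) :
    |C.corr g n| ≤ √(C.X.m fun ω => g ω ^ 2) := by
  have hb : Bdd fun ω => g ω * C.f ((C.X.T₁ ^ n) ω) * C.f ((C.X.T₂ ^ n) ω) :=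
    (hg.mul (C.f_bdd.comp _)).mul (C.f_bdd.comp _)
  refine (C.X.m.abs_le_sqrt hb).trans (Real.sqrt_le_sqrt ?_)
  refine C.X.m.mono (hb.pow 2) (hg.pow 2) fun ω => sq_le_sq.2 ?_
  simpa using
    mul_abs_le (mul_abs_le (le_refl |g ω|) (C.f_abs ((C.X.T₁ ^ n) ω))) (C.f_abs ((C.X.T₂ ^ n) ω))

theorem Over.corr {π : C'.X.Ω → C.X.Ω} (h : Over C' C π) {g : C.X.Ω → ℝ} (hg : Bdd g) (n : ℤ) :
    C'.corr (fun ω => g (π ω)) n = C.corr g n := by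
  rw [Cfg.corr, Cfg.corr, ← h.factor.map_mean _ ((hg.mul (C.f_bdd.comp _)).mul (C.f_bdd.comp _))]
  simp only [h.f_eq, h.factor.zpow₁, h.factor.zpow₂]

theorem corr_h_mem : C.corr C.h ∈ corrAlg := by
  have : C.corr C.h = ∑ i, ∑ j, C.Φ i j • fun n : ℤ => C.X.m fun ω => (C.q j ω * C.f ω) *
      (C.p i (((C.X.T₂ * C.X.T₁⁻¹) ^ n) ω) * C.f (((C.X.T₂ * C.X.T₁⁻¹) ^ n) ω)) := by
    ext n
    rw [corr, C.mean_h_mul n]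
    simp
  rw [this]
  refine Subalgebra.sum_mem _ fun i _ => Subalgebra.sum_mem _ fun j _ =>
    Subalgebra.smul_mem _ (Algebra.subset_adjoin ?_) _
  exact ⟨_, C.X.T₂ * C.X.T₁⁻¹, C.X.m, fun ω => C.q j ω * C.f ω, fun ω => C.p i ω * C.f ω,
    C.X.invS, fun ω => by simpa using mul_abs_le (C.q_abs j ω) (C.f_abs ω),
    fun ω => by simpa using mul_abs_le (C.p_abs i ω) (C.f_abs ω), rfl⟩

theorem IsCondExp.h_nonneg (hC : C.IsCondExp) (ω) : 0 ≤ C.h ω := hC.nonneg _ _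

theorem IsCondExp.h_le_one (hC : C.IsCondExp) (ω) : C.h ω ≤ 1 := hC.le_one _ _

end Cfg

theorem mean_posPart_le_zero {l : Mean ℤ} {a a₁ : ℤ → ℝ} {θ κ : ℝ} (hκ : 0 < κ)
    (ha₁ : ∀ n, |a₁ n| ≤ 1)
    (hdecomp : ∀ P : Polynomial ℝ, ∀ s : ℝ, 0 < s → ∃ b e : ℤ → ℝ, (∀ n, a n = a₁ n + b n + e n) ∧
      (∀ n, |b n| ≤ 1) ∧ (∀ n, |e n| ≤ κ) ∧ |l fun n => P.eval (a₁ n) * b n| ≤ s)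
    (hl : ∀ F : ℤ → ℝ, Bdd F → (∀ n, a n ≤ θ - 3 * κ → F n ≤ 0) → l F ≤ 0) :
    l (fun n => max 0 (a₁ n - θ)) ≤ 0 := by
  by_contra! hpos
  set ρ : ℝ → ℝ := fun t => max 0 (t - θ) with hρ
  change 0 < l (fun n => ρ (a₁ n)) at hpos
  set lam := l (fun n => ρ (a₁ n))
  have hρc : Continuous ρ := by fun_prop
  have hρ0 : ∀ t, 0 ≤ ρ t := fun t => le_max_left _ _
  obtain ⟨P, hP⟩ := exists_polynomial_near_of_continuousOn (-1) 1 ρ hρc.continuousOn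
    (κ * lam / 2) (by positivity)
  obtain ⟨b, e, hab, hb, he, hPb⟩ := hdecomp P (κ * lam / 2) (by positivity)
  have hmem : ∀ n, a₁ n ∈ Set.Icc (-1 : ℝ) 1 := fun n => abs_le.1 (ha₁ n)
  have hcb : ∀ g : ℝ → ℝ, Continuous g → Bdd fun n => g (a₁ n) := fun g hg => by
    obtain ⟨K, hK⟩ := isCompact_Icc.exists_bound_of_continuousOn
      (s := Set.Icc (-1 : ℝ) 1) hg.continuousOn
    exact ⟨K, fun n => hK _ (hmem n)⟩
  have hρb := hcb ρ hρc
  have hbb : Bdd b := ⟨1, hb⟩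
  have heb : Bdd e := ⟨κ, he⟩
  have hFb : Bdd fun n => ρ (a₁ n) * ((b n + e n) + 3 * κ) :=
    hρb.mul ((hbb.add heb).add (Bdd.const _))
  have hF := hl _ hFb fun n hn => by
    rcases le_total (a₁ n) θ with h | h
    · simp [hρ, sub_nonpos.2 h]
    · exact mul_nonpos_of_nonneg_of_nonpos (hρ0 _) (by linarith [hab n])
  have hPbb : Bdd fun n => P.eval (a₁ n) * b n := (hcb _ P.continuous).mul hbb
  have hlow : l (fun n => (P.eval (a₁ n) * b n + -(κ * lam / 2)) + 2 * κ * ρ (a₁ n)) ≤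
      l fun n => ρ (a₁ n) * ((b n + e n) + 3 * κ) := by
    refine l.mono ((hPbb.add (Bdd.const _)).add ((Bdd.const _).mul hρb)) hFb fun n => ?_
    have h1 := abs_le.1 (mul_abs_le (hP _ (hmem n)).le (hb n))
    have h2 := mul_le_mul_of_nonneg_left (abs_le.1 (he n)).1 (hρ0 (a₁ n))
    nlinarith [h1.2]
  rw [l.add, l.add, Mean.const, l.smul] at hlow
  have h3 := (abs_le.1 hPb).1
  have : 0 < κ * lam := by positivity
  change _ + 2 * κ * lam ≤ _ at hlow
  nlinarith

end BanachCorner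


open BanachCorner

theorem banach_density_recurrence
    (E : Set (ℤ × ℤ)) (hE : 0 < upperBanachDensity E) (ε : ℝ) (hε : 0 < ε) :
    Syndetic {n : ℤ |
      upperBanachDensity
          (E ∩ ((· + ((n : ℤ), (0 : ℤ))) '' E) ∩ ((· + ((0 : ℤ), (n : ℤ))) '' E)) >
        upperBanachDensity E ^ 4 - ε} := by
  by_contra hD
  obtain ⟨l, hl, hlD⟩ := exists_shiftInv_of_not_syndetic hD
  obtain ⟨p, hp, hpl⟩ := exists_diffRich hl
  obtain ⟨C, hδ, hC⟩ := exists_cfg hE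
  obtain ⟨C₁, π₁, o₁, hC₁, H⟩ := C.exists_structured_approx (ε := (ε / 4) ^ 2 / 6) (by positivity)
  set δ := upperBanachDensity E
  have hδ₁ : δ ≤ C₁.X.m C₁.f := by
    rw [show C₁.f = fun ω => C.f (π₁ ω) from funext o₁.f_eq, o₁.factor.map_mean _ C.f_bdd]
    exact hδ
  have ha₁ : ∀ n, |C₁.corr C₁.h n| ≤ 1 := Cfg.abs_corr_le fun ω => by
    rw [abs_of_nonneg (hC₁.h_nonneg ω)]; exact hC₁.h_le_one ω
  have hle : l (fun n => max 0 (C₁.corr C₁.h n - (δ ^ 4 - ε / 4))) ≤ 0 := by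
    refine mean_posPart_le_zero (a := C.corr C.f) (κ := ε / 4) (by positivity) ha₁ ?_ ?_
    · intro P s hs
      have hPm : (fun n => P.eval (C₁.corr C₁.h n)) ∈ corrAlg := by
        have h1 : (fun n => P.eval (C₁.corr C₁.h n)) = Polynomial.aeval (C₁.corr C₁.h) P := by
          ext n
          simp [Polynomial.aeval_fn_apply, Polynomial.coe_aeval_eq_eval]
        rw [h1]
        exact Algebra.adjoin_le (Set.singleton_subset_iff.2 Cfg.corr_h_mem)
          (Polynomial.aeval_mem_adjoin_singleton ℝ _)
      obtain ⟨K, hK, hbound⟩ := corrAlg_bound hl hPm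
      obtain ⟨C₂, π₂, o₂, hC₂, hbox, hdiff⟩ := H ((s / (K + 1)) ^ 4) (by positivity)
      have hfh : ∀ ω, |C₂.f ω - C₂.h ω| ≤ 1 := fun ω => by
        rw [abs_le]
        have := ind_nonneg (C₂.e ω)
        have := ind_le_one (C₂.e ω)
        constructor <;> rw [Cfg.f] <;> linarith [hC₂.h_nonneg ω, hC₂.h_le_one ω]
      refine ⟨C₂.corr fun ω => C₂.f ω - C₂.h ω, C₂.corr fun ω => C₂.h ω - C₁.h (π₂ ω), ?_,
        Cfg.abs_corr_le hfh, ?_, ?_⟩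
      · intro n
        rw [← (o₂.comp o₁).corr C.f_bdd, ← o₂.corr C₁.h_bdd, ← Cfg.corr_add, ← Cfg.corr_add]
        congr 1
        ext ω
        rw [← (o₂.comp o₁).f_eq]
        ring
      · intro n
        refine (Cfg.abs_corr_le_sqrt (C₂.h_bdd.sub (C₁.h_bdd.comp _)) n).trans ?_
        refine Real.sqrt_le_iff.2 ⟨by positivity, ?_⟩
        refine le_trans (le_of_eq ?_) (hdiff.trans (le_of_eq (by ring)))
        congr 1
        ext ω
        ring
      · refine (hbound C₂.X _ C₂.f C₂.f ⟨1, hfh⟩ C₂.f_abs C₂.f_abs).trans ?_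
        have h1 : √√(C₂.X.box fun ω => C₂.f ω - C₂.h ω) ≤ s / (K + 1) := by
          rw [Real.sqrt_le_left (by positivity), Real.sqrt_le_left (by positivity), ← pow_mul]
          exact hbox.le
        calc _ ≤ K * (s / (K + 1)) := mul_le_mul_of_nonneg_left h1 hK
          _ ≤ s := by
            rw [← mul_div_assoc, div_le_iff₀ (by positivity)]
            nlinarith
    · intro F hF h
      refine hlD F hF fun n hn => h n ?_
      have h1 := hC n
      have h2 : _ ≤ δ ^ 4 - ε := not_lt.1 hn
      change C.corr C.f n ≤ _ at h1
      linarith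
  obtain ⟨L, hL, hlim⟩ := hC₁.pow_four_le_lim (hE.trans_le hδ₁) hp
  have hδ4 : δ ^ 4 ≤ L := (pow_le_pow_left₀ hE.le hδ₁ 4).trans hL
  set Q : Set ℤ := {n | δ ^ 4 - ε / 8 < C₁.corr C₁.h n} with hQ
  have hQp : Q ∈ p := hlim.eventually (lt_mem_nhds (by linarith : δ ^ 4 - ε / 8 < L))
  have hQb : Bdd (Q.indicator (1 : ℤ → ℝ)) := ⟨1, fun n => by
    by_cases hn : n ∈ Q <;> simp [hn]⟩
  have hQ0 : l (Q.indicator 1) = 0 := by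
    refine le_antisymm ?_ (l.nonneg hQb fun n => Set.indicator_nonneg (fun _ _ => zero_le_one) _)
    have h1 : l (fun n => ε / 8 * Q.indicator 1 n) ≤
        l (fun n => max 0 (C₁.corr C₁.h n - (δ ^ 4 - ε / 4))) := by
      refine l.mono ((Bdd.const _).mul hQb) ?_ fun n => ?_
      · obtain ⟨K, hK⟩ := Bdd.sub (F := C₁.corr C₁.h) ⟨1, ha₁⟩ (Bdd.const (δ ^ 4 - ε / 4))
        refine ⟨K, fun n => ?_⟩
        rw [abs_of_nonneg (le_max_left _ _)]
        exact max_le ((abs_nonneg _).trans (hK n)) ((le_abs_self _).trans (hK n))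
      · by_cases hn : n ∈ Q
        · have : δ ^ 4 - ε / 8 < C₁.corr C₁.h n := hn
          simp only [Set.indicator_of_mem hn, Pi.one_apply]
          exact le_max_of_le_right (by linarith)
        · simp [hn]
    rw [l.smul] at h1
    nlinarith
  exact (Ultrafilter.compl_mem_iff_notMem.1 (hpl Q hQ0)) hQp
end

section
/- Let (X, μ, T₁, T₂) be a system, let f₀, f₁, f₂ be measurable functions with |fᵢ| ≤ 1 for i = 0,1,2, and let t ∈ ℝ. Suppose the box average of f₀ with respect to (T₁, T₂) equals L ≥ 0. Then for every sequence of intervals [Mᵢ, Nᵢ) ⊆ ℤ with Nᵢ − Mᵢ → ∞, limsup_{i→∞} | (1/(Nᵢ−Mᵢ)) Σ_{n ∈ [Mᵢ,Nᵢ)} e^{2πi n t} ∫ f₀ · (f₁∘T₁ⁿ) · (f₂∘T₂ⁿ) dμ | ≤ L^{1/4}. -/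
open MeasureTheory Filter

/-- The box average of `f` with respect to `(T₁, T₂)` equals `L`: for every
`n₂` the inner Cesàro limit `c n₂` exists, and the Cesàro averages of `c`
converge to `L`.  (`L^{1/4}` is then the Host box seminorm `⟦f⟧_{T₁,T₂}`.) -/
def HasBoxAvg {X : Type*} [MeasurableSpace X] (μ : Measure X)
    (T₁ T₂ : X → X) (f : X → ℝ) (L : ℝ) : Prop :=
  ∃ c : ℕ → ℝ,
    (∀ n₂ : ℕ, Tendsto (fun N₁ : ℕ =>
        (∑ n₁ ∈ Finset.range N₁,
          ∫ x, f x * f (T₁^[n₁] x) * f (T₂^[n₂] x) * f (T₁^[n₁] (T₂^[n₂] x)) ∂μ)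
          / (N₁ : ℝ))
      atTop (nhds (c n₂))) ∧
    Tendsto (fun N₂ : ℕ => (∑ n₂ ∈ Finset.range N₂, c n₂) / (N₂ : ℝ))
      atTop (nhds L)

section BoxSeminorm

open Finset Topology

/-- If the Cesàro averages of `a` converge, so do the averages of `a |i - j|` over squares. -/
lemma tendsto_sum_natAbs_sub_div_sq {a : ℕ → ℝ} {l : ℝ}
    (h : Tendsto (fun N : ℕ => (∑ k ∈ range N, a k) / (N : ℝ)) atTop (𝓝 l)) :
    Tendsto (fun N : ℕ => (∑ i ∈ range N, ∑ j ∈ range N, a ((i : ℤ) - j).natAbs) / (N : ℝ) ^ 2)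
      atTop (𝓝 l) := by
  have hD : ∀ N : ℕ, ∑ i ∈ range N, ∑ j ∈ range N, a ((i : ℤ) - j).natAbs =
      ∑ j ∈ range N, (2 * (∑ k ∈ range (j + 1), a k) - a 0) := by
    intro N
    induction N with
    | zero => simp
    | succ N ih =>
      have h1 : ∑ j ∈ range N, a ((N : ℤ) - j).natAbs = ∑ k ∈ range N, a (k + 1) := by
        rw [← sum_range_reflect]
        refine sum_congr rfl fun j hj => ?_
        have := mem_range.1 hj
        congr 1
        omega
      have h2 : ∑ i ∈ range N, a ((i : ℤ) - N).natAbs = ∑ k ∈ range N, a (k + 1) := by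
        rw [← h1]
        refine sum_congr rfl fun j _ => ?_
        congr 1
        omega
      rw [sum_range_succ, sum_range_succ (fun j => 2 * (∑ k ∈ range (j + 1), a k) - a 0), ← ih]
      simp only [sum_range_succ _ N, sum_add_distrib]
      rw [h1, h2, ← sum_range_succ, sum_range_succ']
      simp
      ring
  have hg : ∀ N : ℕ, ∑ j ∈ range N, (2 * (j : ℝ) + 1) = (N : ℝ) ^ 2 := by
    intro N
    induction N with
    | zero => simp
    | succ N ih => rw [sum_range_succ, ih]; push_cast; ring
  have ho : (fun j : ℕ => 2 * (∑ k ∈ range (j + 1), a k) - a 0 - (2 * (j : ℝ) + 1) * l)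
      =o[atTop] fun j : ℕ => 2 * (j : ℝ) + 1 := by
    rw [Asymptotics.isLittleO_iff_tendsto (fun j hj => by
      have : (0 : ℝ) ≤ j := j.cast_nonneg
      linarith)]
    have h1 := ((tendsto_add_atTop_iff_nat 1).2 h).sub_const l
    rw [sub_self] at h1
    have h2 : Tendsto (fun j : ℕ => 1 / (2 * (j : ℝ) + 1)) atTop (𝓝 0) := by
      refine tendsto_const_nhds.div_atTop ?_
      exact tendsto_atTop_add_const_right _ _
        (tendsto_natCast_atTop_atTop.const_mul_atTop (by norm_num))
    have h3 := (h1.mul (h2.const_add 1)).add (h2.const_mul (l - a 0))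
    simp only [zero_mul, mul_zero, add_zero] at h3
    refine h3.congr fun j => ?_
    have : (2 * (j : ℝ) + 1) ≠ 0 := by positivity
    have : ((j : ℝ) + 1) ≠ 0 := by positivity
    push_cast
    field_simp
    ring
  have hs := ho.sum_range (fun j => by positivity) (by
    simp only [hg]
    exact (tendsto_pow_atTop two_ne_zero).comp tendsto_natCast_atTop_atTop)
  simp only [hg] at hs
  have h4 := (hs.tendsto_div_nhds_zero).add_const l
  rw [zero_add] at h4
  refine h4.congr' ?_
  filter_upwards [eventually_gt_atTop 0] with N hN
  have : (N : ℝ) ≠ 0 := by positivity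
  rw [hD, sum_sub_distrib, ← sum_mul, hg]
  field_simp
  ring

lemma norm_sum_range_sub_shift_le {z : ℕ → ℂ} (hz : ∀ n, ‖z n‖ ≤ 1) (K h : ℕ) :
    ‖∑ n ∈ range K, z n - ∑ n ∈ range K, z (n + h)‖ ≤ 2 * h := by
  have h1 : ∑ n ∈ range K, z n - ∑ n ∈ range K, z (n + h)
      = ∑ n ∈ range h, z n - ∑ n ∈ range h, z (K + n) := by
    have h2 := sum_range_add z K h
    have h3 := sum_range_add z h K
    rw [add_comm K h, h3] at h2
    simp only [add_comm _ h]
    linear_combination -h2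
  have hb : ∀ y : ℕ → ℂ, (∀ n, ‖y n‖ ≤ 1) → ‖∑ n ∈ range h, y n‖ ≤ h := fun y hy =>
    (norm_sum_le_of_le _ fun n _ => hy n).trans (by simp)
  rw [h1]
  have h4 := norm_sub_le (∑ n ∈ range h, z n) (∑ n ∈ range h, z (K + n))
  linarith [hb z hz, hb (fun n => z (K + n)) fun n => hz _]

lemma norm_sum_range_le_add_norm_sum_window {z : ℕ → ℂ} (hz : ∀ n, ‖z n‖ ≤ 1) (K : ℕ) {H : ℕ}
    (hH : 0 < H) :
    ‖∑ n ∈ range K, z n‖ ≤ 2 * H + ‖∑ n ∈ range K, ∑ h ∈ range H, z (n + h)‖ / H := by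
  have hH' : (0 : ℝ) < H := by exact_mod_cast hH
  have h1 : (H : ℂ) * ∑ n ∈ range K, z n
      = ∑ h ∈ range H, (∑ n ∈ range K, z n - ∑ n ∈ range K, z (n + h))
        + ∑ n ∈ range K, ∑ h ∈ range H, z (n + h) := by
    rw [sum_sub_distrib, sum_comm (s := range K)]
    simp
  have h2 : ‖∑ h ∈ range H, (∑ n ∈ range K, z n - ∑ n ∈ range K, z (n + h))‖ ≤ H * (2 * H) := by
    refine (norm_sum_le_of_le (n := fun _ => (2 * H : ℝ)) _ fun h hh => ?_).trans (by simp)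
    refine (norm_sum_range_sub_shift_le hz K h).trans ?_
    have : (h : ℝ) ≤ H := by exact_mod_cast (mem_range.1 hh).le
    linarith
  have h3 := congrArg norm h1
  rw [norm_mul, Complex.norm_natCast] at h3
  have h4 := h3.trans_le (norm_add_le _ _)
  rw [← sub_le_iff_le_add', le_div_iff₀ hH']
  linarith

section Integral

variable {X : Type*} [MeasurableSpace X] {μ : Measure X} [IsProbabilityMeasure μ]

lemma integral_le_sqrt_integral_sq {g : X → ℝ} (hg : Integrable g μ)
    (hg2 : Integrable (fun x => g x ^ 2) μ) : ∫ x, g x ∂μ ≤ √(∫ x, g x ^ 2 ∂μ) := by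
  apply Real.le_sqrt_of_sq_le
  have h : 0 ≤ ∫ x, (g x - ∫ y, g y ∂μ) ^ 2 ∂μ := integral_nonneg fun x => sq_nonneg _
  have h2 : ∫ x, (g x - ∫ y, g y ∂μ) ^ 2 ∂μ
      = ∫ x, g x ^ 2 - 2 * (∫ y, g y ∂μ) * g x + (∫ y, g y ∂μ) ^ 2 ∂μ :=
    integral_congr_ae (.of_forall fun x => by ring)
  have hgm := hg.const_mul (2 * ∫ y, g y ∂μ)
  rw [h2, integral_add (by exact hg2.sub hgm) (integrable_const _), integral_sub hg2 hgm,
    integral_const_mul] at h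
  simp at h
  linarith

lemma integrable_of_measurable_of_abs_le {g : X → ℝ} (hg : Measurable g) {C : ℝ}
    (hC : ∀ x, |g x| ≤ C) : Integrable g μ :=
  Integrable.of_bound hg.aestronglyMeasurable C (.of_forall hC)

lemma abs_mul_le_one {a b : ℝ} (ha : |a| ≤ 1) (hb : |b| ≤ 1) : |a * b| ≤ 1 := by
  rw [abs_mul]; exact mul_le_one₀ ha (abs_nonneg _) hb

lemma norm_sq_sum_mul_ofReal (H : ℕ) (e : ℕ → ℂ) (w : ℕ → ℝ) :
    ‖∑ h ∈ range H, e h * (w h : ℂ)‖ ^ 2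
      = ∑ h ∈ range H, ∑ k ∈ range H, (e h * starRingEnd ℂ (e k)).re * (w h * w k) := by
  have h1 : ((‖∑ h ∈ range H, e h * (w h : ℂ)‖ ^ 2 : ℝ) : ℂ)
      = ∑ h ∈ range H, ∑ k ∈ range H, (e h * starRingEnd ℂ (e k)) * ((w h * w k : ℝ) : ℂ) := by
    push_cast
    rw [← Complex.mul_conj', map_sum, sum_mul_sum]
    refine sum_congr rfl fun h _ => sum_congr rfl fun k _ => ?_
    rw [map_mul, Complex.conj_ofReal]
    ring
  have h2 := congrArg Complex.re h1
  rw [Complex.ofReal_re] at h2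
  rw [h2, Complex.re_sum]
  refine sum_congr rfl fun h _ => ?_
  rw [Complex.re_sum]
  refine sum_congr rfl fun k _ => ?_
  rw [Complex.re_mul_ofReal]

/-- Van der Corput's inequality, for a sequence of real functions twisted by a character. -/
lemma norm_sum_mul_integral_le_vanDerCorput {e : ℕ → ℂ} (he : ∀ n, ‖e n‖ = 1)
    (hee : ∀ n h k, e (n + h) * starRingEnd ℂ (e (n + k)) = e h * starRingEnd ℂ (e k))
    {w : ℕ → X → ℝ} (hw : ∀ n, Measurable (w n)) (hw1 : ∀ n x, |w n x| ≤ 1)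
    {f : X → ℝ} (hf : Measurable f) (hf1 : ∀ x, |f x| ≤ 1) (K : ℕ) {H : ℕ} (hH : 0 < H) :
    ‖∑ n ∈ range K, e n * ((∫ x, w n x * f x ∂μ : ℝ) : ℂ)‖ ≤
      2 * H + √(K * ∑ h ∈ range H, ∑ k ∈ range H,
        |∑ n ∈ range K, ∫ x, w (n + h) x * w (n + k) x ∂μ|) / H := by
  have hint : ∀ n, Integrable (fun x => w n x * f x) μ := fun n =>
    integrable_of_measurable_of_abs_le ((hw n).mul hf) fun x => abs_mul_le_one (hw1 n x) (hf1 x)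
  have hint2 : ∀ n m, Integrable (fun x => w n x * w m x) μ := fun n m =>
    integrable_of_measurable_of_abs_le ((hw n).mul (hw m)) fun x =>
      abs_mul_le_one (hw1 n x) (hw1 m x)
  have hz1 : ∀ x n, ‖e n * (w n x : ℂ)‖ ≤ 1 := fun x n => by
    rw [norm_mul, he, one_mul, Complex.norm_real]; exact hw1 n x
  set W : X → ℝ := fun x => ‖∑ n ∈ range K, ∑ h ∈ range H, e (n + h) * (w (n + h) x : ℂ)‖ with hW
  have hWm : Measurable W := by
    have := fun n => Complex.measurable_ofReal.comp (hw n)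
    simp only [hW]
    refine Measurable.norm (Finset.measurable_sum _ fun n _ => Finset.measurable_sum _ fun h _ =>
      (this (n + h)).const_mul _)
  have hWb : ∀ x, |W x| ≤ K * H := fun x => by
    rw [hW, abs_norm]
    refine (norm_sum_le_of_le (n := fun _ => (H : ℝ)) _ fun n _ => ?_).trans (by simp)
    exact (norm_sum_le_of_le _ fun h _ => hz1 x _).trans (by simp)
  have hWi : Integrable W μ := integrable_of_measurable_of_abs_le hWm hWb
  have hW2i : Integrable (fun x => W x ^ 2) μ :=
    integrable_of_measurable_of_abs_le (hWm.pow_const 2) (C := (K * H) ^ 2) fun x => by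
      rw [abs_pow]; exact pow_le_pow_left₀ (abs_nonneg _) (hWb x) 2
  have hfirst : ‖∑ n ∈ range K, e n * ((∫ x, w n x * f x ∂μ : ℝ) : ℂ)‖
      ≤ ∫ x, (2 * H + W x / H) ∂μ := by
    have h1 : ∑ n ∈ range K, e n * ((∫ x, w n x * f x ∂μ : ℝ) : ℂ)
        = ∫ x, ∑ n ∈ range K, e n * ((w n x * f x : ℝ) : ℂ) ∂μ := by
      rw [integral_finsetSum _ fun n _ => (hint n).ofReal.const_mul _]
      refine sum_congr rfl fun n _ => ?_
      rw [integral_const_mul]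
      exact congrArg (e n * ·) (integral_ofReal (𝕜 := ℂ)).symm
    rw [h1]
    refine norm_integral_le_of_norm_le ((integrable_const _).add (hWi.div_const _))
      (.of_forall fun x => ?_)
    have h2 : ∑ n ∈ range K, e n * ((w n x * f x : ℝ) : ℂ)
        = (∑ n ∈ range K, e n * (w n x : ℂ)) * (f x : ℂ) := by
      rw [sum_mul]
      refine sum_congr rfl fun n _ => ?_
      push_cast
      ring
    rw [h2, norm_mul, Complex.norm_real]
    refine (mul_le_of_le_one_right (norm_nonneg _) (hf1 x)).trans ?_
    exact norm_sum_range_le_add_norm_sum_window (hz1 x) K hH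
  refine hfirst.trans ?_
  rw [integral_add (integrable_const _) (hWi.div_const _), integral_div]
  simp only [integral_const, probReal_univ, one_smul]
  gcongr
  refine (integral_le_sqrt_integral_sq hWi hW2i).trans (Real.sqrt_le_sqrt ?_)
  have hi3 : ∀ n h k, Integrable (fun x =>
      (e h * starRingEnd ℂ (e k)).re * (w (n + h) x * w (n + k) x)) μ :=
    fun n h k => (hint2 _ _).const_mul _
  have hpt : ∀ x, W x ^ 2 ≤ K * ∑ h ∈ range H, ∑ k ∈ range H, ∑ n ∈ range K,
      (e h * starRingEnd ℂ (e k)).re * (w (n + h) x * w (n + k) x) := by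
    intro x
    have h1 : W x ^ 2 ≤ K * ∑ n ∈ range K,
        ‖∑ h ∈ range H, e (n + h) * (w (n + h) x : ℂ)‖ ^ 2 := by
      refine (pow_le_pow_left₀ (norm_nonneg _) (norm_sum_le _ _) 2).trans ?_
      simpa using sq_sum_le_card_mul_sum_sq (s := range K)
        (f := fun n => ‖∑ h ∈ range H, e (n + h) * (w (n + h) x : ℂ)‖)
    refine h1.trans_eq ?_
    congr 1
    have h2 : ∀ n, ‖∑ h ∈ range H, e (n + h) * (w (n + h) x : ℂ)‖ ^ 2
        = ∑ h ∈ range H, ∑ k ∈ range H,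
          (e h * starRingEnd ℂ (e k)).re * (w (n + h) x * w (n + k) x) := fun n => by
      rw [norm_sq_sum_mul_ofReal H (fun h => e (n + h)) (fun h => w (n + h) x)]
      simp only [hee]
    simp only [h2]
    rw [sum_comm]
    exact sum_congr rfl fun h _ => sum_comm
  have hi4 : Integrable (fun x => ∑ h ∈ range H, ∑ k ∈ range H, ∑ n ∈ range K,
      (e h * starRingEnd ℂ (e k)).re * (w (n + h) x * w (n + k) x)) μ :=
    integrable_finsetSum _ fun h _ => integrable_finsetSum _ fun k _ =>
      integrable_finsetSum _ fun n _ => hi3 n h k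
  refine (integral_mono hW2i (hi4.const_mul _) hpt).trans ?_
  rw [integral_const_mul]
  gcongr
  rw [integral_finsetSum _ fun h _ => integrable_finsetSum _ fun k _ =>
      integrable_finsetSum _ fun n _ => hi3 n h k]
  gcongr with h
  rw [integral_finsetSum _ fun k _ => integrable_finsetSum _ fun n _ => hi3 n h k]
  gcongr with k
  rw [integral_finsetSum _ fun n _ => hi3 n h k]
  simp only [integral_const_mul]
  rw [← mul_sum]
  refine (le_abs_self _).trans ?_
  rw [abs_mul]
  refine mul_le_of_le_one_left (abs_nonneg _) ((Complex.abs_re_le_norm _).trans ?_)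
  simp [he]

lemma abs_sum_integral_mul_le_sqrt {F : ℕ → X → ℝ} (hF : ∀ n, Measurable (F n))
    (hF1 : ∀ n x, |F n x| ≤ 1) {g : X → ℝ} (hg : Measurable g) (hg1 : ∀ x, |g x| ≤ 1) (K : ℕ) :
    |∑ n ∈ range K, ∫ x, F n x * g x ∂μ|
      ≤ √(∑ i ∈ range K, ∑ j ∈ range K, ∫ x, F i x * F j x ∂μ) := by
  have hint : ∀ n, Integrable (fun x => F n x * g x) μ := fun n =>
    integrable_of_measurable_of_abs_le ((hF n).mul hg) fun x => abs_mul_le_one (hF1 n x) (hg1 x)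
  have hint2 : ∀ n m, Integrable (fun x => F n x * F m x) μ := fun n m =>
    integrable_of_measurable_of_abs_le ((hF n).mul (hF m)) fun x =>
      abs_mul_le_one (hF1 n x) (hF1 m x)
  have hsq : ∀ x, |∑ n ∈ range K, F n x| ^ 2
      = ∑ i ∈ range K, ∑ j ∈ range K, F i x * F j x := fun x => by
    rw [sq_abs, sq, sum_mul_sum]
  have hi : Integrable (fun x => |∑ n ∈ range K, F n x|) μ :=
    (integrable_finsetSum _ fun n _ => integrable_of_measurable_of_abs_le (hF n) (hF1 n)).abs
  have hi2 : Integrable (fun x => |∑ n ∈ range K, F n x| ^ 2) μ := by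
    simp only [hsq]
    exact integrable_finsetSum _ fun i _ => integrable_finsetSum _ fun j _ => hint2 i j
  have h1 := integral_le_sqrt_integral_sq hi hi2
  simp only [hsq] at h1
  rw [integral_finsetSum _ fun i _ => integrable_finsetSum _ fun j _ => hint2 i j] at h1
  simp only [integral_finsetSum _ fun j _ => hint2 _ j] at h1
  refine le_trans ?_ h1
  rw [← integral_finsetSum _ fun n _ => hint n, ← Real.norm_eq_abs]
  refine norm_integral_le_of_norm_le hi (.of_forall fun x => ?_)
  rw [← sum_mul, Real.norm_eq_abs, abs_mul]
  exact mul_le_of_le_one_right (abs_nonneg _) (hg1 x)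

lemma measurePreserving_toEquiv_zpow {X : Type*} [MeasurableSpace X] {μ : Measure X}
    {T : X ≃ᵐ X} (hT : MeasurePreserving T μ μ) (n : ℤ) :
    MeasurePreserving ⇑(T.toEquiv ^ n) μ μ := by
  have hnat : ∀ k : ℕ, MeasurePreserving ⇑(T.toEquiv ^ k) μ μ := fun k => by
    rw [← Equiv.Perm.iterate_eq_pow]; exact hT.iterate k
  obtain ⟨k, rfl | rfl⟩ := n.eq_nat_or_neg
  · simpa using hnat k
  · have hinv : MeasurePreserving ⇑(T.toEquiv⁻¹) μ μ := hT.symm T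
    rw [zpow_neg, zpow_natCast, ← inv_pow, ← Equiv.Perm.iterate_eq_pow]
    exact hinv.iterate k

lemma integral_comp_toEquiv_zpow {X : Type*} [MeasurableSpace X] {μ : Measure X}
    {T : X ≃ᵐ X} (hT : MeasurePreserving T μ μ) (n : ℤ) {g : X → ℝ} (hg : Measurable g) :
    ∫ x, g ((T.toEquiv ^ n) x) ∂μ = ∫ x, g x ∂μ := by
  have h := measurePreserving_toEquiv_zpow hT n
  conv_rhs => rw [← h.map_eq]
  exact (integral_map h.measurable.aemeasurable hg.aestronglyMeasurable).symm

lemma integral_mul_comp_neg_zpow {X : Type*} [MeasurableSpace X] {μ : Measure X}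
    {T : X ≃ᵐ X} (hT : MeasurePreserving T μ μ) {F : X → ℝ} (hF : Measurable F) (m n : ℤ) :
    ∫ x, F ((T.toEquiv ^ (-m)) x) * F ((T.toEquiv ^ (-n)) x) ∂μ
      = ∫ x, F x * F ((T.toEquiv ^ (m - n).natAbs) x) ∂μ := by
  have key : ∀ m : ℤ, ∀ d : ℕ,
      ∫ x, F ((T.toEquiv ^ (-m)) x) * F ((T.toEquiv ^ (-(m + d))) x) ∂μ
        = ∫ x, F x * F ((T.toEquiv ^ d) x) ∂μ := by
    intro m d
    have hm : ∀ k : ℤ, Measurable fun x => F ((T.toEquiv ^ k) x) := fun k =>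
      hF.comp (measurePreserving_toEquiv_zpow hT k).measurable
    rw [← integral_comp_toEquiv_zpow hT (m + d) (g := fun x =>
      F ((T.toEquiv ^ (-m)) x) * F ((T.toEquiv ^ (-(m + d))) x)) ((hm _).mul (hm _))]
    refine integral_congr_ae (.of_forall fun x => ?_)
    simp only [← Equiv.Perm.mul_apply, ← zpow_add]
    rw [neg_add_cancel, show -m + (m + d) = (d : ℤ) by ring, zpow_zero, zpow_natCast]
    exact mul_comm _ _
  rcases le_total m n with h | h
  · have := key m (m - n).natAbs
    rwa [show m + ((m - n).natAbs : ℤ) = n by omega] at this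
  · have := key n (m - n).natAbs
    rw [show n + ((m - n).natAbs : ℤ) = m by omega] at this
    rw [← this]
    exact integral_congr_ae (.of_forall fun x => mul_comm _ _)

end Integral

section System

variable {X : Type*} [MeasurableSpace X] {μ : Measure X} {T₁ T₂ : X ≃ᵐ X}

lemma commute_toEquiv (hcomm : ∀ x, T₁ (T₂ x) = T₂ (T₁ x)) :
    Commute (T₁.toEquiv : Equiv.Perm X) T₂.toEquiv :=
  Equiv.ext hcomm

lemma toEquiv_zpow_comm (hcomm : ∀ x, T₁ (T₂ x) = T₂ (T₁ x)) (m n : ℤ) (x : X) :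
    (T₁.toEquiv ^ m) ((T₂.toEquiv ^ n) x) = (T₂.toEquiv ^ n) ((T₁.toEquiv ^ m) x) :=
  DFunLike.congr_fun ((commute_toEquiv hcomm).zpow_zpow m n) x

lemma measurable_toEquiv_zpow (T : X ≃ᵐ X) (n : ℤ) : Measurable ⇑(T.toEquiv ^ n) := by
  obtain ⟨k, rfl | rfl⟩ := n.eq_nat_or_neg
  · rw [zpow_natCast, ← Equiv.Perm.iterate_eq_pow]
    exact T.measurable.iterate k
  · rw [zpow_neg, zpow_natCast, ← inv_pow, ← Equiv.Perm.iterate_eq_pow]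
    exact T.symm.measurable.iterate k

lemma integral_mul_shift_eq (h₁ : MeasurePreserving T₁ μ μ) (h₂ : MeasurePreserving T₂ μ μ)
    (hcomm : ∀ x, T₁ (T₂ x) = T₂ (T₁ x)) {f₀ f₁ : X → ℝ} (hm₀ : Measurable f₀)
    (hm₁ : Measurable f₁) (m : ℤ) (d : ℕ) :
    ∫ x, (f₀ ((T₂.toEquiv ^ (-m)) x) * f₁ ((T₁.toEquiv ^ m) ((T₂.toEquiv ^ (-m)) x))) *
        (f₀ ((T₂.toEquiv ^ (-(m + d))) x) *
          f₁ ((T₁.toEquiv ^ (m + d)) ((T₂.toEquiv ^ (-(m + d))) x))) ∂μ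
      = ∫ x, (fun y => f₀ y * f₀ (T₂^[d] y)) ((T₁.toEquiv ^ (-m)) x) *
        (f₁ (T₂^[d] x) * f₁ (T₁^[d] x)) ∂μ := by
  have hP := measurable_toEquiv_zpow T₁
  have hQ := measurable_toEquiv_zpow T₂
  rw [← integral_comp_toEquiv_zpow h₂ (m + d), ← integral_comp_toEquiv_zpow h₁ (-m)]
  · refine integral_congr_ae (.of_forall fun x => ?_)
    have e1 : ∀ y, (T₂.toEquiv ^ (-m)) ((T₂.toEquiv ^ (m + d)) y) = T₂^[d] y := fun y => by
      rw [← Equiv.Perm.mul_apply, ← zpow_add, show -m + (m + d) = (d : ℤ) by ring, zpow_natCast,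
        ← Equiv.Perm.iterate_eq_pow]
      rfl
    have e2 : ∀ y, (T₂.toEquiv ^ (-(m + d))) ((T₂.toEquiv ^ (m + d)) y) = y := fun y => by
      rw [← Equiv.Perm.mul_apply, ← zpow_add, neg_add_cancel, zpow_zero]
      rfl
    have e3 : (T₁.toEquiv ^ (m + d)) ((T₁.toEquiv ^ (-m)) x) = T₁^[d] x := by
      rw [← Equiv.Perm.mul_apply, ← zpow_add, show m + d + -m = (d : ℤ) by ring, zpow_natCast,
        ← Equiv.Perm.iterate_eq_pow]
      rfl
    have e4 : (T₁.toEquiv ^ m) (T₂^[d] ((T₁.toEquiv ^ (-m)) x)) = T₂^[d] x := by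
      have h5 : ∀ y, T₂^[d] y = (T₂.toEquiv ^ (d : ℤ)) y := fun y => by
        rw [zpow_natCast, ← Equiv.Perm.iterate_eq_pow]
        rfl
      rw [h5, h5, toEquiv_zpow_comm hcomm, ← Equiv.Perm.mul_apply (T₁.toEquiv ^ m), ← zpow_add,
        add_neg_cancel, zpow_zero]
      rfl
    simp only [e1, e2, e3, e4]
    ring
  · have := hP m
    have := hP (m + d)
    have := hQ (-m)
    have := hQ (-(m + d))
    have := hQ (m + d)
    fun_prop
  · have := hP m
    have := hP (m + d)
    have := hQ (-m)
    have := hQ (-(m + d))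
    fun_prop

/-- The correlation averaged to form the box seminorm. -/
noncomputable def boxCorrelation (μ : Measure X) (T₁ T₂ : X → X) (f : X → ℝ) (d k : ℕ) : ℝ :=
  ∫ x, f x * f (T₁^[k] x) * f (T₂^[d] x) * f (T₁^[k] (T₂^[d] x)) ∂μ

lemma boxCorrelation_natAbs_sub (h₁ : MeasurePreserving T₁ μ μ)
    (hcomm : ∀ x, T₁ (T₂ x) = T₂ (T₁ x)) {f : X → ℝ} (hf : Measurable f) (d : ℕ) (m n : ℤ) :
    boxCorrelation μ T₁ T₂ f d (m - n).natAbs =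
      ∫ x, (fun y => f y * f (T₂^[d] y)) ((T₁.toEquiv ^ (-m)) x) *
        (fun y => f y * f (T₂^[d] y)) ((T₁.toEquiv ^ (-n)) x) ∂μ := by
  rw [integral_mul_comp_neg_zpow h₁ (F := fun y => f y * f (T₂^[d] y))
    (hf.mul (hf.comp (T₂.measurable.iterate d)))]
  refine integral_congr_ae (.of_forall fun x => ?_)
  have hc : T₂^[d] (T₁^[(m - n).natAbs] x) = T₁^[(m - n).natAbs] (T₂^[d] x) :=
    (Function.Commute.iterate_iterate (fun y => (hcomm y).symm) _ _) x
  have hp : (T₁.toEquiv ^ (m - n).natAbs) x = T₁^[(m - n).natAbs] x := by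
    rw [← Equiv.Perm.iterate_eq_pow]
    rfl
  simp only [hp, hc]
  ring

variable [IsProbabilityMeasure μ]

lemma abs_sum_integral_mul_shift_le (h₁ : MeasurePreserving T₁ μ μ)
    (h₂ : MeasurePreserving T₂ μ μ) (hcomm : ∀ x, T₁ (T₂ x) = T₂ (T₁ x)) {f₀ f₁ : X → ℝ}
    (hm₀ : Measurable f₀) (hm₁ : Measurable f₁) (hb₀ : ∀ x, |f₀ x| ≤ 1) (hb₁ : ∀ x, |f₁ x| ≤ 1)
    {w : ℤ → X → ℝ} (hw : ∀ m x, w m x =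
      f₀ ((T₂.toEquiv ^ (-m)) x) * f₁ ((T₁.toEquiv ^ m) ((T₂.toEquiv ^ (-m)) x)))
    (M : ℤ) (K h k : ℕ) :
    |∑ n ∈ range K, ∫ x, w (M + (n + h : ℕ)) x * w (M + (n + k : ℕ)) x ∂μ| ≤
      √(∑ i ∈ range K, ∑ j ∈ range K,
        boxCorrelation μ T₁ T₂ f₀ ((h : ℤ) - k).natAbs ((i : ℤ) - j).natAbs) := by
  wlog hhk : h ≤ k generalizing h k
  · have := this k h (le_of_not_ge hhk)
    rw [show ((h : ℤ) - k).natAbs = ((k : ℤ) - h).natAbs by omega]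
    simpa only [mul_comm] using this
  obtain ⟨d, rfl⟩ := Nat.exists_eq_add_of_le hhk
  rw [show ((h : ℤ) - (h + d : ℕ)).natAbs = d by omega]
  set F : X → ℝ := fun y => f₀ y * f₀ (T₂^[d] y) with hF
  have hFm : Measurable F := hm₀.mul (hm₀.comp (T₂.measurable.iterate d))
  have hterm : ∀ n : ℕ, ∫ x, w (M + (n + h : ℕ)) x * w (M + (n + (h + d) : ℕ)) x ∂μ
      = ∫ x, F ((T₁.toEquiv ^ (-(M + (n + h : ℕ)))) x) * (f₁ (T₂^[d] x) * f₁ (T₁^[d] x)) ∂μ := by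
    intro n
    rw [← integral_mul_shift_eq h₁ h₂ hcomm hm₀ hm₁]
    refine integral_congr_ae (.of_forall fun x => ?_)
    simp only [hw]
    rw [show M + ((n + (h + d) : ℕ) : ℤ) = M + ((n + h : ℕ) : ℤ) + d by push_cast; ring]
  have hbox : ∀ i j : ℕ, ∫ x, F ((T₁.toEquiv ^ (-(M + (i + h : ℕ)))) x) *
      F ((T₁.toEquiv ^ (-(M + (j + h : ℕ)))) x) ∂μ
      = boxCorrelation μ T₁ T₂ f₀ d ((i : ℤ) - j).natAbs := by
    intro i j
    rw [← show (M + ((i + h : ℕ) : ℤ) - (M + ((j + h : ℕ) : ℤ))) = (i : ℤ) - j by push_cast; ring]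
    exact (boxCorrelation_natAbs_sub h₁ hcomm hm₀ d _ _).symm
  simp only [hterm, ← hbox]
  exact abs_sum_integral_mul_le_sqrt
    (fun n => hFm.comp (measurable_toEquiv_zpow T₁ _))
    (fun n x => abs_mul_le_one (hb₀ _) (hb₀ _))
    ((hm₁.comp (T₂.measurable.iterate d)).mul (hm₁.comp (T₁.measurable.iterate d)))
    (fun x => abs_mul_le_one (hb₁ _) (hb₁ _)) K

lemma norm_weighted_average_le (h₁ : MeasurePreserving T₁ μ μ) (h₂ : MeasurePreserving T₂ μ μ)
    (hcomm : ∀ x, T₁ (T₂ x) = T₂ (T₁ x)) {f₀ f₁ f₂ : X → ℝ}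
    (hm₀ : Measurable f₀) (hm₁ : Measurable f₁) (hm₂ : Measurable f₂)
    (hb₀ : ∀ x, |f₀ x| ≤ 1) (hb₁ : ∀ x, |f₁ x| ≤ 1) (hb₂ : ∀ x, |f₂ x| ≤ 1)
    (t : ℝ) (M : ℤ) {K H : ℕ} (hK : 0 < K) (hH : 0 < H) :
    ‖(∑ n ∈ Finset.Ico M (M + K),
          Complex.exp (2 * Real.pi * Complex.I * (n : ℂ) * (t : ℂ)) *
            ((∫ x, f₀ x * f₁ ((T₁.toEquiv ^ n) x) * f₂ ((T₂.toEquiv ^ n) x) ∂μ : ℝ) : ℂ))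
        / (K : ℂ)‖ ≤ 2 * H / K + √((∑ h ∈ range H, ∑ k ∈ range H,
          √((∑ i ∈ range K, ∑ j ∈ range K,
            boxCorrelation μ T₁ T₂ f₀ ((h : ℤ) - k).natAbs ((i : ℤ) - j).natAbs) / (K : ℝ) ^ 2))
          / (H : ℝ) ^ 2) := by
  have hP := measurable_toEquiv_zpow T₁
  have hQ := measurable_toEquiv_zpow T₂
  set w : ℤ → X → ℝ := fun m x =>
    f₀ ((T₂.toEquiv ^ (-m)) x) * f₁ ((T₁.toEquiv ^ m) ((T₂.toEquiv ^ (-m)) x)) with hw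
  set e : ℕ → ℂ := fun n => Complex.exp (((2 * Real.pi * (M + n) * t : ℝ) : ℂ) * Complex.I) with he
  have hwm : ∀ m, Measurable (w m) := fun m =>
    (hm₀.comp (hQ _)).mul (hm₁.comp ((hP _).comp (hQ _)))
  have hsum : ∑ n ∈ Finset.Ico M (M + K),
          Complex.exp (2 * Real.pi * Complex.I * (n : ℂ) * (t : ℂ)) *
            ((∫ x, f₀ x * f₁ ((T₁.toEquiv ^ n) x) * f₂ ((T₂.toEquiv ^ n) x) ∂μ : ℝ) : ℂ)
      = ∑ n ∈ range K, e n * ((∫ x, w (M + n) x * f₂ x ∂μ : ℝ) : ℂ) := by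
    symm
    refine sum_nbij' (fun n => M + n) (fun m => (m - M).toNat) ?_ ?_ ?_ ?_ ?_
    · intro n hn
      have := mem_range.1 hn
      rw [Finset.mem_Ico]
      omega
    · intro m hm
      rw [Finset.mem_Ico] at hm
      rw [mem_range]
      omega
    · intro n _
      simp
    · intro m hm
      rw [Finset.mem_Ico] at hm
      omega
    · intro n _
      congr 1
      · simp only [he]
        congr 1
        push_cast
        ring
      · rw [← integral_comp_toEquiv_zpow h₂ (M + n) (g := fun x => w (M + n) x * f₂ x)
          ((hwm _).mul hm₂)]
        congr 1
        refine integral_congr_ae (.of_forall fun x => ?_)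
        have e2 : (T₂.toEquiv ^ (-(M + (n : ℤ)))) ((T₂.toEquiv ^ (M + (n : ℤ))) x) = x := by
          rw [← Equiv.Perm.mul_apply, ← zpow_add, neg_add_cancel, zpow_zero]
          rfl
        simp only [hw, e2]
  have hvdc := norm_sum_mul_integral_le_vanDerCorput (μ := μ) (e := e)
    (fun n => Complex.norm_exp_ofReal_mul_I _)
    (fun n h k => by
      simp only [he, ← Complex.exp_conj, map_mul, Complex.conj_ofReal, Complex.conj_I,
        ← Complex.exp_add]
      congr 1
      push_cast
      ring)
    (fun n => hwm (M + n)) (fun n x => abs_mul_le_one (hb₀ _) (hb₁ _)) hm₂ hb₂ K hH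
  have hK' : (0 : ℝ) < K := by exact_mod_cast hK
  have hH' : (0 : ℝ) < H := by exact_mod_cast hH
  rw [hsum, norm_div, Complex.norm_natCast, div_le_iff₀ hK']
  refine hvdc.trans ?_
  rw [add_mul, div_mul_cancel₀ _ hK'.ne']
  gcongr
  rw [Real.sqrt_div' _ (by positivity), Real.sqrt_sq hH'.le, div_mul_eq_mul_div]
  gcongr
  apply Real.sqrt_le_iff.2
  refine ⟨by positivity, ?_⟩
  rw [mul_pow, Real.sq_sqrt (by positivity)]
  simp only [Real.sqrt_div' _ (sq_nonneg (K : ℝ)), Real.sqrt_sq hK'.le, ← sum_div]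
  rw [sq (K : ℝ), ← mul_assoc, div_mul_cancel₀ _ hK'.ne', mul_comm (K : ℝ)]
  gcongr with h _ k _
  exact abs_sum_integral_mul_shift_le h₁ h₂ hcomm hm₀ hm₁ hb₀ hb₁ (fun _ _ => rfl) M K h k

lemma sum_boxCorrelation_nonneg (h₁ : MeasurePreserving T₁ μ μ)
    (hcomm : ∀ x, T₁ (T₂ x) = T₂ (T₁ x)) {f₀ : X → ℝ} (hm₀ : Measurable f₀)
    (hb₀ : ∀ x, |f₀ x| ≤ 1) (d K : ℕ) :
    0 ≤ ∑ i ∈ range K, ∑ j ∈ range K, boxCorrelation μ T₁ T₂ f₀ d ((i : ℤ) - j).natAbs := by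
  set F : ℕ → X → ℝ := fun n x =>
    (fun y => f₀ y * f₀ (T₂^[d] y)) ((T₁.toEquiv ^ (-(n : ℤ))) x) with hF
  have hFm : ∀ n, Measurable (F n) := fun n =>
    (hm₀.mul (hm₀.comp (T₂.measurable.iterate d))).comp (measurable_toEquiv_zpow T₁ _)
  have hF1 : ∀ n x, |F n x| ≤ 1 := fun n x => abs_mul_le_one (hb₀ _) (hb₀ _)
  have hint2 : ∀ n m, Integrable (fun x => F n x * F m x) μ := fun n m =>
    integrable_of_measurable_of_abs_le ((hFm n).mul (hFm m)) fun x =>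
      abs_mul_le_one (hF1 n x) (hF1 m x)
  have hsum : ∑ i ∈ range K, ∑ j ∈ range K, boxCorrelation μ T₁ T₂ f₀ d ((i : ℤ) - j).natAbs
      = ∫ x, (∑ n ∈ range K, F n x) ^ 2 ∂μ := by
    simp only [sq, sum_mul_sum]
    rw [integral_finsetSum _ fun i _ => integrable_finsetSum _ fun j _ => hint2 i j]
    refine sum_congr rfl fun i _ => ?_
    rw [integral_finsetSum _ fun j _ => hint2 i j]
    exact sum_congr rfl fun j _ => boxCorrelation_natAbs_sub h₁ hcomm hm₀ d _ _
  rw [hsum]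
  exact integral_nonneg fun x => sq_nonneg _

end System

lemma sum_sqrt_div_le_sqrt {c : ℕ → ℝ} (hc : ∀ n, 0 ≤ c n) {H : ℕ} (hH : 0 < H) :
    (∑ h ∈ range H, ∑ k ∈ range H, √(c ((h : ℤ) - k).natAbs)) / (H : ℝ) ^ 2
      ≤ √((∑ h ∈ range H, ∑ k ∈ range H, c ((h : ℤ) - k).natAbs) / (H : ℝ) ^ 2) := by
  have hH' : (0 : ℝ) < H := by exact_mod_cast hH
  apply Real.le_sqrt_of_sq_le
  rw [div_pow, div_le_div_iff₀ (by positivity) (by positivity)]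
  have h := sq_sum_le_card_mul_sum_sq (s := range H ×ˢ range H)
    (f := fun p : ℕ × ℕ => √(c ((p.1 : ℤ) - p.2).natAbs))
  simp only [Real.sq_sqrt (hc _), sum_product, card_product, card_range] at h
  push_cast at h
  nlinarith [sq_nonneg (H : ℝ), mul_le_mul_of_nonneg_right h (sq_nonneg (H : ℝ))]

end BoxSeminorm

theorem weighted_averages_bounded_by_box_seminorm
    {X : Type*} [MeasurableSpace X] (μ : Measure X) [IsProbabilityMeasure μ]
    (T₁ T₂ : X ≃ᵐ X)
    (h₁ : MeasurePreserving T₁ μ μ) (h₂ : MeasurePreserving T₂ μ μ)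
    (hcomm : ∀ x, T₁ (T₂ x) = T₂ (T₁ x))
    (f₀ f₁ f₂ : X → ℝ)
    (hm₀ : Measurable f₀) (hm₁ : Measurable f₁) (hm₂ : Measurable f₂)
    (hb₀ : ∀ x, |f₀ x| ≤ 1) (hb₁ : ∀ x, |f₁ x| ≤ 1) (hb₂ : ∀ x, |f₂ x| ≤ 1)
    (t : ℝ) (L : ℝ) (hL : 0 ≤ L)
    (hbox : HasBoxAvg μ ⇑T₁ ⇑T₂ f₀ L)
    (M N : ℕ → ℤ) (hMN : Tendsto (fun i => N i - M i) atTop atTop) :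
    limsup (fun i =>
      ‖(∑ n ∈ Finset.Ico (M i) (N i),
          Complex.exp (2 * Real.pi * Complex.I * (n : ℂ) * (t : ℂ)) *
            ((∫ x, f₀ x * f₁ ((T₁.toEquiv ^ n) x) * f₂ ((T₂.toEquiv ^ n) x) ∂μ : ℝ) : ℂ))
        / ((N i - M i : ℤ) : ℂ)‖) atTop ≤ L ^ ((1 : ℝ) / 4) := by
  obtain ⟨c, hc, hcL⟩ := hbox
  have hD : ∀ d, Tendsto (fun K : ℕ => (∑ i ∈ Finset.range K, ∑ j ∈ Finset.range K,
      boxCorrelation μ T₁ T₂ f₀ d ((i : ℤ) - j).natAbs) / (K : ℝ) ^ 2) atTop (nhds (c d)) :=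
    fun d => tendsto_sum_natAbs_sub_div_sq (hc d)
  have hc0 : ∀ d, 0 ≤ c d := fun d => ge_of_tendsto' (hD d) fun K =>
    div_nonneg (sum_boxCorrelation_nonneg h₁ hcomm hm₀ hb₀ d K) (sq_nonneg _)
  have hroot : L ^ ((1 : ℝ) / 4) = √(√L) := by
    rw [Real.sqrt_eq_rpow, Real.sqrt_eq_rpow, ← Real.rpow_mul hL]
    norm_num
  rw [hroot]
  refine le_of_forall_gt_imp_ge_of_dense fun y hy => ?_
  obtain ⟨H, hHy, hH⟩ : ∃ H : ℕ, √(√((∑ h ∈ Finset.range H, ∑ k ∈ Finset.range H,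
      c ((h : ℤ) - k).natAbs) / (H : ℝ) ^ 2)) < y ∧ 0 < H :=
    (((tendsto_sum_natAbs_sub_div_sq hcL).sqrt.sqrt.eventually_lt_const hy).and
      (eventually_gt_atTop 0)).exists
  have hlim : Tendsto (fun K : ℕ => 2 * (H : ℝ) / K + √((∑ h ∈ Finset.range H,
      ∑ k ∈ Finset.range H, √((∑ i ∈ Finset.range K, ∑ j ∈ Finset.range K,
        boxCorrelation μ T₁ T₂ f₀ ((h : ℤ) - k).natAbs ((i : ℤ) - j).natAbs) / (K : ℝ) ^ 2))
        / (H : ℝ) ^ 2)) atTop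
      (nhds (0 + √((∑ h ∈ Finset.range H, ∑ k ∈ Finset.range H,
        √(c ((h : ℤ) - k).natAbs)) / (H : ℝ) ^ 2))) :=
    (tendsto_const_nhds.div_atTop tendsto_natCast_atTop_atTop).add
      (((tendsto_finsetSum _ fun h _ => tendsto_finsetSum _ fun k _ =>
        (hD _).sqrt).div_const _).sqrt)
  have hlt : 0 + √((∑ h ∈ Finset.range H, ∑ k ∈ Finset.range H,
      √(c ((h : ℤ) - k).natAbs)) / (H : ℝ) ^ 2) < y := by
    rw [zero_add]
    exact (Real.sqrt_le_sqrt (sum_sqrt_div_le_sqrt hc0 hH)).trans_lt hHy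
  have hnat : Tendsto (fun i => (N i - M i).toNat) atTop atTop :=
    (tendsto_atTop.2 fun b => (hMN.eventually_ge_atTop (b : ℤ)).mono fun i hi => by omega)
  refine limsup_le_of_le (isCoboundedUnder_le_of_le atTop (x := 0) fun i => norm_nonneg _) ?_
  filter_upwards [hnat.eventually (hlim.eventually_lt_const hlt), hnat.eventually_gt_atTop 0]
    with i hi hpos
  refine le_trans ?_ hi.le
  have hK : ((N i - M i).toNat : ℤ) = N i - M i := by omega
  have hN : N i = M i + ((N i - M i).toNat : ℤ) := by omega
  have hmain := norm_weighted_average_le h₁ h₂ hcomm hm₀ hm₁ hm₂ hb₀ hb₁ hb₂ t (M i) hpos hH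
  rw [← hN] at hmain
  rwa [← hK, Int.cast_natCast]
end

section
/- Let (X, μ, T₁, T₂) be a system and let f be a bounded real-valued measurable function on X. If the box average of f with respect to (T₁, T₂) equals L, then 0 ≤ L ≤ ∫ f⁴ dμ (i.e. the box seminorm of f is at most its L⁴(μ)-norm). -/
open MeasureTheory Filter

/-- If the Cesàro averages of the self-correlations `∫ g · g ∘ T ^ n` of an `L²` function converge,
then the limit is nonnegative. -/
theorem MeasureTheory.MeasurePreserving.cesaro_autocorrelation_nonneg
    {X : Type*} [MeasurableSpace X] {μ : Measure X} {T : X → X} (hT : MeasurePreserving T μ μ)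
    {g : X → ℝ} (hg : MemLp g 2 μ) {c : ℝ}
    (hc : Tendsto (fun N : ℕ => (∑ n ∈ Finset.range N, ∫ x, g x * g (T^[n] x) ∂μ) / (N : ℝ))
      atTop (nhds c)) : 0 ≤ c := by
  let U : Lp ℝ 2 μ →ₗᵢ[ℝ] Lp ℝ 2 μ := Lp.compMeasurePreservingₗᵢ ℝ T hT
  let v : Lp ℝ 2 μ := hg.toLp g
  have hU (n : ℕ) : U^[n] v = (hg.comp_measurePreserving (hT.iterate n)).toLp _ := by
    induction n with
    | zero => rfl
    | succ n ih =>
      rw [Function.iterate_succ_apply', ih]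
      simp only [Function.iterate_succ]
      rfl
  have hinner (n : ℕ) : inner ℝ v (U^[n] v) = ∫ x, g x * g (T^[n] x) ∂μ := by
    rw [hU, L2.inner_def]
    refine integral_congr_ae ?_
    filter_upwards [hg.coeFn_toLp, (hg.comp_measurePreserving (hT.iterate n)).coeFn_toLp]
      with x h h'
    simp [v, h, h', mul_comm]
  have hlim := U.toContinuousLinearMap.tendsto_birkhoffAverage_orthogonalProjection
    U.norm_toContinuousLinearMap_le v
  have hlim' := (tendsto_const_nhds (x := v)).inner (𝕜 := ℝ) hlim
  have heq := tendsto_nhds_unique (hc.congr fun N => ?_) hlim'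
  · rw [heq]
    rw [real_inner_comm]
    exact Submodule.re_inner_starProjection_nonneg
      (U.toContinuousLinearMap.eqLocus (1 : Lp ℝ 2 μ →L[ℝ] Lp ℝ 2 μ)) v
  · simp only [birkhoffAverage, birkhoffSum, inner_smul_right, inner_sum, id]
    rw [div_eq_inv_mul]
    congr 1
    exact Finset.sum_congr rfl fun n _ => (hinner n).symm

theorem mul_mul_mul_le_sum_pow_four_div (a b c d : ℝ) :
    a * b * c * d ≤ (a ^ 4 + b ^ 4 + c ^ 4 + d ^ 4) / 4 := by
  nlinarith [sq_nonneg (a * b - c * d), sq_nonneg (a ^ 2 - b ^ 2), sq_nonneg (c ^ 2 - d ^ 2)]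

/-- If each term of a sequence is at most `B`, then so is the limit of its Cesàro averages. -/
theorem le_of_tendsto_cesaro {u : ℕ → ℝ} {B l : ℝ} (hu : ∀ n, u n ≤ B)
    (hl : Tendsto (fun N : ℕ => (∑ n ∈ Finset.range N, u n) / (N : ℝ)) atTop (nhds l)) :
    l ≤ B := by
  refine le_of_tendsto hl ((eventually_gt_atTop 0).mono fun N hN => ?_)
  rw [div_le_iff₀ (by exact_mod_cast hN), mul_comm]
  simpa using Finset.sum_le_sum fun n (_ : n ∈ Finset.range N) => hu n

/-- The integral of a product of four translates of `f` along measure-preserving maps is at most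
the integral of `f ^ 4`. -/
theorem integral_mul_translates_le {X : Type*} [MeasurableSpace X] {μ : Measure X}
    {f : X → ℝ} (hf : Integrable (fun x => f x ^ 4) μ) (hf' : AEStronglyMeasurable f μ)
    {R S : X → X} (hR : MeasurePreserving R μ μ) (hS : MeasurePreserving S μ μ) :
    ∫ x, f x * f (R x) * f (S x) * f (R (S x)) ∂μ ≤ ∫ x, f x ^ 4 ∂μ := by
  have hcomp {Q : X → X} (hQ : MeasurePreserving Q μ μ) :
      Integrable (fun x => f (Q x) ^ 4) μ ∧ ∫ x, f (Q x) ^ 4 ∂μ = ∫ x, f x ^ 4 ∂μ := by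
    refine ⟨hQ.integrable_comp_of_integrable hf, ?_⟩
    have := integral_map (μ := μ) hQ.aemeasurable (f := fun x => f x ^ 4)
      (by rw [hQ.map_eq]; exact hf.aestronglyMeasurable)
    rw [← this, hQ.map_eq]
  obtain ⟨iR, eR⟩ := hcomp hR
  obtain ⟨iS, eS⟩ := hcomp hS
  obtain ⟨iRS, eRS⟩ := hcomp (hR.comp hS)
  simp only [Function.comp_apply] at iRS eRS
  have hint := (((hf.add iR).add iS).add iRS).div_const 4
  have hbound : ∫ x, f x * f (R x) * f (S x) * f (R (S x)) ∂μ ≤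
      ∫ x, (f x ^ 4 + f (R x) ^ 4 + f (S x) ^ 4 + f (R (S x)) ^ 4) / 4 ∂μ := by
    refine integral_mono (hint.mono' ?_ (.of_forall fun x => ?_)) hint
      fun x => mul_mul_mul_le_sum_pow_four_div _ _ _ _
    · exact ((hf'.mul (hf'.comp_measurePreserving hR)).mul (hf'.comp_measurePreserving hS)).mul
        (hf'.comp_measurePreserving (hR.comp hS))
    · have h := mul_mul_mul_le_sum_pow_four_div |f x| |f (R x)| |f (S x)| |f (R (S x))|
      simpa [abs_mul, Even.pow_abs (show Even 4 by decide)] using h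
  refine hbound.trans_eq ?_
  rw [integral_div, integral_add (by exact (hf.add iR).add iS) iRS,
    integral_add (by exact hf.add iR) iS,
    integral_add hf iR, eR, eS, eRS]
  ring

theorem box_seminorm_le_L4_norm
    {X : Type*} [MeasurableSpace X] (μ : Measure X) [IsProbabilityMeasure μ]
    (T₁ T₂ : X ≃ᵐ X)
    (h₁ : MeasurePreserving T₁ μ μ) (h₂ : MeasurePreserving T₂ μ μ)
    (hcomm : ∀ x, T₁ (T₂ x) = T₂ (T₁ x))
    (f : X → ℝ) (hf : Measurable f) (hfb : ∃ C : ℝ, ∀ x, |f x| ≤ C)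
    (L : ℝ) (hbox : HasBoxAvg μ ⇑T₁ ⇑T₂ f L) :
    0 ≤ L ∧ L ≤ ∫ x, f x ^ 4 ∂μ := by
  obtain ⟨C, hC⟩ := hfb
  obtain ⟨c, hc, hL⟩ := hbox
  constructor
  · refine ge_of_tendsto' hL fun N => div_nonneg (Finset.sum_nonneg fun m _ => ?_) N.cast_nonneg
    have hg : MemLp (fun x => f x * f (T₂^[m] x)) 2 μ := by
      refine MemLp.of_bound (hf.mul (hf.comp (h₂.iterate m).measurable)).aestronglyMeasurable
        (C * C) (.of_forall fun x => ?_)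
      rw [norm_mul]
      exact mul_le_mul (hC _) (hC _) (abs_nonneg _) ((abs_nonneg _).trans (hC x))
    refine h₁.cesaro_autocorrelation_nonneg hg ((hc m).congr fun N => ?_)
    congr 1
    refine Finset.sum_congr rfl fun n _ => integral_congr_ae (.of_forall fun x => ?_)
    simp only [((show Function.Commute T₁ T₂ from hcomm).iterate_iterate n m).eq x]
    ring
  · have hint : Integrable (fun x => f x ^ 4) μ := by
      refine Integrable.of_bound (hf.pow_const 4).aestronglyMeasurable (C ^ 4)
        (.of_forall fun x => ?_)
      rw [norm_pow]
      exact pow_le_pow_left₀ (abs_nonneg _) (hC x) 4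
    exact le_of_tendsto_cesaro (fun m => le_of_tendsto_cesaro (fun n =>
      integral_mul_translates_le hint hf.aestronglyMeasurable (h₁.iterate n) (h₂.iterate m))
      (hc m)) hL
end
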